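/- Suppose the central arrangement A defined by l_1,…,l_p is free, i.e. D(A) is a free R-module. Then for any b ∈ ℂ[s_1,…,s_p], b belongs to the Bernstein ideal B(A) if and only if the polynomial obtained from b by the substitution s_i ↦ −s_i − 2 for every i ∈ {1,…,p} belongs to B(A). -/

import Mathlib

open MvPolynomial

namespace Arrangement

variable {n : ℕ} {ι : Type} [Fintype ι]

/-- The module `D(A)` of logarithmic derivations of the arrangement defined by
the forms `l i`. -/
noncomputable def DA (l : ι → MvPolynomial (Fin n) ℂ) :
    Submodule (MvPolynomial (Fin n) ℂ)
      (Derivation ℂ (MvPolynomial (Fin n) ℂ) (MvPolynomial (Fin n) ℂ)) where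
  carrier := {χ | ∀ i, χ (l i) ∈ Ideal.span {l i}}
  add_mem' := fun hx hy i => by
    simpa using add_mem (hx i) (hy i)
  zero_mem' := fun i => by simp
  smul_mem' := fun r χ hχ i => by
    simpa using Ideal.mul_mem_left _ r (hχ i)

open Classical in
/-- The property characterizing the family of twisted derivatives
`D i = ∂/∂xᵢ + ∑ⱼ sⱼ (∂lⱼ/∂xᵢ)/lⱼ` acting on the localization
`M = ℂ[x,s,1/F]·l^s`. -/
def IsTwisted (l : ι → MvPolynomial (Fin n) ℂ)
    (D : Fin n → Module.End ℂ
      (Localization.Away (rename Sum.inl (∏ i, l i) : MvPolynomial (Fin n ⊕ ι) ℂ))) : Prop :=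
  (∀ (i : Fin n) (r : MvPolynomial (Fin n ⊕ ι) ℂ)
      (m : Localization.Away (rename Sum.inl (∏ i, l i) : MvPolynomial (Fin n ⊕ ι) ℂ)),
      D i (algebraMap _ _ r * m)
        = algebraMap _ _ (pderiv (Sum.inl i) r) * m + algebraMap _ _ r * D i m) ∧
  (∀ i : Fin n,
      algebraMap (MvPolynomial (Fin n ⊕ ι) ℂ) _ (rename Sum.inl (∏ j, l j)) * D i 1
        = algebraMap _ _ (∑ j, X (Sum.inr j) *
            rename Sum.inl (pderiv i (l j) * ∏ k ∈ Finset.univ.erase j, l k)))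

/-- The algebra `W` of operators on `M`, image of the Weyl algebra
`Aₙ(ℂ)[s₁,…,s_p]` acting on `ℂ[x,s,1/F]·l^s`. -/
noncomputable def Wa (l : ι → MvPolynomial (Fin n) ℂ)
    (D : Fin n → Module.End ℂ
      (Localization.Away (rename Sum.inl (∏ i, l i) : MvPolynomial (Fin n ⊕ ι) ℂ))) :
    Subalgebra ℂ (Module.End ℂ
      (Localization.Away (rename Sum.inl (∏ i, l i) : MvPolynomial (Fin n ⊕ ι) ℂ))) :=
  Algebra.adjoin ℂ
    ((Set.range fun i : Fin n =>
        LinearMap.mulLeft ℂ (algebraMap _ _ (X (Sum.inl i) : MvPolynomial (Fin n ⊕ ι) ℂ))) ∪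
     (Set.range fun j : ι =>
        LinearMap.mulLeft ℂ (algebraMap _ _ (X (Sum.inr j) : MvPolynomial (Fin n ⊕ ι) ℂ))) ∪
     Set.range D)

/-- The Bernstein ideal `B(A)`, as the set of polynomials `b(s₁,…,s_p)` such that
`b · l^s = P · l^{s+1}` for some operator `P` in the Weyl algebra. -/
noncomputable def Bideal (l : ι → MvPolynomial (Fin n) ℂ)
    (D : Fin n → Module.End ℂ
      (Localization.Away (rename Sum.inl (∏ i, l i) : MvPolynomial (Fin n ⊕ ι) ℂ))) :
    Set (MvPolynomial ι ℂ) :=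
  {b | ∃ P ∈ Wa l D,
    algebraMap (MvPolynomial (Fin n ⊕ ι) ℂ) _ ((rename Sum.inr b : MvPolynomial (Fin n ⊕ ι) ℂ))
      = P (algebraMap _ _ (rename Sum.inl (∏ i, l i) : MvPolynomial (Fin n ⊕ ι) ℂ))}

/-- The linear functional on `ℂⁿ` associated to a linear form. -/
noncomputable def toLin (f : MvPolynomial (Fin n) ℂ) : (Fin n → ℂ) →ₗ[ℂ] ℂ :=
  ∑ i, f.coeff (Finsupp.single i 1) • LinearMap.proj i

/-- The hyperplane `ker lᵢ ⊆ ℂⁿ`. -/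
noncomputable def hyp (l : ι → MvPolynomial (Fin n) ℂ) (i : ι) : Submodule ℂ (Fin n → ℂ) :=
  LinearMap.ker (toLin (l i))

open Classical in
/-- The intersection lattice `L(A)`: all intersections of nonempty subfamilies. -/
noncomputable def LA (l : ι → MvPolynomial (Fin n) ℂ) : Finset (Submodule ℂ (Fin n → ℂ)) :=
  (Finset.univ.powerset.filter Finset.Nonempty).image fun I : Finset ι => ⨅ i ∈ I, hyp l i

open Classical in
/-- `J(X) = {i : X ⊆ ker lᵢ}`. -/
noncomputable def JX (l : ι → MvPolynomial (Fin n) ℂ) (Y : Submodule ℂ (Fin n → ℂ)) :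
    Finset ι :=
  Finset.univ.filter fun i => Y ≤ hyp l i

/-- `r(X) = n - dim X`, the codimension. -/
noncomputable def rX (Y : Submodule ℂ (Fin n → ℂ)) : ℕ :=
  n - Module.finrank ℂ Y

/-- Irreducibility of the subarrangement with hyperplanes indexed by `J`. -/
def IrredOn (l : ι → MvPolynomial (Fin n) ℂ) (J : Finset ι) : Prop :=
  ¬ ∃ V₁ V₂ : Submodule ℂ (Fin n → ℂ), IsCompl V₁ V₂ ∧
      (∀ i ∈ J, V₁ ≤ hyp l i ∨ V₂ ≤ hyp l i) ∧
      (∃ i ∈ J, V₁ ≤ hyp l i) ∧ (∃ i ∈ J, V₂ ≤ hyp l i)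

open Classical in
/-- `L'(A) = {X ∈ L(A) : A_X irreducible}`. -/
noncomputable def Lprime (l : ι → MvPolynomial (Fin n) ℂ) :
    Finset (Submodule ℂ (Fin n → ℂ)) :=
  (LA l).filter fun Y => IrredOn l (JX l Y)

/-- The polynomial
`b_A = ∏_{X ∈ L'(A)} ∏_{j=0}^{2(card J(X) − r(X))} ((∑_{i ∈ J(X)} sᵢ) + r(X) + j)`. -/
noncomputable def bGen (l : ι → MvPolynomial (Fin n) ℂ) : MvPolynomial ι ℂ :=
  ∏ Y ∈ Lprime l, ∏ j ∈ Finset.range (2 * ((JX l Y).card - rX (n := n) Y) + 1),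
    ((∑ i ∈ JX l Y, X i) + C ((rX (n := n) Y : ℂ) + (j : ℂ)))

end Arrangement

namespace FreeArr

section Fock

variable {n : ℕ} {Y : Type*} [AddCommGroup Y]

/-- The Jordan--Wigner sign of `k` relative to `I`. -/
def sg (k : Fin n) (I : Finset (Fin n)) : ℤ := ∏ j ∈ I, if j < k then -1 else 1

theorem sg_insert {i k : Fin n} {I : Finset (Fin n)} (h : i ∉ I) :
    sg k (insert i I) = (if i < k then -1 else 1) * sg k I := by
  rw [sg, Finset.prod_insert h, sg]

theorem sg_mul_self (k : Fin n) (I : Finset (Fin n)) : sg k I * sg k I = 1 := by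
  rw [sg, ← Finset.prod_mul_distrib]
  exact Finset.prod_eq_one fun j _ => by split_ifs <;> norm_num

theorem sg_insert_comm {i k : Fin n} {I : Finset (Fin n)} (hik : i ≠ k) (hi : i ∉ I)
    (hk : k ∉ I) : sg i I * sg k (insert i I) = -(sg k I * sg i (insert k I)) := by
  rw [sg_insert hi, sg_insert hk]
  rcases lt_or_gt_of_ne hik with h | h
  · simp [h, h.not_gt]; ring
  · simp [h, h.not_gt]; ring

/-- Contraction of the exterior algebra (in the basis indexed by subsets) with a coordinate
covector. -/
def iota (k : Fin n) : (Finset (Fin n) → Y) →+ (Finset (Fin n) → Y) where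
  toFun a I := if k ∈ I then 0 else sg k I • a (insert k I)
  map_zero' := by ext I; simp
  map_add' a b := by ext I; by_cases h : k ∈ I <;> simp [h]

/-- Exterior multiplication by a coordinate vector. -/
def eps (k : Fin n) : (Finset (Fin n) → Y) →+ (Finset (Fin n) → Y) where
  toFun a I := if k ∈ I then sg k (I.erase k) • a (I.erase k) else 0
  map_zero' := by ext I; simp
  map_add' a b := by ext I; by_cases h : k ∈ I <;> simp [h]

theorem iota_apply (k : Fin n) (a : Finset (Fin n) → Y) (I : Finset (Fin n)) :
    iota k a I = if k ∈ I then 0 else sg k I • a (insert k I) := rfl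

theorem eps_apply (k : Fin n) (a : Finset (Fin n) → Y) (I : Finset (Fin n)) :
    eps k a I = if k ∈ I then sg k (I.erase k) • a (I.erase k) else 0 := rfl

theorem iota_smul {T : Type*} [Ring T] [Module T Y] (k : Fin n) (c : T)
    (a : Finset (Fin n) → Y) : iota k (c • a) = c • iota k a := by
  ext I
  simp only [iota_apply, Pi.smul_apply]
  split_ifs
  · simp
  · rw [smul_comm]

theorem eps_smul {T : Type*} [Ring T] [Module T Y] (k : Fin n) (c : T)
    (a : Finset (Fin n) → Y) : eps k (c • a) = c • eps k a := by
  ext I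
  simp only [eps_apply, Pi.smul_apply]
  split_ifs
  · rw [smul_comm]
  · simp

theorem iota_comp {Z : Type*} [AddCommGroup Z] (f : Y →+ Z) (k : Fin n)
    (a : Finset (Fin n) → Y) : iota k (fun I => f (a I)) = fun I => f (iota k a I) := by
  ext I
  simp only [iota_apply]
  split_ifs
  · simp
  · simp

theorem iota_iota_self (k : Fin n) (a : Finset (Fin n) → Y) : iota k (iota k a) = 0 := by
  ext I
  simp [iota_apply]

theorem iota_anticomm (i k : Fin n) (a : Finset (Fin n) → Y) :
    iota i (iota k a) = -iota k (iota i a) := by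
  by_cases hik : i = k
  · subst hik; simp [iota_iota_self]
  ext I
  simp only [iota_apply, Pi.neg_apply, Finset.mem_insert, hik, Ne.symm hik, false_or]
  by_cases hi : i ∈ I <;> by_cases hk : k ∈ I <;> simp only [hi, hk, if_true, if_false, smul_zero,
    neg_zero]
  rw [smul_smul, smul_smul, sg_insert_comm hik hi hk, neg_smul, Finset.insert_comm]

theorem iota_eps_of_ne {i k : Fin n} (hik : i ≠ k) (a : Finset (Fin n) → Y) :
    iota i (eps k a) = -eps k (iota i a) := by
  ext I
  simp only [iota_apply, eps_apply, Pi.neg_apply, Finset.mem_insert, Ne.symm hik, false_or,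
    Finset.mem_erase, ne_eq, hik, not_false_eq_true, true_and]
  by_cases hi : i ∈ I <;> by_cases hk : k ∈ I <;> simp only [hi, hk, if_true, if_false, smul_zero,
    neg_zero]
  have h1 : (insert i I).erase k = insert i (I.erase k) :=
    Finset.erase_insert_of_ne hik
  obtain ⟨J, hkJ, rfl⟩ : ∃ J, k ∉ J ∧ I = insert k J :=
    ⟨I.erase k, Finset.notMem_erase k I, (Finset.insert_erase hk).symm⟩
  rw [h1, Finset.erase_insert hkJ, smul_smul, smul_smul, ← neg_smul]
  have hiJ : i ∉ J := fun h => hi (Finset.mem_insert_of_mem h)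
  congr 1
  have h2 := sg_insert_comm hik hiJ hkJ
  have h3 := sg_mul_self k J
  have h4 := sg_mul_self i J
  rw [sg_insert hiJ, sg_insert hkJ] at *
  rcases lt_or_gt_of_ne hik with h | h
  · simp [h, h.not_gt]; ring
  · simp [h, h.not_gt]; ring

theorem iota_eps_self (k : Fin n) (a : Finset (Fin n) → Y) :
    iota k (eps k a) + eps k (iota k a) = a := by
  ext I
  simp only [iota_apply, eps_apply, Pi.add_apply]
  by_cases hk : k ∈ I
  · simp [hk, smul_smul, sg_mul_self, Finset.insert_erase hk]
  · simp [hk, smul_smul, sg_mul_self]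

theorem sum_eps_iota (a : Finset (Fin n) → Y) (I : Finset (Fin n)) :
    (∑ k, eps k (iota k a)) I = I.card • a I := by
  rw [Finset.sum_apply]
  have : ∀ k, eps k (iota k a) I = if k ∈ I then a I else 0 := by
    intro k
    simp only [iota_apply, eps_apply]
    by_cases hk : k ∈ I
    · simp [hk, smul_smul, sg_mul_self, Finset.insert_erase hk]
    · simp [hk]
  simp [this]

end Fock

section Vec

variable {n : ℕ} {R Y : Type*} [CommRing R] [AddCommGroup Y] [Module R Y]

/-- Apply an additive map to each coefficient. -/
def cw {Z : Type*} [AddCommGroup Z] (f : Y →+ Z) :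
    (Finset (Fin n) → Y) →+ (Finset (Fin n) → Z) where
  toFun a I := f (a I)
  map_zero' := by ext; simp
  map_add' a b := by ext; simp

@[simp] theorem cw_apply {Z : Type*} [AddCommGroup Z] (f : Y →+ Z)
    (a : Finset (Fin n) → Y) (I : Finset (Fin n)) : cw f a I = f (a I) := rfl

theorem iota_cw {Z : Type*} [AddCommGroup Z] (f : Y →+ Z) (k : Fin n)
    (a : Finset (Fin n) → Y) : iota k (cw f a) = cw f (iota k a) := iota_comp f k a

/-- Contraction with a covector. -/
def iv (v : Fin n → R) : (Finset (Fin n) → Y) →ₗ[R] (Finset (Fin n) → Y) where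
  toFun a := ∑ k, v k • iota k a
  map_add' a b := by simp [Finset.sum_add_distrib]
  map_smul' r a := by
    simp only [iota_smul, RingHom.id_apply, Finset.smul_sum]
    exact Finset.sum_congr rfl fun k _ => smul_comm _ _ _

/-- Exterior multiplication by a vector. -/
def ev (v : Fin n → R) : (Finset (Fin n) → Y) →ₗ[R] (Finset (Fin n) → Y) where
  toFun a := ∑ k, v k • eps k a
  map_add' a b := by simp [Finset.sum_add_distrib]
  map_smul' r a := by
    simp only [eps_smul, RingHom.id_apply, Finset.smul_sum]
    exact Finset.sum_congr rfl fun k _ => smul_comm _ _ _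

theorem iv_eq (v : Fin n → R) (a : Finset (Fin n) → Y) : iv v a = ∑ k, v k • iota k a := rfl

theorem ev_eq (v : Fin n → R) (a : Finset (Fin n) → Y) : ev v a = ∑ k, v k • eps k a := rfl

theorem iv_smul {T : Type*} [Ring T] [Module T Y] [SMulCommClass T R Y] (v : Fin n → R) (t : T)
    (a : Finset (Fin n) → Y) : iv v (t • a) = t • iv v a := by
  simp only [iv_eq, iota_smul, Finset.smul_sum]
  exact Finset.sum_congr rfl fun k _ => (smul_comm _ _ _).symm

theorem ev_smul {T : Type*} [Ring T] [Module T Y] [SMulCommClass T R Y] (v : Fin n → R) (t : T)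
    (a : Finset (Fin n) → Y) : ev v (t • a) = t • ev v a := by
  simp only [ev_eq, eps_smul, Finset.smul_sum]
  exact Finset.sum_congr rfl fun k _ => (smul_comm _ _ _).symm

theorem iv_cw {Z : Type*} [AddCommGroup Z] [Module R Z] (f : Y →+ Z) (v : Fin n → R)
    (hf : ∀ k y, f (v k • y) = v k • f y)
    (a : Finset (Fin n) → Y) : iv v (cw f a) = cw f (iv v a) := by
  simp only [iv_eq, iota_cw, map_sum]
  refine Finset.sum_congr rfl fun k _ => ?_
  ext I; simp [hf]

theorem iota_iv (i : Fin n) (v : Fin n → R) (a : Finset (Fin n) → Y) :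
    iota i (iv v a) = - iv v (iota i a) := by
  simp only [iv_eq, map_sum, iota_smul, ← Finset.sum_neg_distrib]
  exact Finset.sum_congr rfl fun k _ => by rw [iota_anticomm, smul_neg]

theorem iv_iv (w v : Fin n → R) (a : Finset (Fin n) → Y) :
    iv w (iv v a) = - iv v (iv w a) := by
  rw [iv_eq w, iv_eq w a, map_sum, ← Finset.sum_neg_distrib]
  exact Finset.sum_congr rfl fun k _ => by rw [iota_iv, map_smul, smul_neg]

theorem iota_ev_add (i : Fin n) (v : Fin n → R) (a : Finset (Fin n) → Y) :
    iota i (ev v a) + ev v (iota i a) = v i • a := by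
  simp only [ev_eq, map_sum, iota_smul, ← Finset.sum_add_distrib, ← smul_add]
  rw [Finset.sum_eq_single i]
  · rw [iota_eps_self]
  · intro k _ hk
    rw [iota_eps_of_ne hk.symm]; simp
  · simp

theorem iv_ev_add (w v : Fin n → R) (a : Finset (Fin n) → Y) :
    iv w (ev v a) + ev v (iv w a) = (∑ k, w k * v k) • a := by
  rw [iv_eq, iv_eq, map_sum, ← Finset.sum_add_distrib, Finset.sum_smul]
  exact Finset.sum_congr rfl fun k _ => by
    rw [map_smul, ← smul_add, iota_ev_add, mul_smul]

theorem sum_ev_iv {m : ℕ} (w A : Fin m → Fin n → R) (F : R)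
    (h : ∀ k k', ∑ i, w i k * A i k' = if k = k' then F else 0) (a : Finset (Fin n) → Y) :
    ∑ i, ev (A i) (iv (w i) a) = F • ∑ k, eps k (iota k a) := by
  have : ∀ i, ev (A i) (iv (w i) a) =
      ∑ k, ∑ k', (w i k * A i k') • eps k' (iota k a) := by
    intro i
    rw [iv_eq, map_sum]
    refine Finset.sum_congr rfl fun k _ => ?_
    rw [map_smul, ev_eq, Finset.smul_sum]
    simp only [mul_smul]
  simp only [this]
  rw [Finset.sum_comm, Finset.smul_sum]
  refine Finset.sum_congr rfl fun k _ => ?_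
  rw [Finset.sum_comm]
  simp only [← Finset.sum_smul, h]
  simp

/-- Homogeneity of degree `k - a`. -/
def Dg (a k : ℕ) (x : Finset (Fin n) → Y) : Prop := ∀ I, I.card + a ≠ k → x I = 0

theorem Dg.iota {a k : ℕ} {x : Finset (Fin n) → Y} (h : Dg a (k + 1) x) (i : Fin n) :
    Dg a k (iota i x) := by
  intro I hI
  rw [iota_apply]
  split_ifs with hi
  · rfl
  · rw [h _ (by rw [Finset.card_insert_of_notMem hi]; omega), smul_zero]

theorem Dg.eps {a k : ℕ} {x : Finset (Fin n) → Y} (h : Dg a k x) (i : Fin n) :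
    Dg a (k + 1) (eps i x) := by
  intro I hI
  rw [eps_apply]
  split_ifs with hi
  · have := Finset.card_erase_add_one hi
    rw [h _ (by omega), smul_zero]
  · rfl

theorem Dg.add {a k : ℕ} {x y : Finset (Fin n) → Y} (h : Dg a k x) (h' : Dg a k y) :
    Dg a k (x + y) := fun I hI => by simp [h I hI, h' I hI]

theorem Dg.neg {a k : ℕ} {x : Finset (Fin n) → Y} (h : Dg a k x) :
    Dg a k (-x) := fun I hI => by simp [h I hI]

theorem Dg.sub {a k : ℕ} {x y : Finset (Fin n) → Y} (h : Dg a k x) (h' : Dg a k y) :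
    Dg a k (x - y) := fun I hI => by simp [h I hI, h' I hI]

theorem Dg.smul {T : Type*} [Ring T] [Module T Y] {a k : ℕ} {x : Finset (Fin n) → Y}
    (h : Dg a k x) (t : T) : Dg a k (t • x) := fun I hI => by simp [h I hI]

theorem Dg.cw {Z : Type*} [AddCommGroup Z] (f : Y →+ Z) {a k : ℕ} {x : Finset (Fin n) → Y}
    (h : Dg a k x) : Dg a k (cw f x) := fun I hI => by simp [h I hI]

theorem Dg.sum {σ : Type*} {s : Finset σ} {a k : ℕ} {x : σ → Finset (Fin n) → Y}
    (h : ∀ i ∈ s, Dg a k (x i)) : Dg a k (∑ i ∈ s, x i) := fun I hI => by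
  rw [Finset.sum_apply]; exact Finset.sum_eq_zero fun i hi => h i hi I hI

theorem Dg.iv {a k : ℕ} {x : Finset (Fin n) → Y} (h : Dg a (k + 1) x) (v : Fin n → R) :
    Dg a k (iv v x) := by
  rw [iv_eq]; exact Dg.sum fun i _ => (h.iota i).smul _

theorem Dg.ev {a k : ℕ} {x : Finset (Fin n) → Y} (h : Dg a k x) (v : Fin n → R) :
    Dg a (k + 1) (ev v x) := by
  rw [ev_eq]; exact Dg.sum fun i _ => (h.eps i).smul _

end Vec

/-- Linear forms `l j`, with coefficient vectors `c j`, acting on a module on which they are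
nonzerodivisors and pairwise coprime. -/
structure Arr (R Y : Type*) [CommRing R] [AddCommGroup Y] [Module R Y] (n p : ℕ) where
  c : Fin p → Fin n → R
  l : Fin p → R
  inj : ∀ j (y : Y), l j • y = 0 → y = 0
  cop : ∀ i j, i ≠ j → ∀ y z : Y, l i • y = l j • z → ∃ w, z = l i • w
  natinv : ∀ k : ℕ, ∃ r : R, r * (k + 1) = 1

namespace Arr

variable {n p : ℕ} {R Y : Type*} [CommRing R] [AddCommGroup Y] [Module R Y] (𝒜 : Arr R Y n p)

/-- The product of the forms. -/
def F : R := ∏ j, 𝒜.l j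

/-- The product of all the forms but one. -/
def Fe (j : Fin p) : R := ∏ k ∈ Finset.univ.erase j, 𝒜.l k

theorem l_mul_Fe (j : Fin p) : 𝒜.l j * 𝒜.Fe j = 𝒜.F :=
  Finset.mul_prod_erase Finset.univ 𝒜.l (Finset.mem_univ j)

theorem inj' (j : Fin p) {a b : Y} (h : 𝒜.l j • a = 𝒜.l j • b) : a = b :=
  sub_eq_zero.1 (𝒜.inj j _ (by rw [smul_sub, h, sub_self]))

theorem injE (j : Fin p) {a b : Finset (Fin n) → Y} (h : 𝒜.l j • a = 𝒜.l j • b) : a = b :=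
  funext fun I => 𝒜.inj' j (congrFun h I)

theorem prod_inj (s : Finset (Fin p)) (y : Y) (h : (∏ j ∈ s, 𝒜.l j) • y = 0) : y = 0 := by
  classical
  induction s using Finset.induction_on generalizing y with
  | empty => simpa using h
  | insert a s ha ih =>
    rw [Finset.prod_insert ha, mul_smul] at h
    exact ih _ (𝒜.inj _ _ h)

theorem F_inj {a b : Y} (h : 𝒜.F • a = 𝒜.F • b) : a = b :=
  sub_eq_zero.1 (𝒜.prod_inj Finset.univ _ (by
    change 𝒜.F • _ = 0
    rw [smul_sub, h, sub_self]))

theorem F_injE {a b : Finset (Fin n) → Y} (h : 𝒜.F • a = 𝒜.F • b) : a = b :=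
  funext fun I => 𝒜.F_inj (congrFun h I)

theorem cop_prod (a : Fin p) (s : Finset (Fin p)) (ha : a ∉ s) (y z : Y)
    (h : 𝒜.l a • y = (∏ j ∈ s, 𝒜.l j) • z) : ∃ w, z = 𝒜.l a • w := by
  classical
  induction s using Finset.induction_on generalizing y z with
  | empty => exact ⟨y, by simpa using h.symm⟩
  | insert b s hb ih =>
    rw [Finset.prod_insert hb, mul_smul] at h
    obtain ⟨w, hw⟩ := 𝒜.cop a b (fun e => ha (e ▸ Finset.mem_insert_self _ _)) _ _ h
    exact ih (fun e => ha (Finset.mem_insert_of_mem e)) _ _ hw.symm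

theorem div_prod (s : Finset (Fin p)) (z : Y) (h : ∀ j ∈ s, ∃ w, z = 𝒜.l j • w) :
    ∃ w, z = (∏ j ∈ s, 𝒜.l j) • w := by
  classical
  induction s using Finset.induction_on with
  | empty => exact ⟨z, by simp⟩
  | insert a s ha ih =>
    obtain ⟨w, hw⟩ := ih fun j hj => h j (Finset.mem_insert_of_mem hj)
    obtain ⟨w', hw'⟩ := h a (Finset.mem_insert_self _ _)
    obtain ⟨y, rfl⟩ := 𝒜.cop_prod a s ha w' w (hw'.symm.trans hw)
    exact ⟨y, by rw [hw, Finset.prod_insert ha, mul_smul, smul_comm]⟩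

theorem div_F (z : Finset (Fin n) → Y) (h : ∀ j, ∃ w, z = 𝒜.l j • w) : ∃ w, z = 𝒜.F • w := by
  have : ∀ I, ∃ w, z I = 𝒜.F • w := fun I => 𝒜.div_prod Finset.univ _ fun j _ => by
    obtain ⟨w, hw⟩ := h j
    exact ⟨w I, congrFun hw I⟩
  choose w hw using this
  exact ⟨w, funext hw⟩

theorem cop' {i j : Fin p} (hij : i ≠ j) (y z : Finset (Fin n) → Y)
    (h : 𝒜.l i • y = 𝒜.l j • z) : ∃ w, z = 𝒜.l i • w := by
  choose w hw using fun I => 𝒜.cop i j hij (y I) (z I) (congrFun h I)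
  exact ⟨w, funext hw⟩

/-- Logarithmic elements. -/
def Log (x : Finset (Fin n) → Y) : Prop := ∀ j, ∃ y, iv (𝒜.c j) x = 𝒜.l j • y

open Classical in
/-- Contraction with the logarithmic covector `c j / l j`. -/
noncomputable def q (j : Fin p) (x : Finset (Fin n) → Y) : Finset (Fin n) → Y :=
  if h : ∃ y, iv (𝒜.c j) x = 𝒜.l j • y then h.choose else 0

variable {𝒜}

theorem q_eq {j : Fin p} {x y : Finset (Fin n) → Y} (h : iv (𝒜.c j) x = 𝒜.l j • y) :
    𝒜.q j x = y := by
  have h' : ∃ y, iv (𝒜.c j) x = 𝒜.l j • y := ⟨y, h⟩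
  rw [q, dif_pos h']
  exact 𝒜.injE j (h'.choose_spec.symm.trans h)

theorem Log.q_spec {x : Finset (Fin n) → Y} (h : 𝒜.Log x) (j : Fin p) :
    iv (𝒜.c j) x = 𝒜.l j • 𝒜.q j x := by
  obtain ⟨y, hy⟩ := h j
  rw [q_eq hy, hy]

theorem log_of {x : Finset (Fin n) → Y} (y : Fin p → Finset (Fin n) → Y)
    (h : ∀ j, iv (𝒜.c j) x = 𝒜.l j • y j) : 𝒜.Log x := fun j => ⟨y j, h j⟩

theorem Log.zero : 𝒜.Log 0 := fun j => ⟨0, by simp⟩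

theorem q_zero (j : Fin p) : 𝒜.q j 0 = 0 := q_eq (by simp)

theorem Log.add_spec {x y : Finset (Fin n) → Y} (h : 𝒜.Log x) (h' : 𝒜.Log y) (j : Fin p) :
    iv (𝒜.c j) (x + y) = 𝒜.l j • (𝒜.q j x + 𝒜.q j y) := by
  rw [map_add, h.q_spec, h'.q_spec, smul_add]

theorem Log.add {x y : Finset (Fin n) → Y} (h : 𝒜.Log x) (h' : 𝒜.Log y) : 𝒜.Log (x + y) :=
  log_of _ (h.add_spec h')

theorem Log.q_add {x y : Finset (Fin n) → Y} (h : 𝒜.Log x) (h' : 𝒜.Log y) (j : Fin p) :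
    𝒜.q j (x + y) = 𝒜.q j x + 𝒜.q j y := q_eq (h.add_spec h' j)

theorem Log.cw_spec {x : Finset (Fin n) → Y} (h : 𝒜.Log x) (f : Y →+ Y)
    (hf : ∀ (r : R) y, f (r • y) = r • f y) (j : Fin p) :
    iv (𝒜.c j) (cw f x) = 𝒜.l j • cw f (𝒜.q j x) := by
  rw [iv_cw f _ fun k y => hf _ y, h.q_spec]
  ext I; simp [hf]

theorem Log.cw {x : Finset (Fin n) → Y} (h : 𝒜.Log x) (f : Y →+ Y)
    (hf : ∀ (r : R) y, f (r • y) = r • f y) : 𝒜.Log (cw f x) :=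
  log_of _ (h.cw_spec f hf)

theorem Log.q_cw {x : Finset (Fin n) → Y} (h : 𝒜.Log x) (f : Y →+ Y)
    (hf : ∀ (r : R) y, f (r • y) = r • f y) (j : Fin p) :
    𝒜.q j (FreeArr.cw f x) = FreeArr.cw f (𝒜.q j x) := q_eq (h.cw_spec f hf j)

theorem Log.smul_spec {T : Type*} [Ring T] [Module T Y] [SMulCommClass T R Y]
    {x : Finset (Fin n) → Y} (h : 𝒜.Log x) (t : T) (j : Fin p) :
    iv (𝒜.c j) (t • x) = 𝒜.l j • (t • 𝒜.q j x) := by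
  rw [iv_smul, h.q_spec, smul_comm]

theorem Log.smul {T : Type*} [Ring T] [Module T Y] [SMulCommClass T R Y]
    {x : Finset (Fin n) → Y} (h : 𝒜.Log x) (t : T) : 𝒜.Log (t • x) :=
  log_of _ (h.smul_spec t)

theorem Log.q_smul {T : Type*} [Ring T] [Module T Y] [SMulCommClass T R Y]
    {x : Finset (Fin n) → Y} (h : 𝒜.Log x) (t : T) (j : Fin p) :
    𝒜.q j (t • x) = t • 𝒜.q j x := q_eq (h.smul_spec t j)

theorem Log.neg {x : Finset (Fin n) → Y} (h : 𝒜.Log x) : 𝒜.Log (-x) := by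
  simpa using h.smul (-1 : R)

theorem Log.q_neg {x : Finset (Fin n) → Y} (h : 𝒜.Log x) (j : Fin p) :
    𝒜.q j (-x) = - 𝒜.q j x := by
  simpa using h.q_smul (-1 : R) j

theorem Log.sub {x y : Finset (Fin n) → Y} (h : 𝒜.Log x) (h' : 𝒜.Log y) : 𝒜.Log (x - y) := by
  rw [sub_eq_add_neg]; exact h.add h'.neg

theorem Log.q_sub {x y : Finset (Fin n) → Y} (h : 𝒜.Log x) (h' : 𝒜.Log y) (j : Fin p) :
    𝒜.q j (x - y) = 𝒜.q j x - 𝒜.q j y := by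
  rw [sub_eq_add_neg, h.q_add h'.neg, h'.q_neg, sub_eq_add_neg]

theorem Log.sum {σ : Type*} {s : Finset σ} {x : σ → Finset (Fin n) → Y}
    (h : ∀ i ∈ s, 𝒜.Log (x i)) : 𝒜.Log (∑ i ∈ s, x i) :=
  Finset.sum_induction _ _ (fun _ _ => Log.add) Log.zero h

theorem Log.q_sum {σ : Type*} {s : Finset σ} {x : σ → Finset (Fin n) → Y}
    (h : ∀ i ∈ s, 𝒜.Log (x i)) (j : Fin p) :
    𝒜.q j (∑ i ∈ s, x i) = ∑ i ∈ s, 𝒜.q j (x i) := by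
  refine q_eq ?_
  rw [map_sum, Finset.smul_sum]
  exact Finset.sum_congr rfl fun i hi => (h i hi).q_spec j

theorem two_inj {x : Finset (Fin n) → Y} (𝒜 : Arr R Y n p) (h : x = -x) : x = 0 := by
  obtain ⟨r, hr⟩ := 𝒜.natinv 1
  have h2 : (2 : R) • x = 0 := by
    rw [two_smul]; nth_rewrite 2 [h]; simp
  have := congrArg (fun y => r • y) h2
  simp only [smul_smul, smul_zero] at this
  rwa [show r * 2 = 1 by rw [← hr]; norm_num, one_smul] at this

theorem iv_self (𝒜 : Arr R Y n p) (v : Fin n → R) (x : Finset (Fin n) → Y) :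
    iv v (iv v x) = 0 := 𝒜.two_inj (iv_iv v v x)

theorem Log.iv_q_self {x : Finset (Fin n) → Y} (h : 𝒜.Log x) (j : Fin p) :
    iv (𝒜.c j) (𝒜.q j x) = 0 := by
  refine 𝒜.injE j ?_
  rw [← map_smul, ← h.q_spec, 𝒜.iv_self, smul_zero]

theorem Log.iota_q {x : Finset (Fin n) → Y} (h : 𝒜.Log x) (k : Fin n) (j : Fin p) :
    iv (𝒜.c j) (iota k x) = 𝒜.l j • (- iota k (𝒜.q j x)) := by
  rw [smul_neg, ← iota_smul, ← h.q_spec, iota_iv, neg_neg]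

theorem Log.iota {x : Finset (Fin n) → Y} (h : 𝒜.Log x) (k : Fin n) : 𝒜.Log (iota k x) :=
  log_of _ (h.iota_q k)

theorem Log.iv_spec {x : Finset (Fin n) → Y} (h : 𝒜.Log x) (v : Fin n → R) (j : Fin p) :
    iv (𝒜.c j) (iv v x) = 𝒜.l j • (- iv v (𝒜.q j x)) := by
  rw [smul_neg, ← map_smul, ← h.q_spec, iv_iv]

theorem Log.iv {x : Finset (Fin n) → Y} (h : 𝒜.Log x) (v : Fin n → R) : 𝒜.Log (iv v x) :=
  log_of _ (h.iv_spec v)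

theorem Log.q {x : Finset (Fin n) → Y} (h : 𝒜.Log x) (j : Fin p) : 𝒜.Log (𝒜.q j x) := by
  intro i
  by_cases hij : i = j
  · subst hij; exact ⟨0, by rw [h.iv_q_self, smul_zero]⟩
  · refine 𝒜.cop' hij (-FreeArr.iv (𝒜.c j) (𝒜.q i x)) _ ?_
    rw [← map_smul, ← h.q_spec, h.iv_spec]

theorem Log.q_q {x : Finset (Fin n) → Y} (h : 𝒜.Log x) (i j : Fin p) :
    𝒜.q i (𝒜.q j x) = - 𝒜.q j (𝒜.q i x) := by
  refine q_eq (𝒜.injE j ?_)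
  rw [← map_smul, ← h.q_spec, h.iv_spec, smul_comm (𝒜.l j), smul_neg (𝒜.l j), ← (h.q i).q_spec]

theorem Log.Dg_q {x : Finset (Fin n) → Y} (h : 𝒜.Log x) {a k : ℕ} (hd : Dg a (k + 1) x)
    (j : Fin p) : Dg a k (𝒜.q j x) := by
  intro I hI
  refine 𝒜.inj j _ ?_
  have := congrFun (h.q_spec j) I
  rw [Pi.smul_apply] at this
  rw [← this, hd.iv _ I hI]

theorem Log.ev_spec {x : Finset (Fin n) → Y} (h : 𝒜.Log x) (v : Fin n → R) (a : Fin p → R)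
    (hv : ∀ j, ∑ k, 𝒜.c j k * v k = 𝒜.l j * a j) (j : Fin p) :
    FreeArr.iv (𝒜.c j) (ev v x) = 𝒜.l j • (a j • x - ev v (𝒜.q j x)) := by
  rw [eq_sub_of_add_eq (iv_ev_add (𝒜.c j) v x), hv, h.q_spec, map_smul, smul_sub, mul_smul]

theorem Log.ev {x : Finset (Fin n) → Y} (h : 𝒜.Log x) (v : Fin n → R) (a : Fin p → R)
    (hv : ∀ j, ∑ k, 𝒜.c j k * v k = 𝒜.l j * a j) : 𝒜.Log (ev v x) :=
  log_of _ (h.ev_spec v a hv)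

theorem Log.q_ev {x : Finset (Fin n) → Y} (h : 𝒜.Log x) (v : Fin n → R) (a : Fin p → R)
    (hv : ∀ j, ∑ k, 𝒜.c j k * v k = 𝒜.l j * a j) (j : Fin p) :
    𝒜.q j (FreeArr.ev v x) = a j • x - FreeArr.ev v (𝒜.q j x) := q_eq (h.ev_spec v a hv j)

end Arr

namespace Arr

variable {n p : ℕ} {R Y : Type*} [CommRing R] [AddCommGroup Y] [Module R Y]

/-- Operators on the coefficients defining a logarithmic Koszul-type differential. -/
structure Dif (𝒜 : Arr R Y n p) (T : Type*) [Ring T] [Module T Y] where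
  A : Fin n → Y →ₗ[T] Y
  B : Fin p → Y →ₗ[T] Y
  γ : ℤ
  AA : ∀ i k y, A i (A k y) = A k (A i y)
  AB : ∀ i j y, A i (B j y) = B j (A i y)
  BB : ∀ i j y, B i (B j y) = B j (B i y)
  B_R : ∀ j (r : R) y, B j (r • y) = r • B j y
  A_c : ∀ i j k y, A i (𝒜.c j k • y) = 𝒜.c j k • A i y
  A_l : ∀ i j y, A i (𝒜.l j • y) = 𝒜.l j • A i y + γ • 𝒜.c j i • y

variable {𝒜 : Arr R Y n p} {T : Type*} [Ring T] [Module T Y]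

namespace Dif

variable (Δ : 𝒜.Dif T)

/-- The part of the differential coming from contractions with coordinate covectors. -/
def dl : (Finset (Fin n) → Y) →+ (Finset (Fin n) → Y) where
  toFun x := ∑ i, cw (Δ.A i).toAddMonoidHom (iota i x)
  map_zero' := by simp
  map_add' x y := by simp [Finset.sum_add_distrib]

theorem dl_eq (x : Finset (Fin n) → Y) :
    Δ.dl x = ∑ i, cw (Δ.A i).toAddMonoidHom (iota i x) := rfl

/-- The part of the differential coming from logarithmic contractions. -/
noncomputable def qB (x : Finset (Fin n) → Y) : Finset (Fin n) → Y :=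
  ∑ j, cw (Δ.B j).toAddMonoidHom (𝒜.q j x)

/-- The differential. -/
noncomputable def d (x : Finset (Fin n) → Y) : Finset (Fin n) → Y := Δ.dl x - Δ.qB x

theorem iv_dl (j : Fin p) (x : Finset (Fin n) → Y) :
    iv (𝒜.c j) (Δ.dl x) = - Δ.dl (iv (𝒜.c j) x) := by
  rw [dl_eq, dl_eq, map_sum, ← Finset.sum_neg_distrib]
  refine Finset.sum_congr rfl fun i _ => ?_
  rw [iv_cw _ _ (fun k y => Δ.A_c i j k y), iota_iv, map_neg, neg_neg]

theorem dl_l (j : Fin p) (x : Finset (Fin n) → Y) :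
    Δ.dl (𝒜.l j • x) = 𝒜.l j • Δ.dl x + Δ.γ • iv (𝒜.c j) x := by
  rw [dl_eq, dl_eq, iv_eq, Finset.smul_sum, Finset.smul_sum, ← Finset.sum_add_distrib]
  refine Finset.sum_congr rfl fun i _ => ?_
  rw [iota_smul]
  ext I
  simp [Δ.A_l]

theorem dl_dl (x : Finset (Fin n) → Y) : Δ.dl (Δ.dl x) = 0 := by
  refine 𝒜.two_inj ?_
  have h : Δ.dl (Δ.dl x) = ∑ i, ∑ k, cw (Δ.A i).toAddMonoidHom
      (cw (Δ.A k).toAddMonoidHom (iota i (iota k x))) := by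
    rw [dl_eq]
    refine Finset.sum_congr rfl fun i _ => ?_
    rw [dl_eq, map_sum, map_sum]
    exact Finset.sum_congr rfl fun k _ => by rw [iota_cw]
  rw [h]
  conv_rhs => rw [Finset.sum_comm]
  rw [← Finset.sum_neg_distrib]
  refine Finset.sum_congr rfl fun i _ => ?_
  rw [← Finset.sum_neg_distrib]
  refine Finset.sum_congr rfl fun k _ => ?_
  rw [iota_anticomm]
  ext I
  simp [Δ.AA i k]

variable {Δ}

theorem log_dl_spec {x : Finset (Fin n) → Y} (h : 𝒜.Log x) (j : Fin p) :
    iv (𝒜.c j) (Δ.dl x) = 𝒜.l j • (- Δ.dl (𝒜.q j x)) := by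
  rw [iv_dl, h.q_spec, dl_l, h.iv_q_self, smul_zero, add_zero, smul_neg]

theorem log_dl {x : Finset (Fin n) → Y} (h : 𝒜.Log x) : 𝒜.Log (Δ.dl x) :=
  log_of _ (log_dl_spec h)

theorem q_dl {x : Finset (Fin n) → Y} (h : 𝒜.Log x) (j : Fin p) :
    𝒜.q j (Δ.dl x) = - Δ.dl (𝒜.q j x) := q_eq (log_dl_spec h j)

theorem log_qB {x : Finset (Fin n) → Y} (h : 𝒜.Log x) : 𝒜.Log (Δ.qB x) :=
  Log.sum fun j _ => (h.q j).cw _ (Δ.B_R j)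

theorem qB_sub {x y : Finset (Fin n) → Y} (h : 𝒜.Log x) (h' : 𝒜.Log y) :
    Δ.qB (x - y) = Δ.qB x - Δ.qB y := by
  simp [qB, h.q_sub h', Finset.sum_sub_distrib]

theorem qB_add {x y : Finset (Fin n) → Y} (h : 𝒜.Log x) (h' : 𝒜.Log y) :
    Δ.qB (x + y) = Δ.qB x + Δ.qB y := by
  simp [qB, h.q_add h', Finset.sum_add_distrib]

theorem qB_qB {x : Finset (Fin n) → Y} (h : 𝒜.Log x) : Δ.qB (Δ.qB x) = 0 := by
  refine 𝒜.two_inj ?_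
  have e : Δ.qB (Δ.qB x) = ∑ i, ∑ k, cw (Δ.B i).toAddMonoidHom
      (cw (Δ.B k).toAddMonoidHom (𝒜.q i (𝒜.q k x))) := by
    rw [qB]
    refine Finset.sum_congr rfl fun i _ => ?_
    rw [qB, Log.q_sum (fun j _ => (h.q j).cw _ (Δ.B_R j)), map_sum]
    exact Finset.sum_congr rfl fun k _ => by rw [(h.q k).q_cw _ (Δ.B_R k)]
  rw [e]
  conv_rhs => rw [Finset.sum_comm]
  rw [← Finset.sum_neg_distrib]
  refine Finset.sum_congr rfl fun i _ => ?_
  rw [← Finset.sum_neg_distrib]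
  refine Finset.sum_congr rfl fun k _ => ?_
  rw [h.q_q]
  ext I
  simp [Δ.BB i k]

theorem dl_cw_B (j : Fin p) (x : Finset (Fin n) → Y) :
    Δ.dl (cw (Δ.B j).toAddMonoidHom x) = cw (Δ.B j).toAddMonoidHom (Δ.dl x) := by
  rw [dl_eq, dl_eq, map_sum]
  refine Finset.sum_congr rfl fun i _ => ?_
  rw [iota_cw]
  ext I
  simp [Δ.AB]

theorem qB_dl {x : Finset (Fin n) → Y} (h : 𝒜.Log x) : Δ.qB (Δ.dl x) = - Δ.dl (Δ.qB x) := by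
  rw [qB, qB, map_sum, ← Finset.sum_neg_distrib]
  exact Finset.sum_congr rfl fun j _ => by rw [q_dl h, map_neg, dl_cw_B]

theorem log_d {x : Finset (Fin n) → Y} (h : 𝒜.Log x) : 𝒜.Log (Δ.d x) :=
  (log_dl h).sub (log_qB h)

theorem d_d {x : Finset (Fin n) → Y} (h : 𝒜.Log x) : Δ.d (Δ.d x) = 0 := by
  rw [d, d, map_sub, qB_sub (log_dl h) (log_qB h), dl_dl, qB_qB h, qB_dl h]
  simp

theorem d_add {x y : Finset (Fin n) → Y} (h : 𝒜.Log x) (h' : 𝒜.Log y) :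
    Δ.d (x + y) = Δ.d x + Δ.d y := by
  rw [d, d, d, map_add, qB_add h h']; abel

theorem d_neg {x : Finset (Fin n) → Y} (h : 𝒜.Log x) : Δ.d (-x) = - Δ.d x := by
  have := d_add (Δ := Δ) h h.neg
  rw [add_neg_cancel] at this
  have h0 : Δ.d (0 : Finset (Fin n) → Y) = 0 := by simp [d, qB, q_zero]
  rw [h0] at this
  exact (neg_eq_of_add_eq_zero_right this.symm).symm

theorem d_smul [SMulCommClass T R Y] {x : Finset (Fin n) → Y} (h : 𝒜.Log x) (t : T) :
    Δ.d (t • x) = t • Δ.d x := by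
  rw [d, d, smul_sub, dl_eq, dl_eq, qB, qB, Finset.smul_sum, Finset.smul_sum]
  congr 1
  · refine Finset.sum_congr rfl fun i _ => ?_
    rw [iota_smul]; ext I; simp
  · refine Finset.sum_congr rfl fun i _ => ?_
    rw [h.q_smul]; ext I; simp

theorem Dg_d {x : Finset (Fin n) → Y} (h : 𝒜.Log x) {a k : ℕ} (hd : Dg a (k + 1) x) :
    Dg a k (Δ.d x) := by
  rw [d, dl_eq, qB]
  exact (Dg.sum fun i _ => (hd.iota i).cw _).sub (Dg.sum fun j _ => (h.Dg_q hd j).cw _)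

variable (Δ)

/-- The differential with all the `B j` shifted by `-γ`. -/
def shift : 𝒜.Dif T where
  A := Δ.A
  B j := Δ.B j - Δ.γ • LinearMap.id
  γ := Δ.γ
  AA := Δ.AA
  AB i j y := by simp [Δ.AB i j y]
  BB i j y := by simp [Δ.BB i j y, smul_sub]; abel
  B_R j r y := by simp [Δ.B_R, smul_sub, smul_comm r]
  A_c := Δ.A_c
  A_l := Δ.A_l

theorem dl_prod {x : Finset (Fin n) → Y} (h : 𝒜.Log x) (s : Finset (Fin p)) :
    Δ.dl ((∏ j ∈ s, 𝒜.l j) • x) = (∏ j ∈ s, 𝒜.l j) • (Δ.dl x + Δ.γ • ∑ j ∈ s, 𝒜.q j x) := by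
  classical
  induction s using Finset.induction_on with
  | empty => simp
  | insert a s ha ih =>
    rw [Finset.prod_insert ha, mul_smul, dl_l, ih, Finset.sum_insert ha, map_smul, h.q_spec,
      smul_comm _ (𝒜.l a), ← smul_comm (𝒜.l a), ← smul_add, mul_smul, smul_comm Δ.γ,
      ← smul_add, smul_add Δ.γ]
    congr 2
    abel

theorem d_F {x : Finset (Fin n) → Y} (h : 𝒜.Log x) :
    Δ.d (𝒜.F • x) = 𝒜.F • Δ.shift.d x := by
  have h1 : Δ.shift.dl x = Δ.dl x := rfl
  have h2 : Δ.shift.qB x = Δ.qB x - Δ.γ • ∑ j, 𝒜.q j x := by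
    rw [qB, qB, Finset.smul_sum, ← Finset.sum_sub_distrib]
    refine Finset.sum_congr rfl fun j _ => ?_
    ext I
    simp [shift]
  have h3 : Δ.qB (𝒜.F • x) = 𝒜.F • Δ.qB x := by
    rw [qB, qB, Finset.smul_sum]
    refine Finset.sum_congr rfl fun j _ => ?_
    rw [h.q_smul]
    ext I
    simp [Δ.B_R]
  rw [d, d, h1, h2, h3, F, dl_prod Δ h]
  simp only [smul_sub, smul_add]
  abel

end Dif

section Complex

variable (𝒜) (T) [SMulCommClass T R Y]

/-- Logarithmic elements which are homogeneous of degree `k - a`. -/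
def Ld (a k : ℕ) : Submodule T (Finset (Fin n) → Y) where
  carrier := {x | 𝒜.Log x ∧ Dg a k x}
  add_mem' h h' := ⟨h.1.add h'.1, h.2.add h'.2⟩
  zero_mem' := ⟨Log.zero, fun _ _ => rfl⟩
  smul_mem' t _ h := ⟨h.1.smul t, h.2.smul t⟩

theorem mem_Ld {a k : ℕ} {x : Finset (Fin n) → Y} : x ∈ 𝒜.Ld T a k ↔ 𝒜.Log x ∧ Dg a k x :=
  Iff.rfl

/-- The terms of the mapping cone of multiplication by `F`. -/
abbrev Cone (k : ℕ) : Type _ := 𝒜.Ld T 0 k × 𝒜.Ld T 1 k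

variable {𝒜} {T}

theorem Ld_one_succ (k : ℕ) : 𝒜.Ld T 1 (k + 1) = 𝒜.Ld T 0 k := by
  ext x; simp [mem_Ld, Dg]

theorem Ld_one_zero {x : Finset (Fin n) → Y} (h : x ∈ 𝒜.Ld T 1 0) : x = 0 :=
  funext fun I => h.2 I (by omega)

theorem Ld_zero_big {x : Finset (Fin n) → Y} {k : ℕ} (hk : n < k) (h : x ∈ 𝒜.Ld T 0 k) :
    x = 0 :=
  funext fun I => h.2 I (by have := I.card_le_univ; simp at this; omega)

theorem cone_big {k : ℕ} (hk : n + 1 < k) (z : 𝒜.Cone T k) : z = 0 := by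
  obtain ⟨⟨x, hx⟩, ⟨y, hy⟩⟩ := z
  obtain ⟨k, rfl⟩ : ∃ m, k = m + 1 := ⟨k - 1, by omega⟩
  have h1 := Ld_zero_big (by omega) hx
  rw [Ld_one_succ] at hy
  have h2 := Ld_zero_big (by omega) hy
  ext1 <;> ext1 <;> assumption

variable (Δ : 𝒜.Dif T)

/-- The differential of the cone of multiplication by `F`. -/
noncomputable def Dif.D (k : ℕ) : 𝒜.Cone T (k + 1) →ₗ[T] 𝒜.Cone T k where
  toFun z := (⟨Δ.d z.1 + 𝒜.F • z.2.1, (Dif.log_d z.1.2.1).add (z.2.2.1.smul _),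
      (Dif.Dg_d z.1.2.1 z.1.2.2).add (Dg.smul (fun I hI => z.2.2.2 I (by omega)) _)⟩,
    ⟨- Δ.shift.d z.2, (Dif.log_d z.2.2.1).neg, (Dif.Dg_d z.2.2.1 z.2.2.2).neg⟩)
  map_add' z w := by
    ext1 <;> ext1
    · simp only [Prod.fst_add, Prod.snd_add, Submodule.coe_add]
      rw [Dif.d_add z.1.2.1 w.1.2.1, smul_add]; abel
    · simp only [Prod.snd_add, Submodule.coe_add]
      rw [Dif.d_add z.2.2.1 w.2.2.1]; abel
  map_smul' t z := by
    ext1 <;> ext1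
    · simp only [Prod.smul_fst, Prod.smul_snd, Submodule.coe_smul, RingHom.id_apply]
      rw [Dif.d_smul z.1.2.1, smul_add]
      congr 1
      ext I
      exact (smul_comm _ _ _).symm
    · simp only [Prod.smul_snd, Submodule.coe_smul, RingHom.id_apply]
      rw [Dif.d_smul z.2.2.1, smul_neg]

theorem Dif.D_fst (k : ℕ) (z : 𝒜.Cone T (k + 1)) :
    ((Δ.D k z).1 : Finset (Fin n) → Y) = Δ.d z.1 + 𝒜.F • z.2.1 := rfl

theorem Dif.D_snd (k : ℕ) (z : 𝒜.Cone T (k + 1)) :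
    ((Δ.D k z).2 : Finset (Fin n) → Y) = - Δ.shift.d z.2 := rfl

theorem Dif.D_D (k : ℕ) (z : 𝒜.Cone T (k + 2)) : Δ.D k (Δ.D (k + 1) z) = 0 := by
  have h1 := z.1.2.1
  have h2 := z.2.2.1
  ext1 <;> ext1
  · rw [Dif.D_fst, Dif.D_fst, Dif.D_snd, Dif.d_add (Dif.log_d h1) (h2.smul _), Dif.d_d h1,
      Dif.d_F Δ h2]
    simp
  · rw [Dif.D_snd, Dif.D_snd, Dif.d_neg (Dif.log_d h2), Dif.d_d h2]
    simp

end Complex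

/-- A dual pair of families witnessing freeness of the module of logarithmic derivations. -/
structure FreeData (𝒜 : Arr R Y n p) (m : ℕ) where
  w : Fin m → Fin n → R
  A : Fin m → Fin n → R
  a : Fin m → Fin p → R
  dual : ∀ k k', ∑ i, w i k * A i k' = if k = k' then 𝒜.F else 0
  adj : ∀ i j, ∃ (h : R) (η : Fin n → R), ∀ k, w i k = h * 𝒜.c j k + 𝒜.l j * η k
  log : ∀ i j, ∑ k, 𝒜.c j k * A i k = 𝒜.l j * a i j

namespace FreeData

variable {m : ℕ} (ℱ : FreeData 𝒜 m)

open Classical in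
/-- The contraction with `w i / F`. -/
noncomputable def κ (i : Fin m) (x : Finset (Fin n) → Y) : Finset (Fin n) → Y :=
  if h : ∃ y, iv (ℱ.w i) x = 𝒜.F • y then h.choose else 0

variable {ℱ}

theorem κ_eq {i : Fin m} {x y : Finset (Fin n) → Y} (h : iv (ℱ.w i) x = 𝒜.F • y) :
    ℱ.κ i x = y := by
  have h' : ∃ y, iv (ℱ.w i) x = 𝒜.F • y := ⟨y, h⟩
  rw [κ, dif_pos h']
  exact 𝒜.F_injE (h'.choose_spec.symm.trans h)

theorem κ_spec {x : Finset (Fin n) → Y} (hx : 𝒜.Log x) (i : Fin m) :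
    iv (ℱ.w i) x = 𝒜.F • ℱ.κ i x := by
  have : ∃ y, iv (ℱ.w i) x = 𝒜.F • y := by
    refine 𝒜.div_F _ fun j => ?_
    obtain ⟨h, η, e⟩ := ℱ.adj i j
    refine ⟨h • 𝒜.q j x + iv η x, ?_⟩
    rw [smul_add, smul_comm, ← hx.q_spec, iv_eq, iv_eq, iv_eq, Finset.smul_sum, Finset.smul_sum,
      ← Finset.sum_add_distrib]
    exact Finset.sum_congr rfl fun k _ => by rw [e, add_smul, mul_smul, mul_smul]
  obtain ⟨y, hy⟩ := this
  rw [κ_eq hy, hy]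

theorem κ_log_spec {x : Finset (Fin n) → Y} (hx : 𝒜.Log x) (i : Fin m) (j : Fin p) :
    iv (𝒜.c j) (ℱ.κ i x) = 𝒜.l j • (- ℱ.κ i (𝒜.q j x)) := by
  refine 𝒜.F_injE ?_
  rw [← map_smul, ← κ_spec hx, smul_comm, smul_neg, ← κ_spec (hx.q j), hx.iv_spec]

theorem κ_log {x : Finset (Fin n) → Y} (hx : 𝒜.Log x) (i : Fin m) : 𝒜.Log (ℱ.κ i x) :=
  log_of _ (κ_log_spec hx i)

theorem κ_Dg {x : Finset (Fin n) → Y} (hx : 𝒜.Log x) (i : Fin m) {a k : ℕ}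
    (h : Dg a (k + 1) x) : Dg a k (ℱ.κ i x) := by
  intro I hI
  refine 𝒜.F_inj ?_
  have := congrFun (κ_spec (ℱ := ℱ) hx i) I
  rw [Pi.smul_apply] at this
  rw [← this, h.iv _ I hI, smul_zero]

variable (ℱ)

theorem sum_ev_κ {x : Finset (Fin n) → Y} (hx : 𝒜.Log x) {k : ℕ} (h : Dg 0 k x) :
    ∑ i, ev (ℱ.A i) (ℱ.κ i x) = (k : R) • x := by
  refine 𝒜.F_injE ?_
  rw [Finset.smul_sum]
  have : ∀ i, 𝒜.F • ev (ℱ.A i) (ℱ.κ i x) = ev (ℱ.A i) (iv (ℱ.w i) x) := fun i => by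
    rw [κ_spec hx, map_smul]
  simp only [this]
  rw [sum_ev_iv _ _ _ ℱ.dual]
  congr 1
  ext I
  rw [sum_eps_iota]
  by_cases hI : I.card = k
  · rw [hI, Pi.smul_apply, Nat.cast_smul_eq_nsmul]
  · simp [h I (by omega)]

variable (T) [SMulCommClass T R Y]

/-- `κ` as a linear map on homogeneous logarithmic elements. -/
noncomputable def κL (k : ℕ) (i : Fin m) : 𝒜.Ld T 0 (k + 1) →ₗ[T] 𝒜.Ld T 0 k where
  toFun x := ⟨ℱ.κ i x, κ_log x.2.1 i, κ_Dg x.2.1 i x.2.2⟩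
  map_add' x y := by
    ext1
    refine κ_eq ?_
    simp only [Submodule.coe_add, map_add, smul_add]
    rw [κ_spec x.2.1, κ_spec y.2.1]
  map_smul' t x := by
    ext1
    refine κ_eq ?_
    simp only [Submodule.coe_smul, RingHom.id_apply]
    rw [iv_smul, κ_spec x.2.1, smul_comm]

/-- Exterior multiplication by `A i` as a linear map on homogeneous logarithmic elements. -/
noncomputable def evL (k : ℕ) (i : Fin m) : 𝒜.Ld T 0 k →ₗ[T] 𝒜.Ld T 0 (k + 1) where
  toFun x := ⟨ev (ℱ.A i) x.1, x.2.1.ev _ (ℱ.a i) (ℱ.log i), x.2.2.ev _⟩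
  map_add' x y := by ext1; simp
  map_smul' t x := by ext1; simp [ev_smul]

/-- The inverse of a positive integer as a linear map. -/
noncomputable def natInvL (k : ℕ) (a k' : ℕ) : 𝒜.Ld T a k' →ₗ[T] 𝒜.Ld T a k' where
  toFun x := ⟨(𝒜.natinv k).choose • x.1, x.2.1.smul _, x.2.2.smul _⟩
  map_add' x y := by ext1; simp
  map_smul' t x := by ext1; simp [smul_comm]

theorem retract (k : ℕ) (x : 𝒜.Ld T 0 (k + 1)) :
    natInvL T k 0 (k + 1) (∑ i, ℱ.evL T k i (ℱ.κL T k i x)) = x := by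
  ext1
  change (𝒜.natinv k).choose • ((∑ i, ℱ.evL T k i (ℱ.κL T k i x) : 𝒜.Ld T 0 (k + 1)) :
    Finset (Fin n) → Y) = x
  rw [Submodule.coe_sum]
  change (𝒜.natinv k).choose • (∑ i, ev (ℱ.A i) (ℱ.κ i x.1)) = x.1
  rw [ℱ.sum_ev_κ x.2.1 x.2.2, smul_smul, Nat.cast_add, Nat.cast_one, (𝒜.natinv k).choose_spec,
    one_smul]

/-- The degree zero part is the coefficient module. -/
def zeroEquiv : 𝒜.Ld T 0 0 ≃ₗ[T] Y where
  toFun x := x.1 ∅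
  map_add' x y := rfl
  map_smul' t x := rfl
  invFun y := ⟨fun I => if I = ∅ then y else 0, fun j => ⟨0, by
      ext I; simp [iv_eq, iota_apply]⟩, fun I hI => by
      have : I ≠ ∅ := fun e => hI (by simp [e])
      simp [this]⟩
  left_inv x := by
    ext I
    by_cases h : I = ∅
    · simp [h]
    · have := x.2.2 I (by simpa using h)
      simp [h, this]
  right_inv y := by simp

include ℱ

theorem projective_zero [Module.Projective T Y] (k : ℕ) : Module.Projective T (𝒜.Ld T 0 k) := by
  induction k with
  | zero => exact Module.Projective.of_equiv (zeroEquiv T).symm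
  | succ k ih =>
    have hpi : Module.Projective T (Fin m → 𝒜.Ld T 0 k) := Module.Projective.of_equiv
      (DFinsupp.linearEquivFunOnFintype (R := T) (M := fun _ : Fin m => 𝒜.Ld T 0 k))
    refine Module.Projective.of_split (P := 𝒜.Ld T 0 (k + 1)) (M := Fin m → 𝒜.Ld T 0 k)
      (LinearMap.pi fun i => ℱ.κL T k i)
      (natInvL T k 0 (k + 1) ∘ₗ ∑ i, ℱ.evL T k i ∘ₗ LinearMap.proj i) ?_
    refine LinearMap.ext fun x => ?_
    have := ℱ.retract T k x
    simpa using this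

theorem projective_cone [Module.Projective T Y] (k : ℕ) : Module.Projective T (𝒜.Cone T k) := by
  have h0 := ℱ.projective_zero T k
  have h1 : Module.Projective T (𝒜.Ld T 1 k) := by
    cases k with
    | zero =>
      have : Subsingleton (𝒜.Ld T 1 0) :=
        ⟨fun x y => Subtype.ext (by rw [Ld_one_zero x.2, Ld_one_zero y.2])⟩
      infer_instance
    | succ k => rw [Ld_one_succ]; exact ℱ.projective_zero T k
  infer_instance

end FreeData

end Arr

section Deriv

variable {S : Type*} [CommRing S] [Algebra ℂ S]

/-- Local nilpotency of a derivation. -/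
def LocNil (D : Derivation ℂ S S) : Prop := ∀ z, ∃ N, D^[N] z = 0

theorem iterate_deriv_mul (D : Derivation ℂ S S) {t u : S} (ht : D t = u) (hu : D u = 0) (m : ℕ)
    (z : S) : D^[m + 1] (t * z) = t * D^[m + 1] z + (m + 1 : ℂ) • (u * D^[m] z) := by
  induction m with
  | zero => simp [ht]; ring
  | succ m ih =>
    rw [Function.iterate_succ_apply', ih, map_add, Derivation.leibniz, ht, Derivation.map_smul,
      Derivation.leibniz, hu, Function.iterate_succ_apply' D (m + 1), Function.iterate_succ_apply' D m]
    simp only [smul_eq_mul, mul_zero, add_zero]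
    push_cast
    rw [add_smul (m + 1 : ℂ) 1, one_smul]
    ring

theorem iterate_mem {D : Derivation ℂ S S} {I : Ideal S} (hD : ∀ x ∈ I, D x ∈ I) {x : S}
    (hx : x ∈ I) (m : ℕ) : D^[m] x ∈ I := by
  induction m with
  | zero => exact hx
  | succ m ih => rw [Function.iterate_succ_apply']; exact hD _ ih

theorem pow_mul_mem_of_deriv {D : Derivation ℂ S S} {I : Ideal S} (hD : ∀ x ∈ I, D x ∈ I)
    {t u : S} (ht : D t = u) (hu : D u = 0) {z : S} (hz : t * z ∈ I) {N : ℕ}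
    (hN : D^[N] z = 0) : u ^ N * z ∈ I := by
  have key : ∀ a m, a + m = N → u ^ a * D^[m] z ∈ I := by
    intro a
    induction a with
    | zero =>
      intro m hm
      obtain rfl : m = N := by omega
      simp [hN]
    | succ a ih =>
      intro m hm
      have h1 := ih (m + 1) (by omega)
      have h2 := I.mul_mem_left (u ^ a) (iterate_mem hD hz (m + 1))
      rw [iterate_deriv_mul D ht hu, mul_add] at h2
      have h3 : u ^ a * (t * D^[m + 1] z) ∈ I := by
        rw [mul_left_comm]; exact I.mul_mem_left _ h1
      have h4 := (I.add_mem_iff_right h3).1 h2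
      rw [mul_smul_comm, ← mul_assoc, ← pow_succ] at h4
      have h5 : (m + 1 : ℂ) ≠ 0 := by exact_mod_cast Nat.succ_ne_zero m
      have h6 := I.mul_mem_left (algebraMap ℂ S (m + 1 : ℂ)⁻¹) h4
      rwa [← Algebra.smul_def, smul_smul, inv_mul_cancel₀ h5, one_smul] at h6
  exact key N 0 rfl

end Deriv

section Acyclic

variable {S : Type*} [CommRing S] (P : Ideal S)
  {K : ℕ → Type*} [∀ k, AddCommGroup (K k)] [∀ k, Module S (K k)]
  (d : ∀ k, K (k + 1) →ₗ[S] K k)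

/-- Relative cycles are killed by multiples of powers of elements of `P`. -/
def Kill (I : Ideal S) (j : ℕ) : Prop :=
  ∀ g ∈ P, ∀ k, j ≤ k → ∀ z : K (k + 1), d k z ∈ I • (⊤ : Submodule S (K k)) →
    ∃ u ∉ P, ∃ N, (u * g ^ N) • z ∈ LinearMap.range (d (k + 1)) ⊔ I • (⊤ : Submodule S (K (k + 1)))

/-- Relative cycles are killed by elements outside `P`. -/
def LocExact (I : Ideal S) (j : ℕ) : Prop :=
  ∀ k, j ≤ k → ∀ z : K (k + 1), d k z ∈ I • (⊤ : Submodule S (K k)) →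
    ∃ u ∉ P, u • z ∈ LinearMap.range (d (k + 1)) ⊔ I • (⊤ : Submodule S (K (k + 1)))

/-- `t` is a nonzerodivisor on `K / I K` locally at `P`. -/
def RegOn (M : Type*) [AddCommGroup M] [Module S M] (t : S) (I : Ideal S) : Prop :=
  ∀ z : M, t • z ∈ I • (⊤ : Submodule S M) → ∃ u ∉ P, u • z ∈ I • (⊤ : Submodule S M)

theorem map_mem_smul {M M' : Type*} [AddCommGroup M] [Module S M] [AddCommGroup M'] [Module S M']
    (f : M →ₗ[S] M') {I : Ideal S} {x : M} (hx : x ∈ I • (⊤ : Submodule S M)) :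
    f x ∈ I • (⊤ : Submodule S M') := by
  have := Submodule.mem_map_of_mem (f := f) hx
  rw [Submodule.map_smul''] at this
  exact (Submodule.smul_mono le_rfl le_top : I • _ ≤ I • (⊤ : Submodule S M')) this

theorem RegOn.of_projective {M : Type*} [AddCommGroup M] [Module S M] [Module.Projective S M]
    [hP : P.IsPrime] {t : S} {I : Ideal S} (h : ∀ z, t * z ∈ I → ∃ u ∉ P, u * z ∈ I) :
    RegOn P M t I := by
  classical
  obtain ⟨s, hs⟩ := Module.projective_def'.1 (inferInstance : Module.Projective S M)
  intro z hz
  have h1 : ∀ i, t * s z i ∈ I := by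
    intro i
    have h2 := map_mem_smul (Finsupp.lapply i ∘ₗ s) hz
    simpa using h2
  choose u hu hu' using fun i => h _ (h1 i)
  refine ⟨∏ i ∈ (s z).support, u i, fun hm => ?_, ?_⟩
  · obtain ⟨i, _, hi⟩ := hP.prod_mem_iff.1 hm
    exact hu i hi
  · have h3 : z = Finsupp.linearCombination S id (s z) := (LinearMap.congr_fun hs z).symm
    have h4 : ∀ c : S, c • z = ∑ i ∈ (s z).support, c • s z i • i := fun c => by
      conv_lhs => rw [h3, Finsupp.linearCombination_apply, Finsupp.sum, Finset.smul_sum]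
      rfl
    rw [h4]
    refine Submodule.sum_mem _ fun i hi => ?_
    rw [smul_smul]
    refine Submodule.smul_mem_smul ?_ trivial
    rw [← Finset.mul_prod_erase _ _ hi, mul_right_comm]
    exact I.mul_mem_right _ (hu' i)

variable {P d}

theorem mem_sup_span {M : Type*} [AddCommGroup M] [Module S M] {I : Ideal S} {t : S} {x : M} :
    x ∈ (I ⊔ Ideal.span {t}) • (⊤ : Submodule S M) ↔
      ∃ a ∈ I • (⊤ : Submodule S M), ∃ y, x = a + t • y := by
  rw [Submodule.sup_smul, Submodule.mem_sup]
  constructor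
  · rintro ⟨a, ha, b, hb, rfl⟩
    rw [Submodule.ideal_span_singleton_smul] at hb
    obtain ⟨y, -, rfl⟩ := hb
    exact ⟨a, ha, y, rfl⟩
  · rintro ⟨a, ha, y, rfl⟩
    exact ⟨a, ha, _, Submodule.smul_mem_smul (Ideal.mem_span_singleton_self t) trivial, rfl⟩

theorem mul_notMem [hP : P.IsPrime] {a b : S} (ha : a ∉ P) (hb : b ∉ P) : a * b ∉ P :=
  fun h => (hP.mem_or_mem h).elim ha hb

theorem Kill.step [P.IsPrime] {I : Ideal S} {j : ℕ} {t : S}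
    (hdd : ∀ k z, d k (d (k + 1) z) = 0) (h : Kill P d I j) (hr : ∀ k, RegOn P (K k) t I) :
    Kill P d (I ⊔ Ideal.span {t}) (j + 1) := by
  intro g hg k hk z hz
  obtain ⟨k, rfl⟩ : ∃ m, k = m + 1 := ⟨k - 1, by omega⟩
  obtain ⟨a, ha, y, hy⟩ := mem_sup_span.1 hz
  have h0 : t • d k y ∈ I • (⊤ : Submodule S (K k)) := by
    have : t • d k y = - d k a := by
      have := hdd k z
      rw [hy, map_add, map_smul] at this
      exact eq_neg_of_add_eq_zero_right this
    rw [this]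
    exact Submodule.neg_mem _ (map_mem_smul _ ha)
  obtain ⟨u, hu, hu'⟩ := hr _ _ h0
  rw [← map_smul] at hu'
  obtain ⟨v, hv, N, hN⟩ := h g hg k (by omega) (u • y) hu'
  obtain ⟨_, ⟨w, rfl⟩, b, hb, hwb⟩ := Submodule.mem_sup.1 hN
  have h1 : d (k + 1) ((v * g ^ N * u) • z - t • w) ∈ I • (⊤ : Submodule S (K (k + 1))) := by
    have : d (k + 1) ((v * g ^ N * u) • z - t • w) = (v * g ^ N * u) • a + t • b := by
      rw [map_sub, map_smul, map_smul, hy, smul_add, eq_sub_of_add_eq hwb, smul_sub,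
        smul_comm _ t y, smul_smul (v * g ^ N)]
      abel
    rw [this]
    exact Submodule.add_mem _ (Submodule.smul_mem _ _ ha) (Submodule.smul_mem _ _ hb)
  obtain ⟨x, hx, M, hM⟩ := h g hg (k + 1) (by omega) _ h1
  refine ⟨x * (v * u), mul_notMem hx (mul_notMem hv hu), M + N, ?_⟩
  have h2 : (x * (v * u) * g ^ (M + N)) • z =
      (x * g ^ M) • ((v * g ^ N * u) • z - t • w) + t • (x * g ^ M) • w := by
    rw [smul_sub, smul_comm t, sub_add_cancel, smul_smul]
    congr 1
    ring
  rw [h2]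
  refine Submodule.add_mem _ ((sup_le_sup_left (Submodule.smul_mono_left le_sup_left) _ :
    LinearMap.range (d (k + 1 + 1)) ⊔ I • (⊤ : Submodule S (K (k + 1 + 1))) ≤ _) hM) ?_
  exact Submodule.mem_sup_right (Submodule.smul_mem_smul
    (Ideal.mem_sup_right (Ideal.mem_span_singleton_self t)) trivial)

theorem LocExact.step [P.IsPrime] {I : Ideal S} {j : ℕ} {t : S}
    (hdd : ∀ k z, d k (d (k + 1) z) = 0) (h : Kill P d I j) (ht : t ∈ P)
    (hr : ∀ k, RegOn P (K k) t I) (hQ : LocExact P d (I ⊔ Ideal.span {t}) (j + 1)) :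
    LocExact P d I j := by
  intro k hk z hz
  obtain ⟨u, hu, N, hN⟩ := h t ht k hk z hz
  induction N generalizing u with
  | zero => exact ⟨u, hu, by simpa using hN⟩
  | succ N ih =>
    obtain ⟨_, ⟨w, rfl⟩, b, hb, hwb⟩ := Submodule.mem_sup.1 hN
    have h1 : d (k + 1) w ∈ (I ⊔ Ideal.span {t}) • (⊤ : Submodule S (K (k + 1))) :=
      mem_sup_span.2 ⟨-b, Submodule.neg_mem _ hb, (u * t ^ N) • z, by
        rw [eq_sub_of_add_eq hwb, smul_smul]
        rw [show u * t ^ (N + 1) = t * (u * t ^ N) by ring]; abel⟩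
    obtain ⟨v, hv, hv'⟩ := hQ (k + 1) (by omega) w h1
    obtain ⟨_, ⟨w', rfl⟩, b', hb', e⟩ := Submodule.mem_sup.1 hv'
    obtain ⟨b'', hb'', y, rfl⟩ := mem_sup_span.1 hb'
    have h2 : t • ((v * (u * t ^ N)) • z - d (k + 1) y) ∈ I • (⊤ : Submodule S (K (k + 1))) := by
      have e2 : v • d (k + 1) w = d (k + 1) b'' + t • d (k + 1) y := by
        rw [← map_smul, ← e, map_add, hdd, map_add, map_smul, zero_add]
      have : t • ((v * (u * t ^ N)) • z - d (k + 1) y) = d (k + 1) b'' + v • b := by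
        have e3 : t • (v * (u * t ^ N)) • z = v • (d (k + 1) w + b) := by
          rw [hwb, smul_smul, smul_smul]; congr 1; ring
        rw [smul_sub, e3, smul_add, e2]; abel
      rw [this]
      exact Submodule.add_mem _ (map_mem_smul _ hb'') (Submodule.smul_mem _ _ hb)
    obtain ⟨x, hx, hx'⟩ := hr _ _ h2
    refine ih (x * (v * u)) (mul_notMem hx (mul_notMem hv hu)) ?_
    have : (x * (v * u) * t ^ N) • z = d (k + 1) (x • y) +
        x • ((v * (u * t ^ N)) • z - d (k + 1) y) := by
      rw [smul_sub, map_smul, add_sub_cancel, smul_smul]; congr 1; ring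
    rw [this]
    exact Submodule.add_mem_sup ⟨_, rfl⟩ hx'

variable (P) in
/-- Sequences in `P` which are regular on `S` locally at `P`, relative to an ideal. -/
def RegSeq : Ideal S → List S → Prop
  | _, [] => True
  | I, t :: ts => (t ∈ P ∧ ∀ z, t * z ∈ I → ∃ u ∉ P, u * z ∈ I) ∧ RegSeq (I ⊔ Ideal.span {t}) ts

theorem LocExact.of_regSeq [P.IsPrime] [∀ k, Module.Projective S (K k)]
    (hdd : ∀ k z, d k (d (k + 1) z) = 0) (ts : List S) (I : Ideal S) (j : ℕ)
    (h : Kill P d I j) (hr : RegSeq P I ts) (h0 : ∀ k, j + ts.length < k → ∀ z : K k, z = 0) :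
    LocExact P d I j := by
  have hP : P.IsPrime := inferInstance
  induction ts generalizing I j with
  | nil =>
    intro k hk z _
    refine ⟨1, fun h => hP.ne_top ((Ideal.eq_top_iff_one _).2 h), ?_⟩
    rw [h0 (k + 1) (by simp; omega) z, smul_zero]
    exact Submodule.zero_mem _
  | cons t ts ih =>
    obtain ⟨⟨ht, hreg⟩, hr⟩ := hr
    have hR : ∀ k, RegOn P (K k) t I := fun k => RegOn.of_projective P hreg
    refine LocExact.step hdd h ht hR (ih _ _ (h.step hdd hR) hr fun k hk => h0 k ?_)
    simp only [List.length_cons]; omega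

/-- An element with a derivation certifying that it is a nonzerodivisor. -/
structure Cert (P : Ideal S) [Algebra ℂ S] where
  t : S
  u : S
  D : Derivation ℂ S S
  mem : t ∈ P
  hu : u ∉ P
  Dt : D t = u
  Du : D u = 0
  nil : LocNil D

theorem RegSeq.of_cert [Algebra ℂ S] [hP : P.IsPrime] (L : List (Cert P))
    (hL : L.Pairwise fun a b => b.D a.t = 0) (I : Ideal S) (hI : ∀ a ∈ L, ∀ x ∈ I, a.D x ∈ I) :
    RegSeq P I (L.map Cert.t) := by
  induction L generalizing I with
  | nil => trivial
  | cons a L ih =>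
    rw [List.pairwise_cons] at hL
    refine ⟨⟨a.mem, fun z hz => ?_⟩, ih hL.2 _ fun b hb x hx => ?_⟩
    · obtain ⟨N, hN⟩ := a.nil z
      exact ⟨a.u ^ N, fun h => a.hu (hP.mem_of_pow_mem _ h),
        pow_mul_mem_of_deriv (hI a (by simp)) a.Dt a.Du hz hN⟩
    · obtain ⟨y, hy, w, hw, rfl⟩ := Submodule.mem_sup.1 hx
      obtain ⟨r, rfl⟩ := Ideal.mem_span_singleton'.1 hw
      rw [map_add, Derivation.leibniz, hL.1 b hb, smul_zero, zero_add, smul_eq_mul]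
      exact Submodule.add_mem_sup (hI b (by simp [hb]) y hy)
        (Ideal.mul_mem_right _ _ (Ideal.mem_span_singleton_self _))

theorem exists_mul_pow_mem {I P : Ideal S} (hP : P ∈ I.minimalPrimes) {g : S} (hg : g ∈ P) :
    ∃ u ∉ P, ∃ N, u * g ^ N ∈ I := by
  have hp : P.IsPrime := hP.1.1
  by_contra! hcon
  let M : Submonoid S :=
    { carrier := {x | ∃ u ∉ P, ∃ N, x = u * g ^ N}
      mul_mem' := by
        rintro _ _ ⟨u, hu, N, rfl⟩ ⟨v, hv, M, rfl⟩
        exact ⟨u * v, mul_notMem hu hv, N + M, by ring⟩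
      one_mem' := ⟨1, fun h => hp.ne_top ((Ideal.eq_top_iff_one _).2 h), 0, by simp⟩ }
  have hdis : Disjoint (I : Set S) M := Set.disjoint_left.2 fun x hx hm => by
    obtain ⟨u, hu, N, rfl⟩ := hm
    exact hcon u hu N hx
  obtain ⟨Q, hQ, hIQ, hQM⟩ := Ideal.exists_le_prime_disjoint I M hdis
  have hQP : Q ≤ P := fun x hx => by
    by_contra hxP
    exact Set.disjoint_left.1 hQM hx ⟨x, hxP, 0, by simp⟩
  have hgQ : g ∈ Q := hP.2 ⟨hQ, hIQ⟩ hQP hg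
  exact Set.disjoint_left.1 hQM hgQ
    ⟨1, fun h => hp.ne_top ((Ideal.eq_top_iff_one _).2 h), 1, by simp⟩

/-- Local-to-global exactness: if the annihilator of homology is not the whole ring, at a minimal
prime over it there is no regular sequence as long as the complex. -/
theorem exact_of_regSeq [IsNoetherianRing S] [∀ k, Module.Projective S (K k)]
    [∀ k, Module.Finite S (K k)] (m : ℕ)
    (hdd : ∀ k z, d k (d (k + 1) z) = 0) (h0 : ∀ k, m < k → ∀ z : K k, z = 0)
    (hseq : ∀ P : Ideal S, P.IsPrime →
      (∀ a, (∀ k, ∀ z : K (k + 1), d k z = 0 → a • z ∈ LinearMap.range (d (k + 1))) → a ∈ P) →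
      ∃ ts : List S, m ≤ ts.length ∧ RegSeq P ⊥ ts) :
    ∀ k, ∀ z : K (k + 1), d k z = 0 → z ∈ LinearMap.range (d (k + 1)) := by
  let 𝔞 : Ideal S :=
    { carrier := {a | ∀ k, ∀ z : K (k + 1), d k z = 0 → a • z ∈ LinearMap.range (d (k + 1))}
      add_mem' := fun ha hb k z hz => by
        rw [add_smul]; exact Submodule.add_mem _ (ha k z hz) (hb k z hz)
      zero_mem' := fun k z hz => by simp
      smul_mem' := fun c a ha k z hz => by
        rw [smul_eq_mul, mul_smul]; exact Submodule.smul_mem _ _ (ha k z hz) }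
  suffices h : 𝔞 = ⊤ by
    have h1 : (1 : S) ∈ 𝔞 := by rw [h]; trivial
    intro k z hz
    simpa using h1 k z hz
  by_contra hne
  obtain ⟨P, hPm⟩ := Ideal.nonempty_minimalPrimes hne
  have hP : P.IsPrime := hPm.1.1
  have hle : 𝔞 ≤ P := hPm.1.2
  obtain ⟨ts, hts, hreg⟩ := hseq P hP fun a ha => hle ha
  have hkill : Kill P d ⊥ 0 := by
    intro g hg k _ z hz
    rw [Submodule.bot_smul, Submodule.mem_bot] at hz
    obtain ⟨u, hu, N, hN⟩ := exists_mul_pow_mem hPm hg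
    exact ⟨u, hu, N, Submodule.mem_sup_left (hN k z hz)⟩
  have hQ := LocExact.of_regSeq hdd ts ⊥ 0 hkill hreg fun k hk => h0 k (by omega)
  have hk : ∀ k, ∃ u ∉ P, ∀ z : K (k + 1), d k z = 0 → u • z ∈ LinearMap.range (d (k + 1)) := by
    intro k
    obtain ⟨s, hs⟩ := (IsNoetherian.noetherian (LinearMap.ker (d k)))
    have hmem : ∀ z ∈ s, ∃ u ∉ P, u • z ∈ LinearMap.range (d (k + 1)) := by
      intro z hz
      have : z ∈ LinearMap.ker (d k) := hs ▸ Submodule.subset_span hz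
      obtain ⟨u, hu, hu'⟩ := hQ k (Nat.zero_le _) z (by rw [LinearMap.mem_ker.1 this]; simp)
      exact ⟨u, hu, by simpa using hu'⟩
    choose! u hu hu' using hmem
    refine ⟨∏ z ∈ s, u z, fun h => ?_, fun z hz => ?_⟩
    · obtain ⟨i, hi, hi'⟩ := hP.prod_mem_iff.1 h
      exact hu i hi hi'
    · have hz' : z ∈ Submodule.span S (s : Set (K (k + 1))) := hs ▸ LinearMap.mem_ker.2 hz
      induction hz' using Submodule.span_induction with
      | mem x hx =>
        classical
        rw [← Finset.prod_erase_mul _ _ hx, mul_smul]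
        exact Submodule.smul_mem _ _ (hu' x hx)
      | zero => simp
      | add x y hx hy h1 h2 =>
        rw [smul_add]
        exact Submodule.add_mem _ (h1 (by simpa using (hs ▸ hx : x ∈ LinearMap.ker (d k))))
          (h2 (by simpa using (hs ▸ hy : y ∈ LinearMap.ker (d k))))
      | smul a x hx h1 =>
        rw [smul_comm]
        exact Submodule.smul_mem _ _ (h1 (by simpa using (hs ▸ hx : x ∈ LinearMap.ker (d k))))
  choose u hu hu' using hk
  have hmem : ∏ k ∈ Finset.range m, u k ∈ 𝔞 := by
    intro k z hz
    by_cases hkm : k < m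
    · rw [← Finset.prod_erase_mul _ _ (Finset.mem_range.2 hkm), mul_smul]
      exact Submodule.smul_mem _ _ (hu' k z hz)
    · rw [h0 (k + 1) (by omega) z]; simp
  obtain ⟨i, _, hi⟩ := hP.prod_mem_iff.1 (hle hmem)
  exact hu i hi

end Acyclic

/-- The polynomial ring on `ℂⁿ`. -/
abbrev Rg (n : ℕ) : Type := MvPolynomial (Fin n) ℂ

/-- The polynomial ring in the variables `ξ`, `x` and `s`. -/
abbrev Sg (n p : ℕ) : Type := MvPolynomial (Fin n ⊕ (Fin n ⊕ Fin p)) ℂ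

section Ring

variable {n p : ℕ}

noncomputable instance algRS : Algebra (Rg n) (Sg n p) :=
  ((rename (Sum.inr ∘ Sum.inl) : Rg n →ₐ[ℂ] Sg n p) : Rg n →+* Sg n p).toAlgebra

theorem algebraMap_eq (r : Rg n) :
    algebraMap (Rg n) (Sg n p) r = rename (Sum.inr ∘ Sum.inl) r := rfl

instance towerRS : IsScalarTower ℂ (Rg n) (Sg n p) :=
  IsScalarTower.of_algebraMap_eq fun z => by
    rw [algebraMap_eq, MvPolynomial.algebraMap_eq, MvPolynomial.algebraMap_eq, rename_C]

theorem smul_eq (r : Rg n) (z : Sg n p) : r • z = rename (Sum.inr ∘ Sum.inl) r * z := rfl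

/-- The covariable `ξ i`. -/
noncomputable abbrev vxi (i : Fin n) : Sg n p := X (Sum.inl i)

/-- The variable `x i`. -/
noncomputable abbrev vx (i : Fin n) : Sg n p := X (Sum.inr (Sum.inl i))

/-- The variable `s j`. -/
noncomputable abbrev vs (j : Fin p) : Sg n p := X (Sum.inr (Sum.inr j))

theorem X_smul (i : Fin n) (z : Sg n p) : (X i : Rg n) • z = vx i * z := by
  rw [smul_eq, rename_X]; rfl

/-- The constant vector field with given coefficients. -/
noncomputable def dir (a : Fin n ⊕ (Fin n ⊕ Fin p) → ℂ) : Derivation ℂ (Sg n p) (Sg n p) :=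
  mkDerivation ℂ fun s => C (a s)

@[simp] theorem dir_X (a : Fin n ⊕ (Fin n ⊕ Fin p) → ℂ) (s : Fin n ⊕ (Fin n ⊕ Fin p)) :
    dir a (X s) = C (a s) := by simp [dir]

@[simp] theorem dir_C (a : Fin n ⊕ (Fin n ⊕ Fin p) → ℂ) (z : ℂ) :
    dir a (C z) = 0 := by simp [dir]

theorem dir_algebraMap {a : Fin n ⊕ (Fin n ⊕ Fin p) → ℂ} (ha : ∀ k, a (Sum.inr (Sum.inl k)) = 0)
    (r : Rg n) : dir a (algebraMap (Rg n) (Sg n p) r) = 0 := by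
  rw [algebraMap_eq]
  induction r using MvPolynomial.induction_on with
  | C z => simp
  | add f g hf hg => simp [hf, hg]
  | mul_X f i hf => simp [hf, ha]

theorem locNil_dir (a : Fin n ⊕ (Fin n ⊕ Fin p) → ℂ) : LocNil (dir a) := by
  have hmono : ∀ (z : Sg n p) {N M : ℕ}, N ≤ M → (dir a)^[N] z = 0 → (dir a)^[M] z = 0 := by
    intro z N M h hz
    obtain ⟨k, rfl⟩ := Nat.exists_eq_add_of_le' h
    rw [Function.iterate_add_apply, hz, iterate_map_zero]
  intro z
  induction z using MvPolynomial.induction_on with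
  | C z => exact ⟨1, by simp⟩
  | add f g hf hg =>
    obtain ⟨N, hN⟩ := hf
    obtain ⟨M, hM⟩ := hg
    exact ⟨max N M, by rw [iterate_map_add, hmono f (le_max_left _ _) hN,
      hmono g (le_max_right _ _) hM, add_zero]⟩
  | mul_X f s hf =>
    obtain ⟨N, hN⟩ := hf
    refine ⟨N + 1, ?_⟩
    rw [mul_comm, iterate_deriv_mul (dir a) (dir_X a s) (dir_C a _), hN,
      hmono f (Nat.le_succ N) hN]
    simp

/-- The linear form with given coefficients. -/
noncomputable def lin : (Fin n → ℂ) →ₗ[ℂ] Rg n where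
  toFun v := ∑ k, C (v k) * X k
  map_add' v w := by simp [add_mul, Finset.sum_add_distrib]
  map_smul' r v := by simp [Finset.mul_sum, mul_assoc, MvPolynomial.smul_eq_C_mul]

theorem lin_eq (v : Fin n → ℂ) : lin v = ∑ k, C (v k) * X k := rfl

theorem algebraMap_lin (v : Fin n → ℂ) :
    algebraMap (Rg n) (Sg n p) (lin v) = ∑ k, C (v k) * vx k := by
  rw [algebraMap_eq, lin_eq, map_sum]
  simp

theorem dir_lin (a : Fin n ⊕ (Fin n ⊕ Fin p) → ℂ) (v : Fin n → ℂ) :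
    dir a (algebraMap (Rg n) (Sg n p) (lin v)) = C (∑ k, v k * a (Sum.inr (Sum.inl k))) := by
  rw [algebraMap_lin]
  simp

variable (p) in
theorem lin_ne_zero {v w : Fin n → ℂ} (h : ∑ k, v k * w k = 1) :
    algebraMap (Rg n) (Sg n p) (lin v) ≠ 0 := by
  intro h0
  have h1 := dir_lin (p := p) (Sum.elim 0 (Sum.elim w 0)) v
  rw [h0, map_zero] at h1
  simp [h] at h1

/-- The vector field on the `x` variables. -/
def xdir (w : Fin n → ℂ) : Fin n ⊕ (Fin n ⊕ Fin p) → ℂ := Sum.elim 0 (Sum.elim w 0)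

/-- The coefficient vectors of nonzero pairwise non-proportional linear forms. -/
structure Sep (c : Fin p → Fin n → ℂ) : Prop where
  ne : ∀ j, ∃ w : Fin n → ℂ, ∑ k, c j k * w k = 1
  sep : ∀ i j, i ≠ j → ∃ w : Fin n → ℂ, ∑ k, c i k * w k = 0 ∧ ∑ k, c j k * w k = 1

/-- The arrangement acting on the big polynomial ring. -/
noncomputable def arr (c : Fin p → Fin n → ℂ) (hc : Sep c) : Arr (Rg n) (Sg n p) n p where
  c j k := C (c j k)
  l j := lin (c j)
  inj j y h := by
    obtain ⟨w, hw⟩ := hc.ne j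
    rw [Algebra.smul_def] at h
    exact (mul_eq_zero.1 h).resolve_left (lin_ne_zero p hw)
  cop i j hij y z h := by
    obtain ⟨w, hi, hj⟩ := hc.sep i j hij
    rw [Algebra.smul_def, Algebra.smul_def] at h
    have hDi := dir_lin (p := p) (xdir w) (c i)
    have hDj := dir_lin (p := p) (xdir w) (c j)
    simp only [xdir, Sum.elim_inr, Sum.elim_inl, hi, hj, map_zero, map_one] at hDi hDj
    obtain ⟨N, hN⟩ := locNil_dir (p := p) (xdir w) z
    have := pow_mul_mem_of_deriv (D := dir (xdir w))
      (I := Ideal.span {algebraMap (Rg n) (Sg n p) (lin (c i))}) (fun x hx => by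
        obtain ⟨r, rfl⟩ := Ideal.mem_span_singleton'.1 hx
        rw [Derivation.leibniz, xdir, hDi, smul_zero, zero_add, smul_eq_mul]
        exact Ideal.mul_mem_right _ _ (Ideal.mem_span_singleton_self _)) hDj (by simp)
      (z := z) (by rw [← h]; exact Ideal.mul_mem_right _ _ (Ideal.mem_span_singleton_self _)) hN
    rw [one_pow, one_mul] at this
    obtain ⟨r, rfl⟩ := Ideal.mem_span_singleton'.1 this
    exact ⟨r, by rw [Algebra.smul_def, mul_comm]⟩
  natinv k := ⟨C ((k + 1 : ℂ)⁻¹), by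
    have h : (k + 1 : ℂ) ≠ 0 := by exact_mod_cast Nat.succ_ne_zero k
    have : ((k : Rg n) + 1) = C (k + 1 : ℂ) := by simp
    rw [this, ← C_mul, inv_mul_cancel₀ h, C_1]⟩

end Ring

section Symbol

variable {n p : ℕ} (c : Fin p → Fin n → ℂ) (hc : Sep c)

/-- The differential of the associated graded complex. -/
noncomputable def symb : (arr c hc).Dif (Sg n p) where
  A i := LinearMap.mulLeft _ (vxi i)
  B j := LinearMap.mulLeft _ (vs j)
  γ := 0
  AA i k y := by simp [mul_left_comm]
  AB i k y := by simp [mul_left_comm]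
  BB i k y := by simp [mul_left_comm]
  B_R j r y := by simp
  A_c i j k y := by simp
  A_l i j y := by simp

variable {c hc}

theorem symb_d (x : Finset (Fin n) → Sg n p) :
    (symb c hc).d x = ∑ i, (vxi i : Sg n p) • iota i x -
      ∑ j, (vs j : Sg n p) • (arr c hc).q j x := rfl

theorem symb_shift_d (x : Finset (Fin n) → Sg n p) : (symb c hc).shift.d x = (symb c hc).d x := by
  have : (symb c hc).shift.qB x = (symb c hc).qB x := by
    refine Finset.sum_congr rfl fun j _ => ?_
    ext1 I
    simp [Arr.Dif.shift, symb]
  rw [Arr.Dif.d, Arr.Dif.d, this]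
  rfl

/-- The symbol of the Lie derivative along a logarithmic vector field. -/
noncomputable def lieSymb (v : Fin n → Rg n) (a : Fin p → Rg n) : Sg n p :=
  ∑ i, vxi i * algebraMap _ _ (v i) - ∑ j, vs j * algebraMap _ _ (a j)

theorem symb_d_ev {v : Fin n → Rg n} {a : Fin p → Rg n}
    (hv : ∀ j, ∑ k, (arr c hc).c j k * v k = (arr c hc).l j * a j) {x : Finset (Fin n) → Sg n p}
    (hx : (arr c hc).Log x) :
    (symb c hc).d (ev v x) = lieSymb v a • x - ev v ((symb c hc).d x) := by
  rw [symb_d, symb_d, map_sub, map_sum, map_sum, lieSymb, sub_smul, Finset.sum_smul,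
    Finset.sum_smul]
  have h1 : ∀ i, (vxi i : Sg n p) • iota i (ev v x) =
      (vxi i * algebraMap (Rg n) (Sg n p) (v i)) • x - ev v ((vxi i : Sg n p) • iota i x) := by
    intro i
    rw [eq_sub_of_add_eq (iota_ev_add i v x), ev_smul, smul_sub, mul_smul, algebraMap_smul]
  have h2 : ∀ j, (vs j : Sg n p) • (arr c hc).q j (ev v x) =
      (vs j * algebraMap (Rg n) (Sg n p) (a j)) • x - ev v ((vs j : Sg n p) • (arr c hc).q j x) := by
    intro j
    rw [hx.q_ev v a hv, ev_smul, smul_sub, mul_smul, algebraMap_smul]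
  simp only [h1, h2, Finset.sum_sub_distrib]
  abel

theorem symb_F_kills (k : ℕ) (z : (arr c hc).Cone (Sg n p) (k + 1)) (hz : (symb c hc).D k z = 0) :
    algebraMap (Rg n) (Sg n p) (arr c hc).F • z ∈ LinearMap.range ((symb c hc).D (k + 1)) := by
  have e1 : (symb c hc).d z.1 + (arr c hc).F • (z.2 : Finset (Fin n) → Sg n p) = 0 :=
    congrArg (fun w => (w.1 : Finset (Fin n) → Sg n p)) hz
  refine ⟨(0, ⟨z.1, ?_⟩), ?_⟩
  · rw [Arr.Ld_one_succ]; exact z.1.2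
  · ext1 <;> ext1
    · rw [Arr.Dif.D_fst]
      simp [symb_d, Arr.q_zero]
    · rw [Arr.Dif.D_snd, symb_shift_d]
      change - (symb c hc).d z.1 = _
      rw [eq_neg_of_add_eq_zero_left e1, neg_neg]
      simp

theorem symb_lie_kills {v : Fin n → Rg n} {a : Fin p → Rg n}
    (hv : ∀ j, ∑ k, (arr c hc).c j k * v k = (arr c hc).l j * a j)
    (k : ℕ) (z : (arr c hc).Cone (Sg n p) (k + 1)) (hz : (symb c hc).D k z = 0) :
    lieSymb v a • z ∈ LinearMap.range ((symb c hc).D (k + 1)) := by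
  have e1 : (symb c hc).d z.1 + (arr c hc).F • (z.2 : Finset (Fin n) → Sg n p) = 0 :=
    congrArg (fun w => (w.1 : Finset (Fin n) → Sg n p)) hz
  have e2 : - (symb c hc).shift.d z.2 = 0 :=
    congrArg (fun w => (w.2 : Finset (Fin n) → Sg n p)) hz
  rw [symb_shift_d, neg_eq_zero] at e2
  refine ⟨(⟨ev v z.1.1, z.1.2.1.ev v a hv, z.1.2.2.ev v⟩,
    ⟨- ev v z.2.1, (z.2.2.1.ev v a hv).neg, (z.2.2.2.ev v).neg⟩), ?_⟩
  ext1 <;> ext1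
  · rw [Arr.Dif.D_fst]
    simp only
    rw [symb_d_ev hv z.1.2.1, eq_neg_of_add_eq_zero_left e1]
    simp
  · rw [Arr.Dif.D_snd, symb_shift_d]
    simp only
    rw [Arr.Dif.d_neg (z.2.2.1.ev v a hv), symb_d_ev hv z.2.2.1, e2]
    simp

end Symbol

section Adapted

variable {n : ℕ}

theorem exists_adapted_basis (V : Submodule ℂ (Fin n → ℂ)) :
    ∃ (r m : ℕ) (b : Module.Basis (Fin r ⊕ Fin m) ℂ (Fin n → ℂ)), r + m = n ∧
      (∀ a, b (Sum.inl a) ∈ V) ∧ ∀ v ∈ V, ∀ k, b.coord (Sum.inr k) v = 0 := by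
  obtain ⟨W, hW⟩ := Submodule.exists_isCompl V
  let b := ((Module.finBasis ℂ V).prod (Module.finBasis ℂ W)).map
    (Submodule.prodEquivOfIsCompl V W hW)
  refine ⟨_, _, b, ?_, fun a => ?_, fun v hv k => ?_⟩
  · have := Module.finrank_eq_card_basis b
    simpa using this.symm
  · simp [b]
  · have h : (Submodule.prodEquivOfIsCompl V W hW).symm v = (⟨v, hv⟩, 0) := by
      rw [LinearEquiv.symm_apply_eq]; simp
    simp [b, h]

variable {σ : Type*} (b : Module.Basis σ ℂ (Fin n → ℂ))

/-- The coordinate vector of a dual basis element. -/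
noncomputable def cov (a : σ) (k : Fin n) : ℂ := b.coord a (Pi.single k 1)

theorem sum_mul_cov (a : σ) (y : Fin n → ℂ) : ∑ k, y k * cov b a k = b.coord a y := by
  rw [LinearMap.pi_apply_eq_sum_univ (b.coord a) y]
  refine Finset.sum_congr rfl fun k _ => ?_
  rw [smul_eq_mul, cov]
  congr 2
  ext j
  simp [Pi.single_apply, eq_comm]

end Adapted

section Seq

variable {n p : ℕ} {c : Fin p → Fin n → ℂ} {hc : Sep c}

theorem exists_regSeq (P : Ideal (Sg n p)) [hP : P.IsPrime]
    (hF : algebraMap (Rg n) (Sg n p) (arr c hc).F ∈ P)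
    (hlie : ∀ (v : Fin n → Rg n) (a : Fin p → Rg n),
      (∀ j, ∑ k, (arr c hc).c j k * v k = (arr c hc).l j * a j) → lieSymb v a ∈ P) :
    ∃ ts : List (Sg n p), n + 1 ≤ ts.length ∧ RegSeq P ⊥ ts := by
  classical
  let φ := algebraMap (Rg n) (Sg n p)
  have h1P : (1 : Sg n p) ∉ P := fun h => hP.ne_top ((Ideal.eq_top_iff_one _).2 h)
  let J : Finset (Fin p) := Finset.univ.filter fun j => φ (lin (c j)) ∈ P
  have hJ : ∀ j, j ∈ J ↔ φ (lin (c j)) ∈ P := fun j => by simp [J]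
  obtain ⟨j₀, hj₀⟩ : ∃ j₀, j₀ ∈ J := by
    rw [Arr.F, map_prod] at hF
    obtain ⟨j, -, hj⟩ := (hP.prod_mem_iff).1 hF
    exact ⟨j, (hJ j).2 hj⟩
  let V : Submodule ℂ (Fin n → ℂ) := Submodule.span ℂ (c '' J)
  have hVP : ∀ v ∈ V, φ (lin v) ∈ P := by
    intro v hv
    induction hv using Submodule.span_induction with
    | mem x hx =>
      obtain ⟨j, hj, rfl⟩ := hx
      exact (hJ j).1 hj
    | zero => simp
    | add x y _ _ hx hy => rw [map_add, map_add]; exact P.add_mem hx hy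
    | smul r x _ hx =>
      rw [map_smul, MvPolynomial.smul_eq_C_mul, map_mul]; exact P.mul_mem_left _ hx
  have hcV : ∀ j ∈ J, c j ∈ V := fun j hj => Submodule.subset_span ⟨j, hj, rfl⟩
  obtain ⟨r, m, b, hrm, hbV, hb0⟩ := exists_adapted_basis V
  let u : Rg n := ∏ j ∈ Jᶜ, lin (c j)
  have huP : φ u ∉ P := by
    intro h
    rw [map_prod] at h
    obtain ⟨j, hj, hj'⟩ := (hP.prod_mem_iff).1 h
    exact (Finset.mem_compl.1 hj) ((hJ j).2 hj')
  let ue : Fin p → Rg n := fun j => ∏ k ∈ Jᶜ.erase j, lin (c k)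
  have hue : ∀ j, j ∉ J → lin (c j) * ue j = u := fun j hj =>
    Finset.mul_prod_erase Jᶜ (fun k => lin (c k)) (Finset.mem_compl.2 hj)
  let vη : Fin m → Fin n → Rg n := fun k i => u * C (cov b (Sum.inr k) i)
  let aη : Fin m → Fin p → Rg n := fun k j =>
    if j ∈ J then 0 else ue j * C (b.coord (Sum.inr k) (c j))
  have hcC : ∀ (a : Fin r ⊕ Fin m) j, ∑ k, (C (c j k) * C (cov b a k) : Rg n) =
      C (b.coord a (c j)) := fun a j => by
    rw [← sum_mul_cov, map_sum]
    exact Finset.sum_congr rfl fun k _ => by rw [C_mul]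
  have hη : ∀ k j, ∑ i, (arr c hc).c j i * vη k i = (arr c hc).l j * aη k j := by
    intro k j
    have : ∑ i, (arr c hc).c j i * vη k i = u * C (b.coord (Sum.inr k) (c j)) := by
      rw [← hcC, Finset.mul_sum]
      exact Finset.sum_congr rfl fun i _ => mul_left_comm _ _ _
    rw [this]
    change _ = lin (c j) * (if j ∈ J then 0 else _)
    split_ifs with hj
    · rw [hb0 _ (hcV j hj)]; simp
    · rw [← mul_assoc, hue j hj]
  have hηP := fun k => hlie _ _ (hη k)
  let vE : Fin n → Rg n := fun i => u * ∑ a : Fin r, lin (b (Sum.inl a)) * C (cov b (Sum.inl a) i)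
  let aE : Fin p → Rg n := fun j =>
    if j ∈ J then u else ue j * ∑ a : Fin r, lin (b (Sum.inl a)) * C (b.coord (Sum.inl a) (c j))
  have hE : ∀ j, ∑ i, (arr c hc).c j i * vE i = (arr c hc).l j * aE j := by
    intro j
    have : ∑ i, (arr c hc).c j i * vE i =
        u * ∑ a : Fin r, lin (b (Sum.inl a)) * C (b.coord (Sum.inl a) (c j)) := by
      simp only [← hcC, vE, Finset.mul_sum]
      rw [Finset.sum_comm]
      refine Finset.sum_congr rfl fun a _ => Finset.sum_congr rfl fun i _ => ?_
      change C (c j i) * _ = _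
      ring
    rw [this]
    change _ = lin (c j) * (if j ∈ J then u else _)
    split_ifs with hj
    · rw [mul_comm]
      congr 1
      conv_rhs => rw [← b.sum_repr (c j), Fintype.sum_sum_type]
      have h0 : ∀ k, b.repr (c j) (Sum.inr k) = 0 := fun k => hb0 _ (hcV j hj) k
      simp only [h0, zero_smul, Finset.sum_const_zero, add_zero, map_sum, map_smul]
      exact Finset.sum_congr rfl fun a _ => by
        rw [MvPolynomial.smul_eq_C_mul, mul_comm]; rfl
    · rw [← mul_assoc, hue j hj]
  have hσP : ∑ j ∈ J, (vs j : Sg n p) ∈ P := by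
    have h1 := hlie _ _ hE
    have hsumP : ∀ f : Fin r → ℂ, φ (∑ a : Fin r, lin (b (Sum.inl a)) * C (f a)) ∈ P := fun f => by
      rw [map_sum]
      exact P.sum_mem fun a _ => by
        rw [map_mul]; exact P.mul_mem_right _ (hVP _ (hbV a))
    have h2 : φ u * ∑ j ∈ J, (vs j : Sg n p) = ∑ i, vxi i * φ (vE i) -
        ∑ j ∈ Jᶜ, vs j * φ (aE j) - lieSymb vE aE := by
      rw [lieSymb, ← Finset.sum_add_sum_compl J (fun j => (vs j : Sg n p) * algebraMap _ _ (aE j))]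
      have h3 : ∑ j ∈ J, (vs j : Sg n p) * algebraMap (Rg n) (Sg n p) (aE j) =
          φ u * ∑ j ∈ J, (vs j : Sg n p) := by
        rw [Finset.mul_sum]
        refine Finset.sum_congr rfl fun j hj => ?_
        simp only [aE, hj, if_true]
        rw [mul_comm]
      rw [h3]
      ring
    refine (hP.mem_or_mem (?_ : φ u * _ ∈ P)).resolve_left huP
    rw [h2]
    refine P.sub_mem (P.sub_mem (P.sum_mem fun i _ => ?_) (P.sum_mem fun j hj => ?_)) h1
    · rw [map_mul]
      exact P.mul_mem_left _ (P.mul_mem_left _ (hsumP _))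
    · simp only [aE, Finset.mem_compl.1 hj, if_false]
      rw [map_mul]
      exact P.mul_mem_left _ (P.mul_mem_left _ (hsumP _))
  let cy : Fin r → Cert P := fun a =>
    { t := φ (lin (b (Sum.inl a)))
      u := 1
      D := dir (xdir (cov b (Sum.inl a)))
      mem := hVP _ (hbV a)
      hu := h1P
      Dt := by rw [dir_lin]; simp [xdir, sum_mul_cov]
      Du := by simp
      nil := locNil_dir _ }
  let cσ : Cert P :=
    { t := ∑ j ∈ J, vs j
      u := 1
      D := dir (Sum.elim 0 (Sum.elim 0 (Pi.single j₀ 1)))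
      mem := hσP
      hu := h1P
      Dt := by
        rw [map_sum, Finset.sum_eq_single_of_mem j₀ hj₀]
        · simp
        · intro j _ hj
          simp [hj]
      Du := by simp
      nil := locNil_dir _ }
  have hDη : ∀ k k', dir (Sum.elim (b (Sum.inr k)) 0) (lieSymb (p := p) (vη k') (aη k')) =
      if k = k' then φ u else 0 := by
    intro k k'
    have hx : ∀ r : Rg n, dir (p := p) (Sum.elim (b (Sum.inr k)) 0) (algebraMap _ _ r) = 0 :=
      dir_algebraMap fun _ => rfl
    simp only [lieSymb, map_sub, map_sum, Derivation.leibniz, hx, dir_X, Sum.elim_inl,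
      Sum.elim_inr, Pi.zero_apply, map_zero, smul_zero, add_zero, zero_add, sub_zero,
      Finset.sum_const_zero]
    have : ∑ i, algebraMap (Rg n) (Sg n p) (vη k' i) • C (b (Sum.inr k) i) =
        φ u * C (b.coord (Sum.inr k') (b (Sum.inr k))) := by
      rw [← sum_mul_cov, map_sum, Finset.mul_sum]
      refine Finset.sum_congr rfl fun i _ => ?_
      simp only [vη]
      rw [map_mul, smul_eq_mul, C_mul, algebraMap_eq (C _), rename_C]
      ring
    rw [this]
    simp only [Module.Basis.coord_apply, Module.Basis.repr_self, Finsupp.single_apply]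
    by_cases h : k = k' <;> simp [h]
  let cη : Fin m → Cert P := fun k =>
    { t := lieSymb (vη k) (aη k)
      u := φ u
      D := dir (Sum.elim (b (Sum.inr k)) 0)
      mem := hηP k
      hu := huP
      Dt := by rw [hDη, if_pos rfl]
      Du := dir_algebraMap (fun _ => rfl) _
      nil := locNil_dir _ }
  let L : List (Cert P) := (List.finRange r).map cy ++ ([cσ] ++ (List.finRange m).map cη)
  refine ⟨L.map Cert.t, ?_, RegSeq.of_cert L ?_ ⊥ ?_⟩
  · simp [L]; omega
  · simp only [L, List.pairwise_append, List.pairwise_map, List.mem_map, List.mem_append,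
      List.mem_singleton, List.pairwise_singleton, true_and]
    refine ⟨(List.nodup_finRange r).imp fun {a a'} h => ?_, ⟨(List.nodup_finRange m).imp
      fun {k k'} h => ?_, ?_⟩, ?_⟩
    · change dir (xdir (cov b (Sum.inl a'))) (φ (lin (b (Sum.inl a)))) = 0
      rw [dir_lin]
      simp [xdir, sum_mul_cov, h]
    · change dir (Sum.elim (b (Sum.inr k')) 0) (lieSymb _ _) = 0
      rw [hDη, if_neg (Ne.symm h)]
    · rintro _ rfl _ ⟨k, -, rfl⟩
      change dir (Sum.elim (b (Sum.inr k)) 0) (∑ j ∈ J, vs j) = 0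
      simp
    · rintro _ ⟨a, -, rfl⟩ x (rfl | ⟨k, -, rfl⟩)
      · exact dir_algebraMap (fun _ => rfl) _
      · exact dir_algebraMap (fun _ => rfl) _
  · intro a _ x hx
    rw [Ideal.mem_bot.1 hx, map_zero]
    exact Ideal.zero_mem _

theorem symb_exact {m : ℕ} (ℱ : (arr c hc).FreeData m) :
    ∀ k, ∀ z : (arr c hc).Cone (Sg n p) (k + 1), (symb c hc).D k z = 0 →
      z ∈ LinearMap.range ((symb c hc).D (k + 1)) := by
  have := fun k => ℱ.projective_cone (Sg n p) k
  refine exact_of_regSeq (n + 1) (Arr.Dif.D_D _) (fun k hk z => Arr.cone_big hk z)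
    fun P hP h => exists_regSeq (c := c) (hc := hc) P (h _ symb_F_kills)
      fun v a hv => h _ (symb_lie_kills hv)

end Seq

section Weyl

variable {n p : ℕ}

/-- Polynomials in `x` and `s` inside the big polynomial ring. -/
noncomputable def emb : MvPolynomial (Fin n ⊕ Fin p) ℂ →ₐ[ℂ] Sg n p := rename Sum.inr

@[simp] theorem emb_X (i : Fin n ⊕ Fin p) : emb (X i : MvPolynomial (Fin n ⊕ Fin p) ℂ) =
    X (Sum.inr i) := rename_X _ _

theorem emb_rename (r : Rg n) : emb (p := p) (rename Sum.inl r) = algebraMap (Rg n) (Sg n p) r := by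
  rw [emb, rename_rename, algebraMap_eq]

theorem emb_mul_C (a : ℂ) (r : MvPolynomial (Fin n ⊕ Fin p) ℂ) : C a * emb r = emb (C a * r) := by
  simp [emb]

theorem Sg_induction_prod {Q : Sg n p → Prop} (hadd : ∀ f g, Q f → Q g → Q (f + g))
    (hprod : ∀ (h : MvPolynomial (Fin n) ℂ) r, Q (rename Sum.inl h * emb r)) (f : Sg n p) : Q f := by
  have key : ∀ (h : MvPolynomial (Fin n) ℂ) r, Q (f * (rename Sum.inl h * emb r)) := by
    induction f using MvPolynomial.induction_on with
    | C a =>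
      intro h r
      rw [mul_left_comm, emb_mul_C]
      exact hprod _ _
    | add f g hf hg =>
      intro h r
      rw [add_mul]
      exact hadd _ _ (hf h r) (hg h r)
    | mul_X f s hf =>
      intro h r
      rcases s with i | s
      · have := hf (X i * h) r
        rw [map_mul, rename_X] at this
        convert this using 1; ring
      · have := hf h (X s * r)
        rw [map_mul, emb_X] at this
        convert this using 1; ring
  simpa using key 1 1

theorem Sg_induction {Q : Sg n p → Prop} (hadd : ∀ f g, Q f → Q g → Q (f + g))
    (hemb : ∀ r, Q (emb r)) (hxi : ∀ i f, Q f → Q (vxi i * f)) (f : Sg n p) : Q f := by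
  refine Sg_induction_prod hadd (fun h => ?_) f
  induction h using MvPolynomial.induction_on with
  | C a => intro r; rw [rename_C, emb_mul_C]; exact hemb _
  | add f g hf hg => intro r; rw [map_add, add_mul]; exact hadd _ _ (hf r) (hg r)
  | mul_X f i hf =>
    intro r
    rw [map_mul, rename_X, mul_comm (rename _ f), mul_assoc]
    exact hxi i _ (hf r)

theorem pderiv_comm {σ : Type*} (i j : σ) (f : MvPolynomial σ ℂ) :
    pderiv i (pderiv j f) = pderiv j (pderiv i f) := by
  classical
  have : ⁅(pderiv i : Derivation ℂ (MvPolynomial σ ℂ) (MvPolynomial σ ℂ)),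
      (pderiv j : Derivation ℂ (MvPolynomial σ ℂ) (MvPolynomial σ ℂ))⁆ = 0 := by
    refine derivation_ext fun k => ?_
    rw [Derivation.commutator_apply, pderiv_X, pderiv_X]
    by_cases h : j = k <;> by_cases h' : i = k <;> simp [h, h']
  have h := congrArg (fun D : Derivation ℂ (MvPolynomial σ ℂ) (MvPolynomial σ ℂ) => D f) this
  rw [Derivation.commutator_apply] at h
  exact sub_eq_zero.1 h

/-- Right multiplication by `ξ i` for the normally ordered product. -/
noncomputable def yop (i : Fin n) : Module.End ℂ (Sg n p) :=
  LinearMap.mulLeft ℂ (vxi i) - (pderiv (Sum.inr (Sum.inl i))).toLinearMap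

/-- Left multiplication by `x i` for the normally ordered product. -/
noncomputable def xop (i : Fin n) : Module.End ℂ (Sg n p) :=
  LinearMap.mulLeft ℂ (vx i) - (pderiv (Sum.inl i)).toLinearMap

theorem yop_apply (i : Fin n) (f : Sg n p) :
    yop i f = vxi i * f - pderiv (Sum.inr (Sum.inl i)) f := rfl

theorem xop_apply (i : Fin n) (f : Sg n p) : xop i f = vx i * f - pderiv (Sum.inl i) f := rfl

theorem pderiv_emb (i : Fin n) (r : MvPolynomial (Fin n ⊕ Fin p) ℂ) :
    pderiv (Sum.inl i) (emb r) = 0 := by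
  induction r using MvPolynomial.induction_on with
  | C a => simp [emb]
  | add f g hf hg => simp [hf, hg]
  | mul_X f s hf => rw [map_mul, pderiv_mul, hf, emb_X, pderiv_X_of_ne (by simp)]; simp

theorem Sg_induction_yop {Q : Sg n p → Prop} (hadd : ∀ f g, Q f → Q g → Q (f + g))
    (hemb : ∀ r, Q (emb r)) (hy : ∀ i f, Q f → Q (yop i f)) (f : Sg n p) : Q f := by
  refine Sg_induction_prod hadd (fun h => ?_) f
  induction h using MvPolynomial.induction_on with
  | C a => intro r; rw [rename_C, emb_mul_C]; exact hemb _
  | add f g hf hg => intro r; rw [map_add, add_mul]; exact hadd _ _ (hf r) (hg r)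
  | mul_X f i hf =>
    intro r
    have h1 := hy i _ (hf r)
    have h2 := hf (pderiv (Sum.inl i) r)
    have h3 : pderiv (Sum.inr (Sum.inl i)) (rename (Sum.inl : Fin n → Fin n ⊕ (Fin n ⊕ Fin p)) f) =
        0 := by
      apply pderiv_eq_zero_of_notMem_vars
      intro hm
      have := vars_rename _ _ hm
      simp at this
    have h4 : pderiv (Sum.inr (Sum.inl i)) (emb r) = emb (pderiv (Sum.inl i) r) :=
      pderiv_rename Sum.inr_injective _ _
    convert hadd _ _ h1 h2 using 1
    rw [yop_apply, pderiv_mul, h3, h4, map_mul, rename_X]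
    ring

variable (n p) in
/-- Generators of the Weyl algebra acting on normally ordered symbols. -/
def gens : Set (Module.End ℂ (Sg n p)) :=
  Set.range xop ∪ ((Set.range fun i => LinearMap.mulLeft ℂ (vxi i)) ∪
    (Set.range fun j => LinearMap.mulLeft ℂ (vs j)))

variable (n p) in
/-- The Weyl algebra acting on normally ordered symbols. -/
noncomputable def Weyl : Subalgebra ℂ (Module.End ℂ (Sg n p)) := Algebra.adjoin ℂ (gens n p)

theorem weyl_comm {T : Module.End ℂ (Sg n p)} (hx : ∀ i f, xop i (T f) = T (xop i f))
    (hxi : ∀ i f, vxi i * T f = T (vxi i * f)) (hs : ∀ j f, vs j * T f = T (vs j * f))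
    (P : Weyl n p) (f : Sg n p) : P • T f = T (P • f) := by
  have : Weyl n p ≤ Subalgebra.centralizer ℂ {T} := by
    refine Algebra.adjoin_le ?_
    rintro _ (⟨i, rfl⟩ | ⟨i, rfl⟩ | ⟨j, rfl⟩) _ rfl
    · exact LinearMap.ext fun f => (hx i f).symm
    · exact LinearMap.ext fun f => (hxi i f).symm
    · exact LinearMap.ext fun f => (hs j f).symm
  exact (LinearMap.congr_fun (this P.2 T rfl) f).symm

theorem weyl_mul_emb (r : MvPolynomial (Fin n ⊕ Fin p) ℂ) (P : Weyl n p) (f : Sg n p) :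
    P • (emb r * f) = emb r * (P • f) := by
  refine weyl_comm (T := LinearMap.mulLeft ℂ (emb r)) (fun i f => ?_) (fun i f => ?_)
    (fun i f => ?_) P f
  · simp only [LinearMap.mulLeft_apply, xop_apply, pderiv_mul, pderiv_emb]
    ring
  · exact mul_left_comm _ _ _
  · exact mul_left_comm _ _ _

instance weylR : SMulCommClass (Weyl n p) (Rg n) (Sg n p) where
  smul_comm P r f := by
    rw [Algebra.smul_def, Algebra.smul_def, ← emb_rename, weyl_mul_emb]

theorem weyl_yop (i : Fin n) (P : Weyl n p) (f : Sg n p) : P • yop i f = yop i (P • f) := by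
  refine weyl_comm (fun k f => ?_) (fun k f => ?_) (fun j f => ?_) P f
  · have h1 : pderiv (Sum.inl k) (pderiv (Sum.inr (Sum.inl i)) f) =
        pderiv (Sum.inr (Sum.inl i)) (pderiv (Sum.inl k) f) := pderiv_comm _ _ _
    simp only [xop_apply, yop_apply, map_sub, pderiv_mul, h1]
    by_cases hk : k = i
    · subst hk
      simp only [pderiv_X_self]; ring
    · rw [pderiv_X_of_ne, pderiv_X_of_ne]
      · ring
      · simpa using hk
      · simpa using Ne.symm hk
  · rw [yop_apply, yop_apply, pderiv_mul, pderiv_X_of_ne (by simp)]; ring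
  · rw [yop_apply, yop_apply, pderiv_mul, pderiv_X_of_ne (by simp)]; ring

theorem weyl_smul_mk {T : Module.End ℂ (Sg n p)} (hT : T ∈ Weyl n p) (f : Sg n p) :
    (⟨T, hT⟩ : Weyl n p) • f = T f := rfl

theorem xop_mem (i : Fin n) : (xop i : Module.End ℂ (Sg n p)) ∈ Weyl n p :=
  Algebra.subset_adjoin (Or.inl ⟨i, rfl⟩)

theorem xi_mem (i : Fin n) : LinearMap.mulLeft ℂ (vxi i : Sg n p) ∈ Weyl n p :=
  Algebra.subset_adjoin (Or.inr (Or.inl ⟨i, rfl⟩))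

theorem s_mem (j : Fin p) : LinearMap.mulLeft ℂ (vs j : Sg n p) ∈ Weyl n p :=
  Algebra.subset_adjoin (Or.inr (Or.inr ⟨j, rfl⟩))

theorem weyl_surj (f : Sg n p) : ∃ P : Weyl n p, P • (1 : Sg n p) = f := by
  induction f using Sg_induction with
  | hadd f g hf hg =>
    obtain ⟨P, rfl⟩ := hf
    obtain ⟨Q, rfl⟩ := hg
    exact ⟨P + Q, add_smul P Q (1 : Sg n p)⟩
  | hemb r =>
    induction r using MvPolynomial.induction_on with
    | C a =>
      refine ⟨algebraMap ℂ (Weyl n p) a, ?_⟩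
      rw [algebraMap_smul (Weyl n p) a (1 : Sg n p), MvPolynomial.smul_eq_C_mul, emb, rename_C, mul_one]
    | add f g hf hg =>
      obtain ⟨P, hP⟩ := hf
      obtain ⟨Q, hQ⟩ := hg
      exact ⟨P + Q, by rw [add_smul, hP, hQ, map_add]⟩
    | mul_X f s hf =>
      obtain ⟨P, hP⟩ := hf
      rcases s with i | j
      · refine ⟨⟨xop i, xop_mem i⟩ * P, ?_⟩
        rw [mul_smul, hP, weyl_smul_mk, xop_apply, pderiv_emb, map_mul, emb_X, sub_zero, mul_comm]
      · refine ⟨⟨_, s_mem j⟩ * P, ?_⟩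
        rw [mul_smul, hP, weyl_smul_mk, map_mul, emb_X, mul_comm]
        rfl
  | hxi i f hf =>
    obtain ⟨P, rfl⟩ := hf
    exact ⟨⟨_, xi_mem i⟩ * P, by rw [mul_smul]; rfl⟩

theorem weyl_inj (P : Weyl n p) (h : P • (1 : Sg n p) = 0) : P = 0 := by
  have : ∀ f : Sg n p, P • f = 0 := by
    intro f
    induction f using Sg_induction_yop with
    | hadd f g hf hg => rw [smul_add, hf, hg, add_zero]
    | hemb r => rw [← mul_one (emb r), weyl_mul_emb, h, mul_zero]
    | hy i f hf => rw [weyl_yop, hf, map_zero]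
  exact Subtype.ext (LinearMap.ext this)

instance weylProjective : Module.Projective (Weyl n p) (Sg n p) :=
  Module.Projective.of_equiv (LinearEquiv.ofBijective
    (LinearMap.toSpanSingleton (Weyl n p) (Sg n p) 1)
    ⟨(injective_iff_map_eq_zero _).2 fun P h => weyl_inj P h, weyl_surj⟩)

variable (c : Fin p → Fin n → ℂ) (hc : Sep c)

theorem smul_C_mul (a : ℂ) (f : Sg n p) : (C a : Rg n) • f = C a * f := by
  rw [smul_eq, rename_C]

theorem yop_smul (i : Fin n) (r : Rg n) (f : Sg n p) : yop i (r • f) =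
    r • yop i f - pderiv i r • f := by
  rw [yop_apply, yop_apply, Algebra.smul_def, Algebra.smul_def, Algebra.smul_def, pderiv_mul,
    ← emb_rename, ← emb_rename]
  have h4 : ∀ r, pderiv (Sum.inr (Sum.inl i)) (emb (p := p) r) = emb (pderiv (Sum.inl i) r) :=
    fun r => pderiv_rename Sum.inr_injective _ _
  rw [h4, pderiv_rename Sum.inl_injective]
  ring

theorem pderiv_lin (i : Fin n) (v : Fin n → ℂ) : pderiv i (lin v) = C (v i) := by
  classical
  rw [lin_eq, map_sum]
  simp [pderiv_X, Pi.single_apply]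

/-- `yop` is linear over the Weyl algebra. -/
noncomputable def yL (i : Fin n) : Sg n p →ₗ[Weyl n p] Sg n p where
  toFun := yop i
  map_add' := map_add _
  map_smul' P f := (weyl_yop i P f).symm

/-- Multiplication by polynomials in `x` and `s` is linear over the Weyl algebra. -/
noncomputable def mL (r : MvPolynomial (Fin n ⊕ Fin p) ℂ) : Sg n p →ₗ[Weyl n p] Sg n p where
  toFun f := emb r * f
  map_add' := mul_add _
  map_smul' P f := (weyl_mul_emb r P f).symm

theorem yL_apply (i : Fin n) (f : Sg n p) : yL i f = yop i f := rfl

theorem mL_apply (r : MvPolynomial (Fin n ⊕ Fin p) ℂ) (f : Sg n p) : mL r f = emb r * f := rfl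

theorem yop_comm (i k : Fin n) (f : Sg n p) : yop i (yop k f) = yop k (yop i f) := by
  rw [yop_apply, yop_apply, yop_apply, yop_apply, map_sub, map_sub, pderiv_mul, pderiv_mul,
    pderiv_comm (Sum.inr (Sum.inl i)), pderiv_X_of_ne (by simp), pderiv_X_of_ne (by simp)]
  ring

theorem yop_shift (i : Fin n) (j : Fin p) (t : ℂ) (f : Sg n p) :
    yop i (emb (X (Sum.inr j) + C t) * f) = emb (X (Sum.inr j) + C t) * yop i f := by
  rw [yop_apply, yop_apply, pderiv_mul]
  have : pderiv (Sum.inr (Sum.inl i)) (emb (X (Sum.inr j) + C t : MvPolynomial (Fin n ⊕ Fin p) ℂ)) =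
      0 := by
    rw [map_add, map_add, emb_X, pderiv_X_of_ne (by simp), emb, rename_C, pderiv_C, add_zero]
  rw [this]; ring

/-- The noncommutative logarithmic differential. -/
noncomputable def nc (t : ℂ) : (arr c hc).Dif (Weyl n p) where
  A := yL
  B j := mL (X (Sum.inr j) + C t)
  γ := -1
  AA i k f := yop_comm i k f
  AB i j f := yop_shift i j t f
  BB i k f := by rw [mL_apply, mL_apply, mL_apply, mL_apply, mul_left_comm]
  B_R j r f := by rw [mL_apply, mL_apply, Algebra.smul_def, Algebra.smul_def, mul_left_comm]
  A_c i j k f := by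
    rw [yL_apply, yL_apply, yop_smul, arr, pderiv_C, zero_smul, sub_zero]
  A_l i j f := by
    rw [yL_apply, yL_apply, yop_smul, arr, pderiv_lin, neg_one_zsmul, sub_eq_add_neg]

variable {c hc}

theorem nc_dl (t : ℂ) (x : Finset (Fin n) → Sg n p) :
    (nc c hc t).dl x = ∑ i, cw (yop i).toAddMonoidHom (iota i x) := rfl

theorem nc_qB (t : ℂ) (x : Finset (Fin n) → Sg n p) :
    (nc c hc t).qB x = ∑ j, (emb (X (Sum.inr j) + C t) : Sg n p) • (arr c hc).q j x := rfl

theorem nc_shift_d (t : ℂ) (x : Finset (Fin n) → Sg n p) :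
    (nc c hc t).shift.d x = (nc c hc (t + 1)).d x := by
  have : (nc c hc t).shift.qB x = (nc c hc (t + 1)).qB x := by
    refine Finset.sum_congr rfl fun j _ => ?_
    ext1 I
    change emb (X (Sum.inr j) + C t : MvPolynomial (Fin n ⊕ Fin p) ℂ) * (arr c hc).q j x I -
      (-1 : ℤ) • (arr c hc).q j x I =
      emb (X (Sum.inr j) + C (t + 1) : MvPolynomial (Fin n ⊕ Fin p) ℂ) * (arr c hc).q j x I
    rw [C_add, map_add, map_add, map_add, C_1, map_one, neg_one_zsmul]
    ring
  rw [Arr.Dif.d, Arr.Dif.d, this]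
  rfl

end Weyl

section Comp

variable {n p : ℕ}

/-- The weights of the variables: `ξ` and `s` have weight one, `x` has weight zero. -/
def wt : Fin n ⊕ (Fin n ⊕ Fin p) → ℕ := Sum.elim 1 (Sum.elim 0 1)

/-- The homogeneous component of a given weight. -/
noncomputable def comp (m : ℕ) : Sg n p →ₗ[ℂ] Sg n p := weightedHomogeneousComponent wt m

/-- The homogeneous component of weight one less. -/
noncomputable def pcomp : ℕ → Sg n p →ₗ[ℂ] Sg n p
  | 0 => 0
  | m + 1 => comp m

theorem coeff_comp (m : ℕ) (f : Sg n p) (d : Fin n ⊕ (Fin n ⊕ Fin p) →₀ ℕ) :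
    (comp m f).coeff d = if Finsupp.weight wt d = m then f.coeff d else 0 := by
  rw [comp, coeff_weightedHomogeneousComponent]

theorem comp_comp (m k : ℕ) (f : Sg n p) : comp m (comp k f) = if m = k then comp k f else 0 := by
  ext d
  rw [coeff_comp, coeff_comp]
  split_ifs with h1 h2 h3 h4
  · rw [coeff_comp, if_pos h2]
  · omega
  · omega
  · rfl
  · rw [coeff_comp, if_neg (by omega)]
  · rfl

theorem comp_pcomp (m k : ℕ) (f : Sg n p) :
    comp m (pcomp k f) = if m + 1 = k then pcomp k f else 0 := by
  cases k with
  | zero => simp [pcomp]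
  | succ k => simp [pcomp, comp_comp]

theorem weight_eq {s : Fin n ⊕ (Fin n ⊕ Fin p)} {d : Fin n ⊕ (Fin n ⊕ Fin p) →₀ ℕ}
    (h : s ∈ d.support) : Finsupp.weight wt d = Finsupp.weight wt (d - Finsupp.single s 1) + wt s := by
  have : d = (d - Finsupp.single s 1) + Finsupp.single s 1 := by
    rw [tsub_add_cancel_of_le]
    rw [Finsupp.single_le_iff]
    exact Nat.one_le_iff_ne_zero.2 (Finsupp.mem_support_iff.1 h)
  conv_lhs => rw [this]
  rw [map_add]
  simp [Finsupp.weight_apply]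

theorem comp_X_mul_of_zero {s : Fin n ⊕ (Fin n ⊕ Fin p)} (hs : wt s = 0) (m : ℕ) (f : Sg n p) :
    comp m (X s * f) = X s * comp m f := by
  ext d
  rw [coeff_comp, coeff_X_mul', coeff_X_mul']
  by_cases h : s ∈ d.support
  · rw [if_pos h, if_pos h, coeff_comp, weight_eq h, hs, add_zero]
  · rw [if_neg h, if_neg h, ite_self]

theorem comp_X_mul_of_one {s : Fin n ⊕ (Fin n ⊕ Fin p)} (hs : wt s = 1) (m : ℕ) (f : Sg n p) :
    comp m (X s * f) = X s * pcomp m f := by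
  ext d
  rw [coeff_comp, coeff_X_mul', coeff_X_mul']
  by_cases h : s ∈ d.support
  · rw [if_pos h, if_pos h, weight_eq h, hs]
    cases m with
    | zero => simp [pcomp]
    | succ m => simp [pcomp, coeff_comp]
  · rw [if_neg h, if_neg h, ite_self]

theorem comp_smul (m : ℕ) (r : Rg n) (f : Sg n p) : comp m (r • f) = r • comp m f := by
  induction r using MvPolynomial.induction_on generalizing f with
  | C a => rw [smul_C_mul, smul_C_mul, ← MvPolynomial.smul_eq_C_mul, map_smul,
      MvPolynomial.smul_eq_C_mul]
  | add a b ha hb => rw [add_smul, add_smul, map_add, ha, hb]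
  | mul_X a i ha => rw [mul_smul, mul_smul, ha, X_smul, X_smul, comp_X_mul_of_zero (by simp [wt])]

theorem pcomp_smul (m : ℕ) (r : Rg n) (f : Sg n p) : pcomp m (r • f) = r • pcomp m f := by
  cases m with
  | zero => simp [pcomp]
  | succ m => exact comp_smul m r f

theorem comp_pderiv (m : ℕ) (i : Fin n) (f : Sg n p) :
    comp m (pderiv (Sum.inr (Sum.inl i)) f) = pderiv (Sum.inr (Sum.inl i)) (comp m f) := by
  ext d
  rw [coeff_comp, coeff_pderiv, coeff_pderiv, coeff_comp, map_add]
  have : Finsupp.weight wt (Finsupp.single (Sum.inr (Sum.inl i) : Fin n ⊕ (Fin n ⊕ Fin p)) 1) = 0 := by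
    simp [Finsupp.weight_apply, wt]
  rw [this, add_zero]
  split_ifs <;> simp

theorem eq_zero_of_comp {f : Sg n p} (h : ∀ m, comp m f = 0) : f = 0 := by
  ext d
  have := congrArg (coeff d) (h (Finsupp.weight wt d))
  rwa [coeff_comp, if_pos rfl] at this

theorem exists_comp_bound (f : Sg n p) : ∃ M, ∀ m, M ≤ m → comp m f = 0 := by
  refine ⟨f.support.sup (Finsupp.weight wt) + 1, fun m hm => ?_⟩
  ext d
  rw [coeff_comp]
  split_ifs with h
  · by_contra hd
    have := Finset.le_sup (f := Finsupp.weight wt) (mem_support_iff.2 hd)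
    omega
  · rfl

end Comp

section Transfer

variable {n p : ℕ} {c : Fin p → Fin n → ℂ} {hc : Sep c}

/-- Coefficientwise homogeneous components. -/
noncomputable def cc (m : ℕ) : (Finset (Fin n) → Sg n p) →+ (Finset (Fin n) → Sg n p) :=
  cw (comp m).toAddMonoidHom

/-- Coefficientwise shifted homogeneous components. -/
noncomputable def pcc (m : ℕ) : (Finset (Fin n) → Sg n p) →+ (Finset (Fin n) → Sg n p) :=
  cw (pcomp m).toAddMonoidHom

/-- The lower order part of the noncommutative differential. -/
noncomputable def low (c : Fin p → Fin n → ℂ) (hc : Sep c) (t : ℂ) (x : Finset (Fin n) → Sg n p) :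
    Finset (Fin n) → Sg n p :=
  ∑ i, cw (pderiv (Sum.inr (Sum.inl i))).toLinearMap.toAddMonoidHom (iota i x) +
    ∑ j, t • (arr c hc).q j x

theorem nc_d (t : ℂ) (x : Finset (Fin n) → Sg n p) :
    (nc c hc t).d x = (symb c hc).d x - low c hc t x := by
  rw [Arr.Dif.d, nc_dl, nc_qB, symb_d, low]
  have h1 : ∀ i, cw (yop i).toAddMonoidHom (iota i x) = (vxi i : Sg n p) • iota i x -
      cw (pderiv (Sum.inr (Sum.inl i))).toLinearMap.toAddMonoidHom (iota i x) := fun i => rfl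
  have h2 : ∀ j, (emb (X (Sum.inr j) + C t) : Sg n p) • (arr c hc).q j x =
      (vs j : Sg n p) • (arr c hc).q j x + t • (arr c hc).q j x := fun j => by
    rw [map_add, emb_X, add_smul]
    congr 1
    ext1 I
    rw [Pi.smul_apply, Pi.smul_apply, emb, rename_C, smul_eq_mul, MvPolynomial.smul_eq_C_mul]
  simp only [h1, h2, Finset.sum_sub_distrib, Finset.sum_add_distrib]
  abel

variable {x y : Finset (Fin n) → Sg n p}

theorem cc_log (m : ℕ) (h : (arr c hc).Log x) : (arr c hc).Log (cc m x) := h.cw _ (comp_smul m)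

theorem pcc_log (m : ℕ) (h : (arr c hc).Log x) : (arr c hc).Log (pcc m x) := h.cw _ (pcomp_smul m)

theorem cc_symb_d (m : ℕ) (h : (arr c hc).Log x) :
    cc m ((symb c hc).d x) = (symb c hc).d (pcc m x) := by
  rw [symb_d, symb_d, map_sub, map_sum, map_sum]
  congr 1
  · refine Finset.sum_congr rfl fun i _ => ?_
    rw [pcc, iota_cw]
    ext1 I
    exact comp_X_mul_of_one (by simp [wt]) m _
  · refine Finset.sum_congr rfl fun j _ => ?_
    rw [pcc, h.q_cw _ (pcomp_smul m)]
    ext1 I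
    exact comp_X_mul_of_one (by simp [wt]) m _

theorem cc_low (t : ℂ) (m : ℕ) (h : (arr c hc).Log x) :
    cc m (low c hc t x) = low c hc t (cc m x) := by
  rw [low, low, map_add, map_sum, map_sum]
  congr 1
  · refine Finset.sum_congr rfl fun i _ => ?_
    rw [cc, iota_cw]
    ext1 I
    exact comp_pderiv m i _
  · refine Finset.sum_congr rfl fun j _ => ?_
    rw [cc, h.q_cw _ (comp_smul m)]
    ext1 I
    exact map_smul (comp m) t _

theorem low_zero (t : ℂ) : low c hc t 0 = 0 := by
  simp [low, Arr.q_zero]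

theorem cc_smul (m : ℕ) (r : Rg n) : cc m (r • x) = r • cc m x :=
  funext fun I => comp_smul m r (x I)

theorem cc_cc (m k : ℕ) : cc m (cc k x) = if m = k then cc k x else 0 := by
  ext1 I
  refine (comp_comp m k (x I)).trans ?_
  split_ifs <;> rfl

theorem cc_pcc (m k : ℕ) : cc m (pcc k x) = if m + 1 = k then pcc k x else 0 := by
  ext1 I
  refine (comp_pcomp m k (x I)).trans ?_
  split_ifs <;> rfl

theorem eq_zero_of_cc (h : ∀ m, cc m x = 0) : x = 0 :=
  funext fun I => eq_zero_of_comp fun m => congrFun (h m) I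

theorem exists_cc_bound (x : Finset (Fin n) → Sg n p) : ∃ M, ∀ m, M ≤ m → cc m x = 0 := by
  choose M hM using fun I => exists_comp_bound (x I)
  exact ⟨Finset.univ.sup M, fun m hm => funext fun I =>
    hM I m ((Finset.le_sup (Finset.mem_univ I)).trans hm)⟩

theorem pcc_succ (m : ℕ) : pcc (m + 1) x = cc m x := rfl

variable {m₀ : ℕ} (ℱ : (arr c hc).FreeData m₀)

include ℱ in
theorem nc_exact_aux (t : ℂ) (k M : ℕ) (z : (arr c hc).Cone (Weyl n p) (k + 1))
    (hz : (nc c hc t).D k z = 0) (h1 : ∀ m, M ≤ m → cc m (z.1 : Finset (Fin n) → Sg n p) = 0)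
    (h2 : ∀ m, M + 1 ≤ m → cc m (z.2 : Finset (Fin n) → Sg n p) = 0) :
    z ∈ LinearMap.range ((nc c hc t).D (k + 1)) := by
  induction M generalizing z with
  | zero =>
    have e1 : (z.1 : Finset (Fin n) → Sg n p) = 0 := eq_zero_of_cc fun m => h1 m (Nat.zero_le m)
    have e2 : (z.2 : Finset (Fin n) → Sg n p) = 0 := by
      have e : (nc c hc t).d z.1 + (arr c hc).F • (z.2 : Finset (Fin n) → Sg n p) = 0 :=
        congrArg (fun w => (w.1 : Finset (Fin n) → Sg n p)) hz
      rw [e1, nc_d, low_zero] at e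
      have e0 : (symb c hc).d 0 = 0 := by simp [symb_d, Arr.q_zero]
      rw [e0, sub_zero, zero_add] at e
      exact (arr c hc).F_injE (e.trans (smul_zero _).symm)
    have : z = 0 := by ext1 <;> ext1 <;> assumption
    rw [this]
    exact Submodule.zero_mem _
  | succ M ih =>
    obtain ⟨⟨x, hx⟩, ⟨y, hy⟩⟩ := z
    have e1 : (nc c hc t).d x + (arr c hc).F • y = 0 :=
      congrArg (fun w => (w.1 : Finset (Fin n) → Sg n p)) hz
    have e2 : (nc c hc (t + 1)).d y = 0 := by
      have e : -(nc c hc t).shift.d y = 0 :=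
        congrArg (fun w => (w.2 : Finset (Fin n) → Sg n p)) hz
      rwa [nc_shift_d, neg_eq_zero] at e
    simp only at h1 h2
    have f1 : (symb c hc).d (cc M x) + (arr c hc).F • cc (M + 1) y = 0 := by
      have := congrArg (cc (M + 1)) e1
      rw [map_add, nc_d, map_sub, cc_symb_d _ hx.1, cc_low _ _ hx.1, h1 (M + 1) le_rfl, low_zero,
        cc_smul, map_zero, sub_zero, pcc_succ] at this
      exact this
    have f2 : (symb c hc).d (cc (M + 1) y) = 0 := by
      have := congrArg (cc (M + 2)) e2
      rw [nc_d, map_sub, cc_symb_d _ hy.1, cc_low _ _ hy.1, h2 (M + 2) le_rfl, low_zero,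
        map_zero, sub_zero, pcc_succ] at this
      exact this
    obtain ⟨w, hw⟩ := symb_exact ℱ k (⟨cc M x, cc_log M hx.1, hx.2.cw _⟩,
      ⟨cc (M + 1) y, cc_log (M + 1) hy.1, hy.2.cw _⟩) (by
        ext1 <;> ext1
        · rw [Arr.Dif.D_fst]; exact f1
        · rw [Arr.Dif.D_snd, symb_shift_d]
          simp only
          rw [f2, neg_zero]; rfl)
    obtain ⟨⟨x', hx'⟩, ⟨y', hy'⟩⟩ := w
    have g1 : (symb c hc).d x' + (arr c hc).F • y' = cc M x :=
      congrArg (fun w => (w.1 : Finset (Fin n) → Sg n p)) hw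
    have g2 : - (symb c hc).d y' = cc (M + 1) y := by
      have e : -(symb c hc).shift.d y' = cc (M + 1) y :=
        congrArg (fun w => (w.2 : Finset (Fin n) → Sg n p)) hw
      rwa [symb_shift_d] at e
    have k1 : (symb c hc).d (pcc M x') + (arr c hc).F • cc M y' = cc M x := by
      have := congrArg (cc M) g1
      rwa [map_add, cc_symb_d _ hx'.1, cc_smul, cc_cc, if_pos rfl] at this
    have k2 : - (symb c hc).d (cc M y') = cc (M + 1) y := by
      have := congrArg (cc (M + 1)) g2
      rwa [map_neg, cc_symb_d _ hy'.1, cc_cc, if_pos rfl, pcc_succ] at this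
    let w₀ : (arr c hc).Cone (Weyl n p) (k + 2) :=
      (⟨pcc M x', pcc_log M hx'.1, hx'.2.cw _⟩, ⟨cc M y', cc_log M hy'.1, hy'.2.cw _⟩)
    have hlx := pcc_log M hx'.1
    have hly := cc_log M hy'.1
    have d1 : (((nc c hc t).D (k + 1) w₀).1 : Finset (Fin n) → Sg n p) =
        cc M x - low c hc t (pcc M x') := by
      rw [Arr.Dif.D_fst, nc_d, ← k1]
      simp only [w₀]
      abel
    have d2 : (((nc c hc t).D (k + 1) w₀).2 : Finset (Fin n) → Sg n p) =
        cc (M + 1) y + low c hc (t + 1) (cc M y') := by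
      rw [Arr.Dif.D_snd, nc_shift_d, nc_d, ← k2]
      simp only [w₀]
      abel
    have key := ih ((⟨x, hx⟩, ⟨y, hy⟩) - (nc c hc t).D (k + 1) w₀) ?_ ?_ ?_
    · have := Submodule.add_mem _ key (LinearMap.mem_range_self ((nc c hc t).D (k + 1)) w₀)
      rwa [sub_add_cancel] at this
    · rw [map_sub, hz, Arr.Dif.D_D, sub_zero]
    · intro m hm
      rw [Prod.fst_sub, Submodule.coe_sub, d1, map_sub, map_sub, cc_low _ _ hlx, cc_pcc,
        if_neg (by omega), low_zero, sub_zero, cc_cc]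
      split_ifs with h
      · rw [h, sub_self]
      · rw [h1 m (by omega), sub_zero]
    · intro m hm
      rw [Prod.snd_sub, Submodule.coe_sub, d2, map_sub, map_add, cc_low _ _ hly, cc_cc m M,
        if_neg (by omega), low_zero, add_zero, cc_cc]
      split_ifs with h
      · rw [h, sub_self]
      · rw [h2 m (by omega), sub_zero]

include ℱ in
theorem nc_exact (t : ℂ) (k : ℕ) (z : (arr c hc).Cone (Weyl n p) (k + 1))
    (hz : (nc c hc t).D k z = 0) : z ∈ LinearMap.range ((nc c hc t).D (k + 1)) := by
  obtain ⟨M, hM⟩ := exists_cc_bound (z.1 : Finset (Fin n) → Sg n p)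
  obtain ⟨M', hM'⟩ := exists_cc_bound (z.2 : Finset (Fin n) → Sg n p)
  exact nc_exact_aux ℱ t k (max M M') z hz (fun m hm => hM m ((le_max_left _ _).trans hm))
    fun m hm => hM' m ((le_max_right M M').trans ((Nat.le_succ _).trans hm))

end Transfer

section Homotopy

variable {T : Type*} [Ring T]

theorem exists_lift_of_mem_range {P N K : Type*} [AddCommGroup P] [Module T P] [AddCommGroup N]
    [Module T N] [AddCommGroup K] [Module T K] [Module.Projective T P] (f : P →ₗ[T] N)
    (g : K →ₗ[T] N) (h : ∀ z, f z ∈ LinearMap.range g) : ∃ e : P →ₗ[T] K, ∀ z, g (e z) = f z := by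
  obtain ⟨e, he⟩ := Module.projective_lifting_property g.rangeRestrict
    (f.codRestrict (LinearMap.range g) h) g.surjective_rangeRestrict
  exact ⟨e, fun z => congrArg Subtype.val (LinearMap.congr_fun he z)⟩

variable {K : ℕ → Type*} [∀ k, AddCommGroup (K k)] [∀ k, Module T (K k)]
  [∀ k, Module.Projective T (K k)]

theorem exists_homotopy (d : ∀ k, K (k + 1) →ₗ[T] K k) (dd : ∀ k z, d k (d (k + 1) z) = 0)
    (ex : ∀ k z, d k z = 0 → z ∈ LinearMap.range (d (k + 1))) (β : ∀ k, K k →ₗ[T] K k)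
    (comm : ∀ k z, d k (β (k + 1) z) = β k (d k z)) (h0 : ∀ z, β 0 z ∈ LinearMap.range (d 0))
    (k : ℕ) : ∃ h : K k →ₗ[T] K (k + 1), ∀ z, d k (h (d k z)) = β k (d k z) := by
  induction k with
  | zero =>
    obtain ⟨h, hh⟩ := exists_lift_of_mem_range (β 0) (d 0) h0
    exact ⟨h, fun z => hh _⟩
  | succ k ih =>
    obtain ⟨h, hh⟩ := ih
    obtain ⟨h', hh'⟩ := exists_lift_of_mem_range (β (k + 1) - h ∘ₗ d k) (d (k + 1)) fun z =>
      ex k _ (by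
        rw [LinearMap.sub_apply, LinearMap.comp_apply, map_sub, comm, hh, sub_self])
    refine ⟨h', fun z => ?_⟩
    rw [hh', LinearMap.sub_apply, LinearMap.comp_apply, dd, map_zero, sub_zero]

theorem exists_homotopy_top (d : ∀ k, K (k + 1) →ₗ[T] K k) (dd : ∀ k z, d k (d (k + 1) z) = 0)
    (ex : ∀ k z, d k z = 0 → z ∈ LinearMap.range (d (k + 1))) (β : ∀ k, K k →ₗ[T] K k)
    (comm : ∀ k z, d k (β (k + 1) z) = β k (d k z)) (h0 : ∀ z, β 0 z ∈ LinearMap.range (d 0))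
    (k : ℕ) (hk : ∀ z : K (k + 2), z = 0) :
    ∃ h : K k →ₗ[T] K (k + 1), ∀ z, h (d k z) = β (k + 1) z := by
  obtain ⟨h, hh⟩ := exists_homotopy d dd ex β comm h0 k
  refine ⟨h, fun z => sub_eq_zero.1 ?_⟩
  obtain ⟨w, hw⟩ := ex k (h (d k z) - β (k + 1) z) (by rw [map_sub, hh, comm, sub_self])
  rw [← hw, hk w, map_zero]

end Homotopy

section Operators

variable {n p : ℕ} {𝒜 : Type*} [Ring 𝒜] [Algebra ℂ 𝒜]

theorem exists_aeval_of_commute {σ : Type*} (T : σ → 𝒜) (hT : ∀ i k, T i * T k = T k * T i) :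
    ∃ τ : MvPolynomial σ ℂ →ₐ[ℂ] 𝒜, ∀ i, τ (X i) = T i := by
  have hcomm := Algebra.isMulCommutative_adjoin ℂ (s := Set.range T) (by
    rintro _ ⟨i, rfl⟩ _ ⟨k, rfl⟩; exact hT i k)
  let _ : CommRing (Algebra.adjoin ℂ (Set.range T)) :=
    open scoped IsMulCommutative in inferInstance
  refine ⟨(Algebra.adjoin ℂ (Set.range T)).val.comp
    (aeval fun i => (⟨T i, Algebra.subset_adjoin ⟨i, rfl⟩⟩ : Algebra.adjoin ℂ (Set.range T))),
    fun i => ?_⟩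
  rw [AlgHom.comp_apply, aeval_X]
  rfl

theorem exists_linear_of_algHoms (τ : MvPolynomial (Fin n) ℂ →ₐ[ℂ] 𝒜)
    (ψ : MvPolynomial (Fin n ⊕ Fin p) ℂ →ₐ[ℂ] 𝒜) :
    ∃ Φ : Sg n p →ₗ[ℂ] 𝒜, ∀ h r, Φ (rename Sum.inl h * emb r) = τ h * ψ r := by
  refine ⟨(basisMonomials (Fin n ⊕ (Fin n ⊕ Fin p)) ℂ).constr ℂ fun d =>
    τ (monomial (d.comapDomain Sum.inl Sum.inl_injective.injOn) 1) *
      ψ (monomial (d.comapDomain Sum.inr Sum.inr_injective.injOn) 1), fun h r => ?_⟩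
  induction h using MvPolynomial.induction_on' with
  | add f g hf hg => rw [map_add, add_mul, map_add, hf, hg, map_add, add_mul]
  | monomial a u =>
    induction r using MvPolynomial.induction_on' with
    | add f g hf hg => rw [map_add, mul_add, map_add, hf, hg, map_add, mul_add]
    | monomial b v =>
      rw [emb, rename_monomial, rename_monomial, monomial_mul, ← mul_one (u * v),
        ← smul_eq_mul (u * v), ← smul_monomial, map_smul]
      have := (basisMonomials (Fin n ⊕ (Fin n ⊕ Fin p)) ℂ).constr_basis ℂ (fun d =>
        τ (monomial (d.comapDomain Sum.inl Sum.inl_injective.injOn) 1) *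
          ψ (monomial (d.comapDomain Sum.inr Sum.inr_injective.injOn) 1))
        (a.mapDomain Sum.inl + b.mapDomain Sum.inr)
      rw [coe_basisMonomials] at this
      rw [this]
      have e1 : (a.mapDomain Sum.inl + b.mapDomain Sum.inr :
          Fin n ⊕ (Fin n ⊕ Fin p) →₀ ℕ).comapDomain Sum.inl Sum.inl_injective.injOn = a := by
        ext i
        rw [Finsupp.comapDomain_apply, Finsupp.add_apply,
          Finsupp.mapDomain_apply Sum.inl_injective, Finsupp.mapDomain_of_notMem_range _ _ (by simp),
          add_zero]
      have e2 : (a.mapDomain Sum.inl + b.mapDomain Sum.inr :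
          Fin n ⊕ (Fin n ⊕ Fin p) →₀ ℕ).comapDomain Sum.inr Sum.inr_injective.injOn = b := by
        ext i
        rw [Finsupp.comapDomain_apply, Finsupp.add_apply,
          Finsupp.mapDomain_apply Sum.inr_injective, Finsupp.mapDomain_of_notMem_range _ _ (by simp),
          zero_add]
      rw [e1, e2]
      have e3 : (monomial a u : MvPolynomial (Fin n) ℂ) = u • monomial a 1 := by
        rw [smul_monomial, smul_eq_mul, mul_one]
      have e4 : (monomial b v : MvPolynomial (Fin n ⊕ Fin p) ℂ) = v • monomial b 1 := by
        rw [smul_monomial, smul_eq_mul, mul_one]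
      rw [e3, e4, map_smul, map_smul, smul_mul_smul_comm]

theorem exists_ordered_eval (T : Fin n → 𝒜) (hT : ∀ i k, T i * T k = T k * T i)
    (ψ : MvPolynomial (Fin n ⊕ Fin p) ℂ →ₐ[ℂ] 𝒜) :
    ∃ Φ : Sg n p →ₗ[ℂ] 𝒜, Φ 1 = 1 ∧ (∀ i f, Φ (vxi i * f) = T i * Φ f) ∧
      ∀ r f, Φ (emb r * f) = Φ f * ψ r := by
  obtain ⟨τ, hτ⟩ := exists_aeval_of_commute T hT
  obtain ⟨Φ, hΦ⟩ := exists_linear_of_algHoms τ ψ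
  refine ⟨Φ, ?_, fun i f => ?_, fun r f => ?_⟩
  · simpa using hΦ 1 1
  · induction f using Sg_induction_prod with
    | hadd f g hf hg => rw [mul_add, map_add, hf, hg, map_add, mul_add]
    | _ h r =>
      rw [hΦ, ← mul_assoc (vxi i), vxi, ← rename_X, ← map_mul, hΦ, map_mul, hτ, mul_assoc]
  · induction f using Sg_induction_prod with
    | hadd f g hf hg => rw [mul_add, map_add, hf, hg, map_add, add_mul]
    | _ h r' =>
      rw [hΦ, mul_left_comm, ← map_mul, hΦ, mul_comm r, map_mul, mul_assoc]

end Operators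

section Twisted

variable {n p : ℕ} (c : Fin p → Fin n → ℂ) (hc : Sep c)

/-- The polynomial ring in the coordinates and the parameters. -/
abbrev Rs (n p : ℕ) : Type := MvPolynomial (Fin n ⊕ Fin p) ℂ

/-- The product of the forms, in the polynomial ring with parameters. -/
noncomputable def FF : Rs n p := rename Sum.inl (arr c hc).F

/-- The product of all the forms but one, in the polynomial ring with parameters. -/
noncomputable def FFe (j : Fin p) : Rs n p := rename Sum.inl ((arr c hc).Fe j)

/-- The numerator of the logarithmic derivative of `l^(s+t)`. -/
noncomputable def GG (t : ℂ) (i : Fin n) : Rs n p :=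
  ∑ j, (X (Sum.inr j) + C t) * (C (c j i) * FFe c hc j)

theorem pderiv_prod_lin (i : Fin n) (s : Finset (Fin p)) :
    pderiv i (∏ j ∈ s, lin (c j)) = ∑ j ∈ s, C (c j i) * ∏ k ∈ s.erase j, lin (c k) := by
  induction s using Finset.induction_on with
  | empty => simp
  | insert a s ha ih =>
    rw [Finset.prod_insert ha, pderiv_mul, ih, Finset.sum_insert ha, Finset.erase_insert ha,
      pderiv_lin, Finset.mul_sum]
    congr 1
    refine Finset.sum_congr rfl fun j hj => ?_
    have : j ≠ a := fun e => ha (e ▸ hj)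
    rw [Finset.erase_insert_of_ne this.symm, Finset.prod_insert (by simp [ha])]
    ring

theorem pderiv_FF (i : Fin n) : pderiv (Sum.inl i) (FF c hc) = ∑ j, C (c j i) * FFe c hc j := by
  rw [FF, pderiv_rename Sum.inl_injective, Arr.F]
  change rename _ (pderiv i (∏ j, lin (c j))) = _
  rw [pderiv_prod_lin, map_sum]
  refine Finset.sum_congr rfl fun j _ => ?_
  rw [map_mul, rename_C]
  rfl

theorem lin_mul_FFe (j : Fin p) : rename Sum.inl (lin (c j)) * FFe c hc j = FF c hc := by
  rw [FFe, FF, ← map_mul, ← (arr c hc).l_mul_Fe j]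
  rfl

theorem GG_add (t : ℂ) (u : ℂ) (i : Fin n) :
    GG c hc (t + u) i = GG c hc t i + C u * pderiv (Sum.inl i) (FF c hc) := by
  rw [GG, GG, pderiv_FF, Finset.mul_sum, ← Finset.sum_add_distrib]
  refine Finset.sum_congr rfl fun j _ => ?_
  rw [C_add]; ring

theorem FFe_identity (i : Fin n) (j : Fin p) :
    FF c hc * pderiv (Sum.inl i) (FFe c hc j) - pderiv (Sum.inl i) (FF c hc) * FFe c hc j =
      - (C (c j i) * FFe c hc j ^ 2) := by
  rw [← lin_mul_FFe c hc j, pderiv_mul, pderiv_rename Sum.inl_injective, pderiv_lin, rename_C]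
  ring

theorem GG_identity (t : ℂ) (i k : Fin n) :
    FF c hc * pderiv (Sum.inl i) (GG c hc t k) - pderiv (Sum.inl i) (FF c hc) * GG c hc t k =
      FF c hc * pderiv (Sum.inl k) (GG c hc t i) - pderiv (Sum.inl k) (FF c hc) * GG c hc t i := by
  have key : ∀ i k, FF c hc * pderiv (Sum.inl i) (GG c hc t k) -
      pderiv (Sum.inl i) (FF c hc) * GG c hc t k =
      ∑ j, (X (Sum.inr j) + C t) * (C (c j k) * -(C (c j i) * FFe c hc j ^ 2)) := by
    intro i k
    rw [GG, map_sum, Finset.mul_sum, Finset.mul_sum, ← Finset.sum_sub_distrib]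
    refine Finset.sum_congr rfl fun j _ => ?_
    rw [← FFe_identity, pderiv_mul, pderiv_C_mul, map_add, pderiv_C,
      pderiv_X_of_ne (by simp)]
    ring
  rw [key, key]
  refine Finset.sum_congr rfl fun j _ => ?_
  ring

variable {M : Type*} [CommRing M] [Algebra ℂ M] [Algebra (Rs n p) M]
  [IsScalarTower ℂ (Rs n p) M]

/-- Twisted derivatives on the localization at the product of the forms. -/
structure IsTw (D : Fin n → Module.End ℂ M) : Prop where
  leib : ∀ i (r : Rs n p) m, D i (algebraMap _ _ r * m) =
    algebraMap _ _ (pderiv (Sum.inl i) r) * m + algebraMap _ _ r * D i m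
  one : ∀ i, algebraMap (Rs n p) M (FF c hc) * D i 1 = algebraMap _ _ (GG c hc 0 i)
  unit : IsUnit (algebraMap (Rs n p) M (FF c hc))
  inj : Function.Injective (algebraMap (Rs n p) M)
  frac : ∀ m : M, ∃ (N : ℕ) (r : Rs n p), algebraMap (Rs n p) M (FF c hc) ^ N * m = algebraMap _ _ r

/-- Multiplication by a polynomial. -/
noncomputable def mu (M : Type*) [CommRing M] [Algebra ℂ M] [Algebra (Rs n p) M]
    [IsScalarTower ℂ (Rs n p) M] : Rs n p →ₐ[ℂ] Module.End ℂ M :=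
  (Algebra.lmul ℂ M).comp (IsScalarTower.toAlgHom ℂ (Rs n p) M)

@[simp] theorem mu_apply (r : Rs n p) (m : M) : mu M r m = algebraMap _ _ r * m := rfl

namespace IsTw

variable {c hc} {D : Fin n → Module.End ℂ M} (h : IsTw c hc D)
include h

theorem comm (i k : Fin n) : D i * D k = D k * D i := by
  have hlin : ∀ (r : Rs n p) m, D i (D k (algebraMap _ _ r * m)) - D k (D i (algebraMap _ _ r * m)) =
      algebraMap _ _ r * (D i (D k m) - D k (D i m)) := by
    intro r m
    rw [h.leib, h.leib, map_add, map_add, h.leib, h.leib, h.leib, h.leib,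
      pderiv_comm (Sum.inl i)]
    ring
  have h1 : ∀ i k, algebraMap (Rs n p) M (FF c hc) * (algebraMap (Rs n p) M (FF c hc) *
      D i (D k 1)) = algebraMap _ _ (FF c hc * pderiv (Sum.inl i) (GG c hc 0 k) -
        pderiv (Sum.inl i) (FF c hc) * GG c hc 0 k) +
        algebraMap (Rs n p) M (GG c hc 0 i) * algebraMap (Rs n p) M (GG c hc 0 k) := by
    intro i k
    have e := h.leib i (FF c hc) (D k 1)
    rw [h.one k, ← mul_one (algebraMap (Rs n p) M (GG c hc 0 k)), h.leib, mul_one] at e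
    have e' := h.one i
    have e'' := h.one k
    rw [map_sub, map_mul, map_mul, ← e', ← e'']
    rw [← e''] at e
    linear_combination (-algebraMap (Rs n p) M (FF c hc)) * e
  have h2 : D i (D k 1) - D k (D i 1) = 0 := by
    refine h.unit.mul_left_cancel (h.unit.mul_left_cancel ?_)
    rw [mul_sub, mul_sub, h1, h1, GG_identity]
    ring
  refine LinearMap.ext fun m => sub_eq_zero.1 ?_
  obtain ⟨N, r, hr⟩ := h.frac m
  refine (h.unit.pow N).mul_left_cancel ?_
  rw [Module.End.mul_apply, Module.End.mul_apply, ← map_pow, ← hlin, map_pow, hr,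
    ← mul_one (algebraMap (Rs n p) M r), hlin, h2]
  ring

theorem exists_power (N : ℕ) : ∃ m m' : M, algebraMap (Rs n p) M (FF c hc) ^ N * m = 1 ∧
    m = algebraMap (Rs n p) M (FF c hc) * m' ∧
    ∀ i, D i m = algebraMap (Rs n p) M (GG c hc (-N) i) * m' := by
  obtain ⟨u, hu⟩ := h.unit.exists_right_inv
  induction N with
  | zero =>
    refine ⟨1, u, by simp, hu.symm, fun i => h.unit.mul_left_cancel ?_⟩
    rw [h.one, mul_left_comm, hu, Nat.cast_zero, neg_zero, mul_one]
  | succ N ih =>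
    obtain ⟨m, m', h1, h2, h3⟩ := ih
    refine ⟨m', m' * u, by rw [pow_succ, mul_assoc, ← h2, h1],
      by rw [mul_left_comm, hu, mul_one], fun i => h.unit.mul_left_cancel ?_⟩
    have e := h.leib i (FF c hc) m'
    rw [← h2, h3] at e
    have : (-((N + 1 : ℕ) : ℂ)) = -(N : ℂ) + (-1) := by push_cast; ring
    rw [this, GG_add, C_neg, C_1, map_add, map_mul, map_neg, map_one]
    linear_combination -e + (algebraMap (Rs n p) M (pderiv (Sum.inl i) (FF c hc)) * m' -
      algebraMap (Rs n p) M (GG c hc (-N) i) * m') * hu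

end IsTw

end Twisted

section Image

variable {n p : ℕ} {c : Fin p → Fin n → ℂ} {hc : Sep c}

theorem emb_FF_mul (f : Sg n p) : emb (FF c hc) * f = (arr c hc).F • f := by
  rw [FF, emb_rename, Algebra.smul_def]

theorem emb_FFe_mul (j : Fin p) (f : Sg n p) : emb (FFe c hc j) * f = (arr c hc).Fe j • f := by
  rw [FFe, emb_rename, Algebra.smul_def]

theorem nc_d_empty (t : ℂ) (x : Finset (Fin n) → Sg n p) :
    (nc c hc t).d x ∅ = ∑ i, yop i (iota i x ∅) -
      ∑ j, emb (X (Sum.inr j) + C t) * (arr c hc).q j x ∅ := by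
  rw [Arr.Dif.d, nc_dl, nc_qB, Pi.sub_apply, Finset.sum_apply, Finset.sum_apply]
  rfl

theorem log_empty {x : Finset (Fin n) → Sg n p} (hx : (arr c hc).Log x) (j : Fin p) :
    ∑ i, C (c j i) * iota i x ∅ = emb (rename Sum.inl (lin (c j))) * (arr c hc).q j x ∅ := by
  have := congrFun (hx.q_spec j) ∅
  rw [iv_eq, Finset.sum_apply] at this
  rw [emb_rename, ← Algebra.smul_def]
  refine Eq.trans (Finset.sum_congr rfl fun i _ => ?_) this
  exact (smul_C_mul _ _).symm

theorem GG_empty {x : Finset (Fin n) → Sg n p} (hx : (arr c hc).Log x) (t : ℂ) :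
    ∑ i, emb (GG c hc t i) * iota i x ∅ =
      ∑ j, emb ((X (Sum.inr j) + C t) * FF c hc) * (arr c hc).q j x ∅ := by
  simp only [GG, map_sum, Finset.sum_mul]
  rw [Finset.sum_comm]
  refine Finset.sum_congr rfl fun j _ => ?_
  rw [← lin_mul_FFe c hc j, ← mul_assoc (X _ + C t), mul_right_comm, map_mul, mul_assoc]
  have e : ∀ a : ℂ, (emb (C a) : Sg n p) = C a := fun a => by rw [emb, rename_C]
  rw [← log_empty hx, Finset.mul_sum]
  refine Finset.sum_congr rfl fun i _ => ?_
  simp only [map_mul, e]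
  ring

variable (c hc) in
/-- The image of the first differential. -/
noncomputable def imd (t : ℂ) : Submodule (Weyl n p) (Sg n p) where
  carrier := {f | ∃ x ∈ (arr c hc).Ld (Weyl n p) 0 1, (nc c hc t).d x ∅ = f}
  add_mem' := by
    rintro _ _ ⟨x, hx, rfl⟩ ⟨y, hy, rfl⟩
    exact ⟨x + y, add_mem hx hy, by rw [Arr.Dif.d_add hx.1 hy.1]; rfl⟩
  zero_mem' := ⟨0, zero_mem _, by simp [nc_d_empty, Arr.q_zero]⟩
  smul_mem' := by
    rintro P _ ⟨x, hx, rfl⟩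
    exact ⟨P • x, Submodule.smul_mem _ P hx, by rw [Arr.Dif.d_smul hx.1]; rfl⟩

/-- The degree zero element with given coefficient. -/
noncomputable def e0 (u : Sg n p) : Finset (Fin n) → Sg n p := fun I => if I = ∅ then u else 0

theorem iota_e0 (i : Fin n) (u : Sg n p) : iota i (e0 u) = 0 := by
  ext1 I
  rw [iota_apply, e0, if_neg (Finset.insert_ne_empty _ _), smul_zero, ite_self]
  rfl

theorem iv_e0 (v : Fin n → Rg n) (u : Sg n p) : iv v (e0 u) = 0 := by
  rw [iv_eq]
  exact Finset.sum_eq_zero fun i _ => by rw [iota_e0, smul_zero]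

theorem log_e0 (u : Sg n p) : (arr c hc).Log (e0 u) := fun j => ⟨0, by rw [iv_e0, smul_zero]⟩

theorem q_e0 (j : Fin p) (u : Sg n p) : (arr c hc).q j (e0 u) = 0 :=
  Arr.q_eq (by rw [iv_e0, smul_zero])

theorem yop_sub_mem_imd (t : ℂ) (i : Fin n) (u : Sg n p) :
    yop i (emb (FF c hc) * u) - emb (GG c hc t i) * u ∈ imd c hc t := by
  have hv : ∀ j, ∑ k, (arr (p := p) c hc).c j k * (Pi.single i (arr c hc).F : Fin n → Rg n) k =
      (arr c hc).l j * (C (c j i) * (arr c hc).Fe j) := by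
    intro j
    rw [Finset.sum_eq_single i (fun k _ hk => by rw [Pi.single_eq_of_ne hk, mul_zero]) (by simp),
      Pi.single_eq_same, mul_left_comm, Arr.l_mul_Fe]
    rfl
  refine ⟨ev (Pi.single i (arr c hc).F : Fin n → Rg n) (e0 u), ⟨(log_e0 u).ev _ _ hv,
    Dg.ev (fun I hI => if_neg (fun e => hI (by rw [e]; rfl))) _⟩, ?_⟩
  rw [nc_d_empty]
  congr 1
  · rw [Finset.sum_eq_single i]
    · have := iota_ev_add i (Pi.single i (arr c hc).F : Fin n → Rg n) (e0 u)
      rw [iota_e0, map_zero, add_zero, Pi.single_eq_same] at this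
      rw [this, emb_FF_mul]
      rfl
    · intro k _ hk
      have := iota_ev_add k (Pi.single i (arr c hc).F : Fin n → Rg n) (e0 u)
      rw [iota_e0, map_zero, add_zero, Pi.single_eq_of_ne hk, zero_smul] at this
      rw [this, Pi.zero_apply, map_zero]
    · simp
  · rw [GG, map_sum, Finset.sum_mul]
    refine Finset.sum_congr rfl fun j _ => ?_
    rw [(log_e0 u).q_ev _ _ hv, q_e0, map_zero, sub_zero, map_mul, mul_assoc, map_mul, mul_assoc,
      emb_FFe_mul, Pi.smul_apply, mul_smul, smul_C_mul]
    congr 2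
    rw [emb, rename_C]

theorem xi_smul_mem (t : ℂ) {f : Sg n p} (i : Fin n) (hf : f ∈ imd c hc t) :
    vxi i * f ∈ imd c hc t :=
  Submodule.smul_mem _ (⟨_, xi_mem i⟩ : Weyl n p) hf

theorem pderiv_pow_mul (i : Fin n) (M : ℕ) (a r : Rs n p) : ∃ s,
    pderiv (Sum.inl i) (a ^ (M + 1) * r) = a ^ M * s := by
  refine ⟨((M : Rs n p) + 1) * pderiv (Sum.inl i) a * r + a * pderiv (Sum.inl i) r, ?_⟩
  rw [pderiv_mul, pderiv_pow]
  push_cast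
  ring

theorem exists_pow_mul_mem (f : Sg n p) : ∃ N₀ : ℕ, ∀ (M : ℕ) (t : ℂ), ∃ r : Rs n p,
    emb (FF c hc ^ (N₀ + M)) * f - emb (FF c hc ^ M * r) ∈ imd c hc t := by
  induction f using Sg_induction with
  | hadd f g hf hg =>
    obtain ⟨N, hN⟩ := hf
    obtain ⟨N', hN'⟩ := hg
    refine ⟨N + N', fun M t => ?_⟩
    obtain ⟨r, hr⟩ := hN (N' + M) t
    obtain ⟨r', hr'⟩ := hN' (N + M) t
    refine ⟨FF c hc ^ N' * r + FF c hc ^ N * r', ?_⟩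
    convert add_mem hr hr' using 1
    simp only [map_mul, map_add, map_pow]
    ring
  | hemb r => exact ⟨0, fun M t => ⟨r, by rw [zero_add, map_mul, sub_self]; exact zero_mem _⟩⟩
  | hxi i g hg =>
    obtain ⟨N, hN⟩ := hg
    refine ⟨N + 1, fun M t => ?_⟩
    obtain ⟨r, hr⟩ := hN (M + 1) t
    obtain ⟨s, hs⟩ := pderiv_pow_mul i M (FF c hc) r
    have h1 := xi_smul_mem t i hr
    have h2 := yop_sub_mem_imd (c := c) (hc := hc) t i (emb (FF c hc ^ M * r))
    have h3 : pderiv (Sum.inr (Sum.inl i)) (emb (FF c hc ^ (M + 1) * r)) = emb (FF c hc ^ M * s) :=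
      (pderiv_rename Sum.inr_injective _ _).trans (congrArg emb hs)
    rw [yop_apply, ← map_mul, ← mul_assoc (FF c hc), ← pow_succ', h3] at h2
    refine ⟨s + GG c hc t i * r, ?_⟩
    convert add_mem h1 h2 using 1
    simp only [map_mul, map_add, map_pow]
    ring

variable {m₀ : ℕ} (ℱ : (arr c hc).FreeData m₀)

theorem mem_imd_succ (ℱ : (arr c hc).FreeData m₀) (t : ℂ) {v : Sg n p}
    (hv : emb (FF c hc) * v ∈ imd c hc t) : v ∈ imd c hc (t + 1) := by
  obtain ⟨x, hx, e⟩ := hv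
  have hv0 : e0 v ∈ (arr c hc).Ld (Weyl n p) 1 1 :=
    ⟨log_e0 v, fun I hI => if_neg fun e => hI (by rw [e]; rfl)⟩
  obtain ⟨w, hw⟩ := nc_exact ℱ t 0 (⟨-x, neg_mem hx⟩, ⟨e0 v, hv0⟩) (by
    ext1
    · ext1
      rw [Arr.Dif.D_fst]
      funext I
      change (nc c hc t).d (-x) I + (arr c hc).F • e0 v I = 0
      rw [Arr.Dif.d_neg hx.1, Pi.neg_apply]
      by_cases hI : I = ∅
      · rw [hI, e, emb_FF_mul, e0, if_pos rfl, neg_add_cancel]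
      · rw [Arr.Dif.Dg_d hx.1 hx.2 I (fun h => hI (by simpa using h)), e0, if_neg hI]
        simp
    · ext1
      exact Arr.Ld_one_zero (Subtype.property _))
  have h2 := congrArg (fun z : (arr c hc).Cone (Weyl n p) 1 => (z.2 : Finset (Fin n) → Sg n p) ∅) hw
  change ((((nc c hc t).D 1 w).2 : (arr c hc).Ld (Weyl n p) 1 1) : Finset (Fin n) → Sg n p) ∅ =
    e0 v ∅ at h2
  rw [Arr.Dif.D_snd, nc_shift_d] at h2
  have hw2 : (w.2 : Finset (Fin n) → Sg n p) ∈ (arr c hc).Ld (Weyl n p) 0 1 :=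
    (Arr.Ld_one_succ (𝒜 := arr c hc) (T := Weyl n p) 1).le w.2.2
  refine ⟨-w.2, neg_mem hw2, ?_⟩
  rw [Arr.Dif.d_neg hw2.1, h2, e0, if_pos rfl]

theorem mem_imd_add (ℱ : (arr c hc).FreeData m₀) (N : ℕ) (t : ℂ) {v : Sg n p}
    (hv : emb (FF c hc ^ N) * v ∈ imd c hc t) : v ∈ imd c hc (t + N) := by
  induction N generalizing t with
  | zero => simpa using hv
  | succ N ih =>
    rw [pow_succ', map_mul, mul_assoc] at hv
    have := ih (t + 1) (mem_imd_succ ℱ t hv)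
    convert this using 2
    push_cast; ring

end Image

section Action

variable {n p : ℕ} {c : Fin p → Fin n → ℂ} {hc : Sep c}
  {M : Type*} [CommRing M] [Algebra ℂ M] [Algebra (Rs n p) M] [IsScalarTower ℂ (Rs n p) M]

/-- Evaluation of normally ordered symbols on twisted derivatives. -/
structure IsOrd (D : Fin n → Module.End ℂ M) (Φ : Sg n p →ₗ[ℂ] Module.End ℂ M) : Prop where
  one : Φ 1 = 1
  xi : ∀ i f, Φ (vxi i * f) = D i * Φ f
  em : ∀ (r : Rs n p) f, Φ (emb r * f) = Φ f * (mu M : Rs n p →ₐ[ℂ] Module.End ℂ M) r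

theorem IsTw.exists_isOrd {D : Fin n → Module.End ℂ M} (h : IsTw c hc D) :
    ∃ Φ : Sg n p →ₗ[ℂ] Module.End ℂ M, IsOrd D Φ := by
  obtain ⟨Φ, h1, h2, h3⟩ := exists_ordered_eval D h.comm (mu M : Rs n p →ₐ[ℂ] Module.End ℂ M)
  exact ⟨Φ, h1, h2, h3⟩

namespace IsOrd

variable {D : Fin n → Module.End ℂ M} {Φ : Sg n p →ₗ[ℂ] Module.End ℂ M} (hΦ : IsOrd D Φ)
include hΦ

theorem apply_emb (r : Rs n p) : Φ (emb r) = mu M r := by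
  rw [← mul_one (emb r), hΦ.em, hΦ.one, one_mul]

variable (h : IsTw c hc D)
include h

theorem map_yop (i : Fin n) (f : Sg n p) : Φ (yop i f) = Φ f * D i := by
  induction f using Sg_induction with
  | hadd f g hf hg => rw [map_add, map_add, hf, hg, map_add, add_mul]
  | hemb r =>
    have e : pderiv (Sum.inr (Sum.inl i)) (emb r) = emb (pderiv (Sum.inl i) r) :=
      pderiv_rename Sum.inr_injective _ _
    rw [yop_apply, e, map_sub, hΦ.xi, hΦ.apply_emb, hΦ.apply_emb]
    refine LinearMap.ext fun m => ?_
    rw [LinearMap.sub_apply, Module.End.mul_apply, Module.End.mul_apply, mu_apply, mu_apply,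
      mu_apply, h.leib]
    ring
  | hxi k f hf =>
    have : yop i (vxi k * f) = vxi k * yop i f := by
      rw [yop_apply, yop_apply, pderiv_mul, pderiv_X_of_ne (by simp)]
      ring
    rw [this, hΦ.xi, hf, hΦ.xi, mul_assoc]

theorem map_xop (i : Fin n) (f : Sg n p) : Φ (xop i f) = mu M (X (Sum.inl i) : Rs n p) * Φ f := by
  induction f using Sg_induction with
  | hadd f g hf hg => rw [map_add, map_add, hf, hg, map_add, mul_add]
  | hemb r =>
    rw [xop_apply, pderiv_emb, sub_zero, vx, ← emb_X, ← map_mul, hΦ.apply_emb, map_mul,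
      hΦ.apply_emb]
  | hxi k f hf =>
    have e : xop i (vxi k * f) = vxi k * xop i f -
        (if i = k then 1 else 0 : ℂ) • f := by
      rw [xop_apply, xop_apply, pderiv_mul, vxi, pderiv_X]
      by_cases hik : i = k
      · subst hik; simp; ring
      · simp [hik]; ring
    rw [e, map_sub, hΦ.xi, hf, map_smul, hΦ.xi]
    refine LinearMap.ext fun m => ?_
    change D k (mu M (X (Sum.inl i) : Rs n p) (Φ f m)) - (if i = k then 1 else 0 : ℂ) • Φ f m =
      mu M (X (Sum.inl i) : Rs n p) (D k (Φ f m))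
    rw [mu_apply, mu_apply, h.leib, pderiv_X]
    by_cases hik : i = k
    · subst hik; simp
    · simp [hik]

theorem d_kills {x : Finset (Fin n) → Sg n p} (hx : (arr c hc).Log x) (t : ℂ) {m m' : M}
    (hm : m = algebraMap (Rs n p) M (FF c hc) * m')
    (hD : ∀ i, D i m = algebraMap (Rs n p) M (GG c hc t i) * m') :
    Φ ((nc c hc t).d x ∅) m = 0 := by
  have h1 : ∀ i, Φ (yop i (iota i x ∅)) m =
      Φ (emb (GG c hc t i) * iota i x ∅) m' := fun i => by
    rw [hΦ.map_yop h, hΦ.em, Module.End.mul_apply, Module.End.mul_apply, hD, mu_apply]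
  have h2 : ∀ j, Φ (emb (X (Sum.inr j) + C t) * (arr c hc).q j x ∅) m =
      Φ (emb ((X (Sum.inr j) + C t) * FF c hc) * (arr c hc).q j x ∅) m' := fun j => by
    rw [hΦ.em, hΦ.em, Module.End.mul_apply, Module.End.mul_apply, mu_apply, mu_apply, hm,
      RingHom.map_mul, ← mul_assoc]
  rw [nc_d_empty, map_sub, map_sum, map_sum, LinearMap.sub_apply, LinearMap.sum_apply,
    LinearMap.sum_apply, Finset.sum_congr rfl fun i _ => h1 i, Finset.sum_congr rfl fun j _ => h2 j,
    ← LinearMap.sum_apply, ← LinearMap.sum_apply, ← map_sum, ← map_sum, GG_empty hx, sub_self]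

theorem mem_imd {m₀ : ℕ} (ℱ : (arr c hc).FreeData m₀) {f : Sg n p} (hf : Φ f 1 = 0) :
    f ∈ imd c hc 0 := by
  obtain ⟨N, hN⟩ := exists_pow_mul_mem (c := c) (hc := hc) f
  obtain ⟨r, x, hx, hr⟩ := hN 0 (-N)
  obtain ⟨m, m', h1, h2, h3⟩ := h.exists_power N
  have h4 := hΦ.d_kills h hx.1 _ h2 h3
  rw [hr, add_zero, pow_zero, one_mul, map_sub, hΦ.em, hΦ.apply_emb, LinearMap.sub_apply,
    Module.End.mul_apply, mu_apply, mu_apply, map_pow, h1, hf, zero_sub, neg_eq_zero] at h4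
  have h5 : algebraMap (Rs n p) M r = 0 := by
    rw [← mul_one (algebraMap _ _ r), ← h1, mul_left_comm, h4, mul_zero]
  have h6 : r = 0 := h.inj (by rw [h5, map_zero])
  have h7 : emb (FF c hc ^ N) * f ∈ imd c hc (-N) :=
    ⟨x, hx, by rw [hr, h6]; simp⟩
  have := mem_imd_add ℱ N _ h7
  rwa [neg_add_cancel] at this

end IsOrd

end Action

section Anti

variable {n p : ℕ}

/-- The substitution `s ↦ -s - 2`. -/
noncomputable def inv2 : Rs n p →ₐ[ℂ] Rs n p :=
  aeval (Sum.elim (fun i => X (Sum.inl i)) fun j => - X (Sum.inr j) - 2)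

theorem inv2_rename (r : Rg n) : (inv2 (rename Sum.inl r) : Rs n p) = rename Sum.inl r := by
  induction r using MvPolynomial.induction_on with
  | C a => rw [rename_C, inv2, aeval_C]; rfl
  | add f g hf hg => rw [map_add, map_add, hf, hg]
  | mul_X f k hf => rw [map_mul, map_mul, hf, rename_X, inv2, aeval_X, Sum.elim_inl]

theorem inv2_inl (i : Fin n) : (inv2 (X (Sum.inl i)) : Rs n p) = X (Sum.inl i) := by
  rw [inv2, aeval_X, Sum.elim_inl]

theorem inv2_inr (j : Fin p) : (inv2 (X (Sum.inr j)) : Rs n p) = - X (Sum.inr j) - 2 := by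
  rw [inv2, aeval_X, Sum.elim_inr]

theorem pderiv_inv2 (i : Fin n) (r : Rs n p) :
    pderiv (Sum.inl i) (inv2 r) = inv2 (pderiv (Sum.inl i) r) := by
  induction r using MvPolynomial.induction_on with
  | C a => simp [inv2]
  | add f g hf hg => simp only [map_add, hf, hg]
  | mul_X f k hf =>
    rw [map_mul, pderiv_mul, hf, pderiv_mul, map_add, map_mul, map_mul]
    congr 2
    rcases k with k | j
    · rw [inv2_inl, pderiv_X]
      by_cases hk : i = k
      · subst hk; simp
      · simp [hk]
    · rw [inv2_inr, pderiv_X_of_ne (by simp), map_zero, map_sub, map_neg,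
        pderiv_X_of_ne (by simp), neg_zero, zero_sub, neg_eq_zero]
      exact (pderiv (Sum.inl i)).map_natCast 2

variable {c : Fin p → Fin n → ℂ} {hc : Sep c}
  {M : Type*} [CommRing M] [Algebra ℂ M] [Algebra (Rs n p) M] [IsScalarTower ℂ (Rs n p) M]

omit [Algebra (Rs n p) M] [IsScalarTower ℂ (Rs n p) M] in
theorem end_neg_mul (a b : Module.End ℂ M) : -a * b = -(a * b) := rfl

omit [Algebra (Rs n p) M] [IsScalarTower ℂ (Rs n p) M] in
theorem end_mul_neg (a b : Module.End ℂ M) : a * -b = -(a * b) :=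
  LinearMap.ext fun m => map_neg a (b m)

/-- The opposite evaluation of symbols, through formal adjunction and `s ↦ -s - 2`. -/
structure IsAnti (D : Fin n → Module.End ℂ M) (ρ : Sg n p →ₗ[ℂ] Module.End ℂ M) : Prop where
  one : ρ 1 = 1
  xi : ∀ i f, ρ (vxi i * f) = -(ρ f * D i)
  em : ∀ (r : Rs n p) f, ρ (emb r * f) = (mu M : Rs n p →ₐ[ℂ] Module.End ℂ M) (inv2 r) * ρ f

theorem IsTw.exists_isAnti {D : Fin n → Module.End ℂ M} (h : IsTw c hc D) :
    ∃ ρ : Sg n p →ₗ[ℂ] Module.End ℂ M, IsAnti D ρ := by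
  obtain ⟨Φ, h1, h2, h3⟩ := exists_ordered_eval (fun i => MulOpposite.op (-(D i)))
    (fun i k => by rw [← MulOpposite.op_mul, ← MulOpposite.op_mul, end_neg_mul, end_mul_neg,
      end_neg_mul, end_mul_neg, h.comm])
    (AlgHom.toOpposite ((mu M : Rs n p →ₐ[ℂ] Module.End ℂ M).comp inv2) fun x y => by
      rw [commute_iff_eq, ← map_mul, ← map_mul, mul_comm])
  refine ⟨(MulOpposite.opLinearEquiv ℂ).symm.toLinearMap ∘ₗ Φ, ?_, fun i f => ?_, fun r f => ?_⟩
  · rw [LinearMap.comp_apply, h1]; rfl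
  · rw [LinearMap.comp_apply, h2, LinearMap.comp_apply, ← end_mul_neg]; rfl
  · rw [LinearMap.comp_apply, h3, LinearMap.comp_apply]; rfl

namespace IsAnti

variable {D : Fin n → Module.End ℂ M} {ρ : Sg n p →ₗ[ℂ] Module.End ℂ M} (hρ : IsAnti D ρ)
include hρ

theorem apply_emb (r : Rs n p) : ρ (emb r) = (mu M : Rs n p →ₐ[ℂ] Module.End ℂ M) (inv2 r) := by
  rw [← mul_one (emb r), hρ.em, hρ.one, mul_one]

theorem smul_apply (r : Rg n) (f : Sg n p) :
    ρ (r • f) = (mu M : Rs n p →ₐ[ℂ] Module.End ℂ M) (rename Sum.inl r) * ρ f := by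
  rw [Algebra.smul_def, ← emb_rename, hρ.em, inv2_rename]

variable (h : IsTw c hc D)
include h

theorem map_xop (i : Fin n) (f : Sg n p) :
    ρ (xop i f) = ρ f * (mu M : Rs n p →ₐ[ℂ] Module.End ℂ M) (X (Sum.inl i)) := by
  induction f using Sg_induction with
  | hadd f g hf hg => rw [map_add, map_add, hf, hg, map_add, add_mul]
  | hemb r =>
    rw [xop_apply, pderiv_emb, sub_zero, vx, ← emb_X, ← map_mul, hρ.apply_emb, mul_comm, map_mul,
      map_mul, inv2_inl, hρ.apply_emb]
  | hxi k f hf =>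
    have e : xop i (vxi k * f) = vxi k * xop i f -
        (if i = k then 1 else 0 : ℂ) • f := by
      rw [xop_apply, xop_apply, pderiv_mul, vxi, pderiv_X]
      by_cases hik : i = k
      · subst hik; simp; ring
      · simp [hik]; ring
    rw [e, map_sub, hρ.xi, hf, map_smul, hρ.xi]
    refine LinearMap.ext fun m => ?_
    change -(ρ f (mu M (X (Sum.inl i) : Rs n p) (D k m))) - (if i = k then 1 else 0 : ℂ) • ρ f m =
      -(ρ f (D k (mu M (X (Sum.inl i) : Rs n p) m)))
    rw [mu_apply, mu_apply, h.leib, pderiv_X, map_add, neg_add]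
    by_cases hik : i = k
    · subst hik; simp; abel
    · simp [hik]

theorem commute_s (f : Sg n p) {r : Rs n p} (hr : ∀ i, pderiv (Sum.inl i) r = 0) :
    ρ f * (mu M : Rs n p →ₐ[ℂ] Module.End ℂ M) r =
      (mu M : Rs n p →ₐ[ℂ] Module.End ℂ M) r * ρ f := by
  induction f using Sg_induction with
  | hadd f g hf hg => rw [map_add, add_mul, mul_add, hf, hg]
  | hemb r' => rw [hρ.apply_emb, ← map_mul, ← map_mul, mul_comm]
  | hxi i f hf =>
    have : D i * (mu M : Rs n p →ₐ[ℂ] Module.End ℂ M) r =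
        (mu M : Rs n p →ₐ[ℂ] Module.End ℂ M) r * D i := by
      refine LinearMap.ext fun m => ?_
      rw [Module.End.mul_apply, Module.End.mul_apply, mu_apply, mu_apply, h.leib, hr, map_zero,
        zero_mul, zero_add]
    rw [hρ.xi, end_neg_mul, end_mul_neg, mul_assoc, this, ← mul_assoc, hf, mul_assoc]

theorem smul_weyl (P : Weyl n p) (g : Sg n p) : ρ (P • g) = ρ g * ρ (P • (1 : Sg n p)) := by
  have key : ∃ Q, ∀ g, ρ (P • g) = ρ g * Q := by
    obtain ⟨P, hP⟩ := P
    change ∃ Q, ∀ g, ρ (P g) = ρ g * Q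
    induction hP using Algebra.adjoin_induction with
    | mem P hP =>
      rcases hP with ⟨i, rfl⟩ | ⟨i, rfl⟩ | ⟨j, rfl⟩
      · exact ⟨_, hρ.map_xop h i⟩
      · exact ⟨-(D i), fun g => by rw [end_mul_neg]; exact hρ.xi i g⟩
      · refine ⟨(mu M : Rs n p →ₐ[ℂ] Module.End ℂ M) (inv2 (X (Sum.inr j))), fun g => ?_⟩
        rw [hρ.commute_s h, ← hρ.em, emb_X]
        · rfl
        · intro i
          rw [pderiv_inv2, pderiv_X_of_ne (by simp), map_zero]
    | algebraMap a => exact ⟨algebraMap ℂ _ a, fun g => by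
        rw [Module.algebraMap_end_apply, map_smul, ← Algebra.commutes, Algebra.smul_def]⟩
    | add P P' _ _ h1 h2 =>
      obtain ⟨Q, hQ⟩ := h1
      obtain ⟨Q', hQ'⟩ := h2
      exact ⟨Q + Q', fun g => by rw [LinearMap.add_apply, map_add, hQ, hQ', mul_add]⟩
    | mul P P' _ _ h1 h2 =>
      obtain ⟨Q, hQ⟩ := h1
      obtain ⟨Q', hQ'⟩ := h2
      exact ⟨Q' * Q, fun g => by rw [Module.End.mul_apply, hQ, hQ', mul_assoc]⟩
  obtain ⟨Q, hQ⟩ := key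
  rw [hQ, hQ 1, hρ.one, one_mul]

theorem vanish {m₀ : ℕ} (ℱ : (arr c hc).FreeData m₀) (k : ℕ)
    (H : (arr c hc).Ld (Weyl n p) 0 k →ₗ[Weyl n p] Sg n p) (y : (arr c hc).Ld (Weyl n p) 0 k)
    (hy : ∀ I, ρ (y.1 I) 1 = 0) : ρ (H y) 1 = 0 := by
  induction k with
  | zero =>
    obtain ⟨P, hP⟩ := weyl_surj (y.1 ∅)
    have e := (H ∘ₗ (Arr.FreeData.zeroEquiv (𝒜 := arr c hc) (Weyl n p)).symm.toLinearMap).map_smul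
      P (1 : Sg n p)
    have e' : (Arr.FreeData.zeroEquiv (𝒜 := arr c hc) (Weyl n p)).symm (P • (1 : Sg n p)) = y := by
      rw [hP]
      exact (Arr.FreeData.zeroEquiv (𝒜 := arr c hc) (Weyl n p)).symm_apply_apply y
    rw [LinearMap.comp_apply, LinearEquiv.coe_coe, e'] at e
    rw [e, hρ.smul_weyl h, hP, Module.End.mul_apply, hy, map_zero]
  | succ k ih =>
    rw [← ℱ.retract (Weyl n p) k y, map_sum, map_sum, map_sum, LinearMap.sum_apply]
    refine Finset.sum_eq_zero fun i _ => ?_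
    refine ih (H ∘ₗ Arr.FreeData.natInvL (𝒜 := arr c hc) (Weyl n p) k 0 (k + 1) ∘ₗ
      ℱ.evL (Weyl n p) k i) _
      fun I => h.unit.mul_left_cancel ?_
    have e : (iv (ℱ.w i) y.1) I = (arr c hc).F • ℱ.κ i y.1 I :=
      congrFun (Arr.FreeData.κ_spec y.2.1 i) I
    have e' := congrArg (fun f => ρ f 1) e
    rw [hρ.smul_apply, Module.End.mul_apply, mu_apply] at e'
    refine (e'.symm.trans ?_).trans (mul_zero _).symm
    rw [iv_eq, Finset.sum_apply, map_sum, LinearMap.sum_apply]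
    refine Finset.sum_eq_zero fun k _ => ?_
    rw [Pi.smul_apply, hρ.smul_apply, Module.End.mul_apply, iota_apply]
    split_ifs
    · rw [map_zero, LinearMap.zero_apply, map_zero]
    · rw [map_zsmul, LinearMap.smul_apply, hy, smul_zero, map_zero]

theorem vanish_one {m₀ : ℕ} (ℱ : (arr c hc).FreeData m₀) (k : ℕ)
    (H : (arr c hc).Ld (Weyl n p) 1 k →ₗ[Weyl n p] Sg n p) (y : (arr c hc).Ld (Weyl n p) 1 k)
    (hy : ∀ I, ρ (y.1 I) 1 = 0) : ρ (H y) 1 = 0 := by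
  cases k with
  | zero =>
    have : y = 0 := Subtype.ext (Arr.Ld_one_zero y.2)
    rw [this, map_zero, map_zero, LinearMap.zero_apply]
  | succ k =>
    exact hρ.vanish h ℱ k
      (H ∘ₗ Submodule.inclusion (Arr.Ld_one_succ (𝒜 := arr c hc) (T := Weyl n p) k).ge)
      ⟨y.1, (Arr.Ld_one_succ (T := Weyl n p) k).le y.2⟩ hy

end IsAnti

end Anti

theorem Arr.Dif.exists_homotopy_cone {n p : ℕ} {R Y T : Type*} [CommRing R] [AddCommGroup Y]
    [Module R Y] {𝒜 : Arr R Y n p} [Ring T] [Module T Y] [SMulCommClass T R Y] (Δ : 𝒜.Dif T)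
    (hp : ∀ k, Module.Projective T (𝒜.Cone T k))
    (ex : ∀ k z, Δ.D k z = 0 → z ∈ LinearMap.range (Δ.D (k + 1)))
    (β : ∀ k, 𝒜.Cone T k →ₗ[T] 𝒜.Cone T k)
    (comm : ∀ k z, Δ.D k (β (k + 1) z) = β k (Δ.D k z))
    (h0 : ∀ z, β 0 z ∈ LinearMap.range (Δ.D 0)) :
    ∃ (H₀ : 𝒜.Ld T 0 n →ₗ[T] Y) (H₁ : 𝒜.Ld T 1 n →ₗ[T] Y),
      (∀ z, H₀ (Δ.D n z).1 + H₁ (Δ.D n z).2 = (β (n + 1) z).2.1 Finset.univ) ∧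
      (∀ y, ∃ x, 𝒜.Log x ∧ x Finset.univ = H₀ y) ∧
      ∀ (P : T) (y z : 𝒜.Ld T 0 n), z.1 = P • y.1 → H₀ z = P • H₀ y := by
  obtain ⟨h, hh⟩ := exists_homotopy_top (K := fun k => 𝒜.Cone T k) Δ.D Δ.D_D ex β comm h0 n
    fun z => Arr.cone_big (by omega) z
  let e : 𝒜.Cone T (n + 1) →ₗ[T] Y :=
    LinearMap.proj Finset.univ ∘ₗ (Submodule.subtype _) ∘ₗ LinearMap.snd T _ _
  refine ⟨e ∘ₗ h ∘ₗ LinearMap.inl T _ _, e ∘ₗ h ∘ₗ LinearMap.inr T _ _, fun z => ?_,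
    fun y => ⟨_, (h (LinearMap.inl T _ _ y)).2.2.1, rfl⟩, fun P y z hyz => ?_⟩
  swap
  · rw [show z = P • y from Subtype.ext hyz, map_smul]
  have h1 : e (h (Δ.D n z)) = (β (n + 1) z).2.1 Finset.univ := by rw [hh]; rfl
  rw [← h1]
  change e (h (LinearMap.inl T _ _ (Δ.D n z).1)) + e (h (LinearMap.inr T _ _ (Δ.D n z).2)) = _
  rw [← map_add, ← map_add]
  simp

section Assembly

variable {n p : ℕ} (c : Fin p → Fin n → ℂ) (hc : Sep c)

theorem mL_smul (B : Rs n p) (r : Rg n) (y : Sg n p) : mL B (r • y) = r • mL B y := by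
  rw [mL_apply, mL_apply, mul_smul_comm]

/-- Multiplication by a polynomial on homogeneous logarithmic elements. -/
noncomputable def bL (B : Rs n p) (a k : ℕ) :
    (arr c hc).Ld (Weyl n p) a k →ₗ[Weyl n p] (arr c hc).Ld (Weyl n p) a k where
  toFun x := ⟨cw (mL B).toAddMonoidHom x.1, x.2.1.cw _ (mL_smul B), x.2.2.cw _⟩
  map_add' x y := by ext1; exact map_add (cw (mL B).toAddMonoidHom) x.1 y.1
  map_smul' t x := by
    ext1
    funext I
    exact (mL B).map_smul t (x.1 I)

/-- Multiplication by a polynomial on the cone. -/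
noncomputable def bCone (B : Rs n p) (k : ℕ) :
    (arr c hc).Cone (Weyl n p) k →ₗ[Weyl n p] (arr c hc).Cone (Weyl n p) k :=
  LinearMap.prodMap (bL c hc B 0 k) (bL c hc B 1 k)

variable {c hc}

theorem d_cw_mL {B : Rs n p} (hB : ∀ i, pderiv (Sum.inl i) B = 0) (t : ℂ)
    {x : Finset (Fin n) → Sg n p} (hx : (arr c hc).Log x) :
    (nc c hc t).d (cw (mL B).toAddMonoidHom x) = cw (mL B).toAddMonoidHom ((nc c hc t).d x) := by
  rw [Arr.Dif.d, Arr.Dif.d, map_sub, nc_dl, nc_dl, nc_qB, nc_qB, map_sum, map_sum]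
  congr 1
  · refine Finset.sum_congr rfl fun i _ => ?_
    rw [iota_cw]
    funext I
    change yop i (emb B * iota i x I) = emb B * yop i (iota i x I)
    have : pderiv (Sum.inr (Sum.inl i)) (emb B) = 0 :=
      (pderiv_rename Sum.inr_injective _ _).trans (by rw [hB, map_zero])
    rw [yop_apply, yop_apply, pderiv_mul, this]
    ring
  · refine Finset.sum_congr rfl fun j _ => ?_
    rw [hx.q_cw _ (mL_smul B)]
    funext I
    exact mul_left_comm _ _ _

theorem D_bCone {B : Rs n p} (hB : ∀ i, pderiv (Sum.inl i) B = 0) (t : ℂ) (k : ℕ)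
    (z : (arr c hc).Cone (Weyl n p) (k + 1)) :
    (nc c hc t).D k (bCone c hc B (k + 1) z) = bCone c hc B k ((nc c hc t).D k z) := by
  ext1 <;> ext1
  · rw [Arr.Dif.D_fst]
    change (nc c hc t).d (cw (mL B).toAddMonoidHom z.1.1) +
      (arr c hc).F • cw (mL B).toAddMonoidHom z.2.1 = cw (mL B).toAddMonoidHom
        ((nc c hc t).d z.1.1 + (arr c hc).F • z.2.1)
    rw [map_add, d_cw_mL hB t z.1.2.1]
    congr 1
    funext I
    exact (mL_smul B _ _).symm
  · rw [Arr.Dif.D_snd, nc_shift_d]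
    change -(nc c hc (t + 1)).d (cw (mL B).toAddMonoidHom z.2.1) = cw (mL B).toAddMonoidHom
        (-(nc c hc t).shift.d z.2.1)
    rw [nc_shift_d, map_neg, d_cw_mL hB _ z.2.2.1]

theorem bCone_zero {B : Rs n p} (t : ℂ) {f : Sg n p}
    (hf : emb B - emb (FF c hc) * f ∈ imd c hc t) (z : (arr c hc).Cone (Weyl n p) 0) :
    bCone c hc B 0 z ∈ LinearMap.range ((nc c hc t).D 0) := by
  obtain ⟨P, hP⟩ := weyl_surj (z.1.1 ∅)
  have h1 := (imd c hc t).smul_mem P hf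
  have h2 : P • (emb B - emb (FF c hc) * f) = emb B * z.1.1 ∅ - (arr c hc).F • (P • f) := by
    rw [smul_sub, weyl_mul_emb, emb_FF_mul, ← hP, ← mul_one (emb B), weyl_mul_emb, mul_one]
  rw [h2] at h1
  obtain ⟨x, hx, e⟩ := h1
  have hv : e0 (P • f) ∈ (arr c hc).Ld (Weyl n p) 1 1 :=
    ⟨log_e0 _, fun I hI => if_neg fun e => hI (by rw [e]; rfl)⟩
  refine ⟨(⟨x, hx⟩, ⟨_, hv⟩), ?_⟩
  ext1
  · refine (Arr.FreeData.zeroEquiv (𝒜 := arr c hc) (Weyl n p)).injective ?_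
    change (nc c hc t).d x ∅ + (arr c hc).F • e0 (P • f) ∅ = emb B * z.1.1 ∅
    rw [e, e0, if_pos rfl, sub_add_cancel]
  · ext1
    rw [Arr.Ld_one_zero (Subtype.property _), Arr.Ld_one_zero (Subtype.property _)]

variable (n p) in
/-- The top degree generator. -/
noncomputable def e1 : Finset (Fin n) → Sg n p := fun I => if I = Finset.univ then 1 else 0

theorem iota_e1 (i : Fin n) (I : Finset (Fin n)) : ∃ a : ℂ, iota i (e1 n p) I = C a := by
  rw [iota_apply, e1]
  split_ifs
  · exact ⟨0, by rw [C_0]⟩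
  · exact ⟨sg i I, by rw [zsmul_one]; exact (map_intCast (C : ℂ →+* Sg n p) _).symm⟩
  · exact ⟨0, by rw [C_0, smul_zero]⟩

theorem iv_F_e1 (j : Fin p) : iv ((arr c hc).c j) ((arr c hc).F • e1 n p) =
    (arr c hc).l j • (arr c hc).Fe j • iv ((arr c hc).c j) (e1 n p) := by
  rw [map_smul, ← Arr.l_mul_Fe _ j, mul_smul]

theorem F_e1_mem : (arr c hc).F • e1 n p ∈ (arr c hc).Ld (Weyl n p) 0 n := by
  refine ⟨fun j => ⟨_, iv_F_e1 j⟩, fun I hI => ?_⟩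
  rw [Pi.smul_apply, e1, if_neg, smul_zero]
  rintro rfl
  simp at hI

theorem top_div {x : Finset (Fin n) → Sg n p} (hx : (arr c hc).Log x) :
    ∃ g, x Finset.univ = (arr c hc).F • g := by
  refine (arr c hc).div_prod Finset.univ _ fun j _ => ?_
  obtain ⟨w, hw⟩ := hc.ne j
  obtain ⟨k, hk⟩ : ∃ k, c j k ≠ 0 := by
    by_contra! h
    rw [Finset.sum_eq_zero fun k _ => by rw [h, zero_mul]] at hw
    exact zero_ne_one hw
  have h1 := congrFun (hx.q_spec j) (Finset.univ.erase k)
  rw [iv_eq, Finset.sum_apply, Finset.sum_eq_single k] at h1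
  · rw [Pi.smul_apply, iota_apply, if_neg (Finset.notMem_erase _ _),
      Finset.insert_erase (Finset.mem_univ k)] at h1
    refine ⟨sg k (Finset.univ.erase k) • (C (c j k)⁻¹ : Rg n) • (arr c hc).q j x
      (Finset.univ.erase k), ?_⟩
    have h2 := congrArg (fun y => sg k (Finset.univ.erase k) • (C (c j k)⁻¹ : Rg n) • y) h1
    have h3 : (arr (p := p) c hc).c j k = C (c j k) := rfl
    simp only [h3] at h2
    rw [smul_smul, ← C_mul, inv_mul_cancel₀ hk, C_1, one_smul, smul_smul, sg_mul_self, one_smul]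
      at h2
    rw [h2, Pi.smul_apply, smul_comm (C _) ((arr c hc).l j), smul_comm _ ((arr c hc).l j)]
  · intro i _ hi
    rw [Pi.smul_apply, iota_apply, if_pos (Finset.mem_erase.2 ⟨hi, Finset.mem_univ _⟩), smul_zero]
  · simp

theorem d_F_e1 (t : ℂ) (I : Finset (Fin n)) :
    (nc c hc t).d ((arr c hc).F • e1 n p) I =
      ∑ i, (vxi i * emb (FF c hc) - emb (GG c hc (t + 1) i)) * iota i (e1 n p) I := by
  have hq : ∀ j, (arr c hc).q j ((arr c hc).F • e1 n p) I =
      emb (FFe c hc j) * ∑ i, C (c j i) * iota i (e1 n p) I := fun j => by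
    rw [Arr.q_eq (iv_F_e1 j), Pi.smul_apply, ← emb_FFe_mul, iv_eq, Finset.sum_apply]
    congr 1
    exact Finset.sum_congr rfl fun i _ => smul_C_mul _ _
  have hy : ∀ i, yop i (iota i ((arr c hc).F • e1 n p) I) =
      (vxi i * emb (FF c hc) - emb (pderiv (Sum.inl i) (FF c hc))) * iota i (e1 n p) I :=
    fun i => by
    obtain ⟨a, ha⟩ := iota_e1 (p := p) i I
    have e : pderiv (Sum.inr (Sum.inl i)) (emb (FF c hc)) = emb (pderiv (Sum.inl i) (FF c hc)) :=
      pderiv_rename Sum.inr_injective _ _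
    rw [iota_smul, Pi.smul_apply, ← emb_FF_mul, ha, yop_apply, pderiv_mul, pderiv_C, e]
    ring
  rw [Arr.Dif.d, nc_dl, nc_qB, Pi.sub_apply, Finset.sum_apply, Finset.sum_apply]
  have hz : ∑ j, ((emb (X (Sum.inr j) + C t) : Sg n p) •
      (arr c hc).q j ((arr c hc).F • e1 n p)) I =
      ∑ i, emb (GG c hc t i) * iota i (e1 n p) I := by
    simp only [Pi.smul_apply, hq, GG, map_sum, Finset.sum_mul, smul_eq_mul, Finset.mul_sum]
    rw [Finset.sum_comm]
    refine Finset.sum_congr rfl fun i _ => Finset.sum_congr rfl fun j _ => ?_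
    have e : ∀ a : ℂ, (emb (C a) : Sg n p) = C a := fun a => by rw [emb, rename_C]
    rw [map_mul, map_mul, e]
    ring
  refine Eq.trans (congrArg₂ _ (Finset.sum_congr rfl fun i _ => hy i) hz) ?_
  rw [← Finset.sum_sub_distrib]
  refine Finset.sum_congr rfl fun i _ => ?_
  rw [GG_add, C_1, one_mul, map_add]
  ring

variable {M : Type*} [CommRing M] [Algebra ℂ M] [Algebra (Rs n p) M] [IsScalarTower ℂ (Rs n p) M]
  {D : Fin n → Module.End ℂ M}

theorem inv2_GG (i : Fin n) : inv2 (GG c hc 2 i) = - GG c hc 0 i := by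
  rw [GG, GG, map_sum, ← Finset.sum_neg_distrib]
  refine Finset.sum_congr rfl fun j _ => ?_
  have e : ∀ a : ℂ, (inv2 (C a) : Rs n p) = C a := fun a => by rw [inv2, aeval_C]; rfl
  rw [map_mul, map_mul, map_add, e, e, FFe, inv2_rename, inv2_inr, C_0]
  have : (C (2 : ℂ) : Rs n p) = 2 := map_ofNat C 2
  rw [this]
  ring

theorem IsAnti.d_top {ρ : Sg n p →ₗ[ℂ] Module.End ℂ M} (hρ : IsAnti D ρ) (h : IsTw c hc D)
    (I : Finset (Fin n)) : ρ ((nc c hc 1).d ((arr c hc).F • e1 n p) I) 1 = 0 := by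
  rw [d_F_e1, map_sum, LinearMap.sum_apply]
  refine Finset.sum_eq_zero fun i _ => ?_
  obtain ⟨a, ha⟩ := iota_e1 (p := p) i I
  rw [ha, mul_comm, ← smul_eq_C_mul, map_smul, LinearMap.smul_apply, map_sub, hρ.xi,
    hρ.apply_emb, hρ.apply_emb, FF, inv2_rename, ← FF, one_add_one_eq_two, inv2_GG]
  change a • (-(mu M (FF c hc) (D i 1)) - mu M (-GG c hc 0 i) 1) = 0
  rw [mu_apply, mu_apply, h.one, map_neg]
  simp

theorem exists_symm {m₀ : ℕ} (ℱ : (arr c hc).FreeData m₀) (h : IsTw c hc D)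
    {Φ ρ : Sg n p →ₗ[ℂ] Module.End ℂ M} (hΦ : IsOrd D Φ) (hρ : IsAnti D ρ) {B : Rs n p}
    (hB : ∀ i, pderiv (Sum.inl i) B = 0) {f : Sg n p}
    (hf : algebraMap _ _ B = Φ f (algebraMap _ _ (FF c hc))) :
    ∃ g, algebraMap (Rs n p) M (inv2 B) = ρ g (algebraMap _ _ (FF c hc)) := by
  have h1 : emb B - emb (FF c hc) * f ∈ imd c hc 0 := by
    refine hΦ.mem_imd h ℱ ?_
    rw [map_sub, hΦ.apply_emb, hΦ.em, LinearMap.sub_apply, Module.End.mul_apply, mu_apply,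
      mu_apply, mul_one, mul_one, hf, sub_self]
  have hproj := weylProjective (n := n) (p := p)
  obtain ⟨H₀, H₁, hH, htop, hlin⟩ := (nc c hc 0).exists_homotopy_cone (ℱ.projective_cone (Weyl n p))
    (nc_exact ℱ 0) (bCone c hc B) (D_bCone hB 0) (bCone_zero 0 h1)
  have hy1 : (arr c hc).F • e1 n p ∈ (arr c hc).Ld (Weyl n p) 1 (n + 1) :=
    (Arr.Ld_one_succ (𝒜 := arr c hc) (T := Weyl n p) n).ge F_e1_mem
  obtain ⟨P, hP⟩ := weyl_surj (emb (FF c hc))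
  obtain ⟨x, hx, hxe⟩ := htop ⟨_, F_e1_mem⟩
  obtain ⟨g, hg⟩ := top_div hx
  rw [hxe] at hg
  refine ⟨g, h.unit.mul_left_cancel ?_⟩
  have h2 := hH (0, ⟨_, hy1⟩)
  have h3 : H₀ ((nc c hc 0).D n (0, ⟨_, hy1⟩)).1 = P • H₀ ⟨_, F_e1_mem⟩ := by
    refine hlin P _ _ ?_
    rw [Arr.Dif.D_fst]
    change (nc c hc 0).d (0 : Finset (Fin n) → Sg n p) + (arr c hc).F • (arr c hc).F • e1 n p =
      P • ((arr c hc).F • e1 n p)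
    have e : (nc c hc 0).d (0 : Finset (Fin n) → Sg n p) = 0 := by
      simp [Arr.Dif.d, Arr.Dif.qB, Arr.q_zero]
    rw [e, zero_add]
    funext I
    rw [Pi.smul_apply, Pi.smul_apply, Pi.smul_apply, Pi.smul_apply, e1]
    split_ifs
    · rw [← emb_FF_mul, ← emb_FF_mul, weyl_mul_emb, hP, mul_one]
    · simp
  rw [h3, hg] at h2
  have h5 : ρ (H₁ ((nc c hc 0).D n (0, ⟨_, hy1⟩)).2) 1 = 0 := by
    refine hρ.vanish_one h ℱ n H₁ _ fun I => ?_
    rw [Arr.Dif.D_snd, nc_shift_d, Pi.neg_apply, map_neg, LinearMap.neg_apply, zero_add,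
      hρ.d_top h, neg_zero]
  have h7 : (bCone c hc B (n + 1) (0, ⟨_, hy1⟩)).2.1 Finset.univ = emb B * emb (FF c hc) := by
    change emb B * ((arr c hc).F • e1 n p) Finset.univ = _
    rw [Pi.smul_apply, e1, if_pos rfl, ← emb_FF_mul, mul_one]
  have h8 : (inv2 (FF c hc) : Rs n p) = FF c hc := inv2_rename _
  rw [h7] at h2
  have h4 := congrArg (fun f => ρ f 1) h2
  simp only [map_add, LinearMap.add_apply, h5, add_zero] at h4
  rw [hρ.smul_weyl h, hP, hρ.apply_emb, ← emb_FF_mul, hρ.em, hρ.em, hρ.apply_emb, h8] at h4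
  simp only [Module.End.mul_apply, mu_apply, mul_one] at h4
  rw [h4, mul_comm]

end Assembly

section Logarithmic

variable {n p : ℕ} {c : Fin p → Fin n → ℂ} (hc : Sep c)

/-- The derivative along a constant vector field. -/
noncomputable def dd (v : Fin n → ℂ) : Derivation ℂ (Rg n) (Rg n) :=
  mkDerivation ℂ fun k => C (v k)

theorem dd_X (v : Fin n → ℂ) (k : Fin n) : dd v (X k) = C (v k) := mkDerivation_X _ _ _

theorem derivation_lin (χ : Derivation ℂ (Rg n) (Rg n)) (v : Fin n → ℂ) :
    χ (lin v) = ∑ k, C (v k) * χ (X k) := by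
  rw [lin_eq, map_sum]
  refine Finset.sum_congr rfl fun k _ => ?_
  rw [← smul_eq_C_mul, χ.map_smul, smul_eq_C_mul]

theorem dd_lin (v a : Fin n → ℂ) : dd v (lin a) = C (∑ k, a k * v k) := by
  rw [derivation_lin, map_sum]
  refine Finset.sum_congr rfl fun k _ => ?_
  rw [dd_X, C_mul]

theorem smul_dd_mem {r : Rg n} {v : Fin n → ℂ}
    (h : ∀ j, lin (c j) ∣ r * C (∑ k, c j k * v k)) :
    r • dd v ∈ Arrangement.DA fun j => lin (c j) := fun j => by
  rw [Ideal.mem_span_singleton, Derivation.smul_apply, dd_lin, smul_eq_mul]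
  exact h j

/-- The coefficients of logarithmic derivations. -/
noncomputable def coeffDA (c : Fin p → Fin n → ℂ) (k : Fin n) :
    Arrangement.DA (fun j => lin (c j)) →ₗ[Rg n] Rg n where
  toFun χ := χ.1 (X k)
  map_add' _ _ := rfl
  map_smul' _ _ := rfl

theorem coeffDA_injective (c : Fin p → Fin n → ℂ) :
    Function.Injective (LinearMap.pi (coeffDA c)) := fun _ _ h =>
  Subtype.ext (MvPolynomial.derivation_ext fun k => congrFun h k)

/-- Freeness of the module of logarithmic derivations provides a basis with a dual family. -/
theorem exists_freeData
    (hfree : Module.Free (Rg n) (Arrangement.DA fun j => lin (c j))) :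
    ∃ m, Nonempty ((arr (p := p) c hc).FreeData m) := by
  have : IsNoetherian (Rg n) (Arrangement.DA fun j => lin (c j)) :=
    isNoetherian_of_injective _ (coeffDA_injective c)
  let b := Module.finBasis (Rg n) (Arrangement.DA fun j => lin (c j))
  have hF : ∀ v, (arr c hc).F • dd v ∈ Arrangement.DA fun j => lin (c j) := fun v =>
    smul_dd_mem fun j => Dvd.dvd.mul_right ⟨_, ((arr c hc).l_mul_Fe j).symm⟩ _
  have hFe : ∀ j v, ∑ k, c j k * v k = 0 →
      (arr c hc).Fe j • dd v ∈ Arrangement.DA fun j => lin (c j) := fun j v hv =>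
    smul_dd_mem fun i => by
      by_cases hij : i = j
      · rw [hij, hv, C_0, mul_zero]
        exact dvd_zero _
      · exact Dvd.dvd.mul_right (Finset.dvd_prod_of_mem _
          (Finset.mem_erase.2 ⟨hij, Finset.mem_univ _⟩)) _
  have hlog : ∀ i j, ∃ a, ∑ k, (arr c hc).c j k * coeffDA c k (b i) = (arr c hc).l j * a :=
    fun i j => by
    obtain ⟨a, ha⟩ := Ideal.mem_span_singleton.1 ((b i).2 j)
    exact ⟨a, (derivation_lin _ _).symm.trans ha⟩
  choose a ha using hlog
  refine ⟨_, ⟨⟨fun i k => b.repr ⟨_, hF (Pi.single k 1)⟩ i, fun i k => coeffDA c k (b i), a,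
    fun k k' => ?_, fun i j => ?_, ha⟩⟩⟩
  · have h1 := congrArg (coeffDA c k') (b.sum_repr ⟨_, hF (Pi.single k 1)⟩)
    rw [map_sum] at h1
    simp only [map_smul] at h1
    refine h1.trans ?_
    change (arr c hc).F * dd (Pi.single k 1) (X k') = _
    rw [dd_X, Pi.single_apply]
    by_cases hk : k = k'
    · simp [hk]
    · simp [hk, Ne.symm hk]
  · obtain ⟨e, he⟩ := hc.ne j
    have hv : ∀ k, ∑ k', c j k' * ((Pi.single k 1 - c j k • e : Fin n → ℂ) k') = 0 := fun k => by
      simp only [Pi.sub_apply, Pi.smul_apply, smul_eq_mul, mul_sub, Finset.sum_sub_distrib,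
        mul_left_comm _ (c j k), ← Finset.mul_sum, he, mul_one]
      simp [Pi.single_apply]
    refine ⟨b.repr ⟨_, hF e⟩ i, fun k => b.repr ⟨_, hFe j _ (hv k)⟩ i, fun k => ?_⟩
    have h1 : (⟨_, hF (Pi.single k 1)⟩ : Arrangement.DA fun j => lin (c j)) =
        (C (c j k) : Rg n) • ⟨_, hF e⟩ + (arr c hc).l j • ⟨_, hFe j _ (hv k)⟩ := by
      refine Subtype.ext (MvPolynomial.derivation_ext fun k' => ?_)
      change (arr c hc).F * dd (Pi.single k 1) (X k') = C (c j k) * ((arr c hc).F * dd e (X k')) +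
        (arr c hc).l j * ((arr c hc).Fe j * dd (Pi.single k 1 - c j k • e) (X k'))
      rw [dd_X, dd_X, dd_X, ← (arr c hc).l_mul_Fe j, Pi.sub_apply, Pi.smul_apply, smul_eq_mul,
        C_sub, C_mul]
      ring
    rw [h1, map_add, map_smul, map_smul]
    change C (c j k) * _ + _ = _ * C (c j k) + _
    rw [mul_comm]
    rfl

/-- Nonzero, pairwise nonproportional linear forms have coefficient vectors that separate. -/
theorem exists_coeff {l : Fin p → Rg n} (hl0 : ∀ i, l i ≠ 0) (hlh : ∀ i, (l i).IsHomogeneous 1)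
    (hprop : ∀ i j, i ≠ j → ∀ c : ℂ, l i ≠ c • l j) :
    ∃ c : Fin p → Fin n → ℂ, Sep c ∧ l = fun j => lin (c j) := by
  have hl : ∀ j, ∃ v : Fin n → ℂ, l j = lin v := fun j => by
    have h1 : l j ∈ homogeneousSubmodule (Fin n) ℂ 1 := hlh j
    rw [homogeneousSubmodule_one_eq_span_X] at h1
    obtain ⟨v, hv⟩ := (Submodule.mem_span_range_iff_exists_fun ℂ).1 h1
    refine ⟨v, ?_⟩
    rw [lin_eq, ← hv]
    exact Finset.sum_congr rfl fun k _ => smul_eq_C_mul _ _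
  choose c hl using hl
  refine ⟨c, ?_, funext hl⟩
  have hne : ∀ j, ∃ k, c j k ≠ 0 := fun j => by
    by_contra! h
    refine hl0 j ((hl j).trans ?_)
    rw [lin_eq]
    exact Finset.sum_eq_zero fun k _ => by rw [h, C_0, zero_mul]
  constructor
  · intro j
    obtain ⟨k, hk⟩ := hne j
    refine ⟨Pi.single k (c j k)⁻¹, ?_⟩
    simp [Pi.single_apply, hk]
  · intro i j hij
    obtain ⟨k, hk⟩ := hne i
    obtain ⟨k', hk'⟩ : ∃ k', c j k' * c i k - c j k * c i k' ≠ 0 := by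
      by_contra! h
      refine hprop j i hij.symm (c j k / c i k) ?_
      rw [hl i, hl j, ← map_smul]
      congr 1
      funext k'
      have h1 := h k'
      rw [Pi.smul_apply, smul_eq_mul, div_mul_eq_mul_div, eq_div_iff hk]
      exact sub_eq_zero.1 h1
    refine ⟨(c j k' * c i k - c j k * c i k')⁻¹ • (c i k • Pi.single k' 1 - c i k' • Pi.single k 1),
      ?_, ?_⟩
    · simp only [Pi.smul_apply, Pi.sub_apply, smul_eq_mul, mul_left_comm _ (_⁻¹ : ℂ),
        ← Finset.mul_sum, mul_sub, Finset.sum_sub_distrib, Pi.single_apply]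
      simp
      ring
    · simp only [Pi.smul_apply, Pi.sub_apply, smul_eq_mul, mul_left_comm _ (_⁻¹ : ℂ),
        ← Finset.mul_sum, mul_sub, Finset.sum_sub_distrib, Pi.single_apply]
      rw [← mul_sub, inv_mul_eq_one₀ hk']
      simp

end Logarithmic

section Bridge

variable {n p : ℕ} {c : Fin p → Fin n → ℂ} {hc : Sep c}

/-- The localization on which the twisted derivatives act. -/
abbrev Loc (c : Fin p → Fin n → ℂ) : Type :=
  Localization.Away (rename Sum.inl (∏ j, lin (c j)) : Rs n p)

variable {D : Fin n → Module.End ℂ (Loc c)}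

theorem isTw_of_isTwisted (hD : Arrangement.IsTwisted (fun j => lin (c j)) D) :
    IsTw c hc D := by
  have hF : (rename Sum.inl (∏ j, lin (c j)) : Rs n p) = FF c hc := rfl
  have hloc : IsLocalization.Away (FF c hc) (Loc c) := hF ▸
    inferInstanceAs (IsLocalization.Away (rename Sum.inl (∏ j, lin (c j)) : Rs n p) (Loc c))
  have hF0 : FF c hc ≠ 0 := by
    rw [← hF]
    refine (map_ne_zero_iff _ (rename_injective _ Sum.inl_injective)).2
      (Finset.prod_ne_zero_iff.2 fun j _ => ?_)
    intro e
    obtain ⟨w, hw⟩ := hc.ne j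
    have h1 := dd_lin w (c j)
    rw [e, map_zero, hw, C_1] at h1
    exact zero_ne_one h1
  refine ⟨hD.1, fun i => ?_, IsLocalization.Away.algebraMap_isUnit (FF c hc),
    IsLocalization.injective (M := Submonoid.powers (FF c hc)) (Loc c)
      (powers_le_nonZeroDivisors_of_noZeroDivisors hF0),
    fun m => ?_⟩
  · refine (hD.2 i).trans (congrArg _ ?_)
    rw [GG]
    refine Finset.sum_congr rfl fun j _ => ?_
    rw [C_0, add_zero, pderiv_lin, map_mul, rename_C, FFe, Arr.Fe]
    congr 4
    congr!
  · obtain ⟨N, r, h⟩ := IsLocalization.Away.surj (FF c hc) m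
    exact ⟨N, r, by rw [mul_comm, ← h]⟩

theorem IsOrd.commute_s {Φ : Sg n p →ₗ[ℂ] Module.End ℂ (Loc c)} (hΦ : IsOrd D Φ)
    (h : IsTw c hc D) (f : Sg n p) {r : Rs n p} (hr : ∀ i, pderiv (Sum.inl i) r = 0) :
    Φ f * mu (Loc c) r = mu (Loc c) r * Φ f := by
  induction f using Sg_induction with
  | hadd f g hf hg => rw [map_add, add_mul, mul_add, hf, hg]
  | hemb r' => rw [hΦ.apply_emb, ← map_mul, ← map_mul, mul_comm]
  | hxi i f hf =>
    have : D i * mu (Loc c) r = mu (Loc c) r * D i := by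
      refine LinearMap.ext fun m => ?_
      rw [Module.End.mul_apply, Module.End.mul_apply, mu_apply, mu_apply, h.leib, hr, map_zero,
        zero_mul, zero_add]
    rw [hΦ.xi, mul_assoc, hf, ← mul_assoc, this, mul_assoc]

theorem IsOrd.exists_of_mem {Φ : Sg n p →ₗ[ℂ] Module.End ℂ (Loc c)} (hΦ : IsOrd D Φ)
    (h : IsTw c hc D) {P : Module.End ℂ (Loc c)}
    (hP : P ∈ Arrangement.Wa (fun j => lin (c j)) D) : ∃ f, P = Φ f := by
  have key : ∀ f, ∃ g, P * Φ f = Φ g := by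
    induction hP using Algebra.adjoin_induction with
    | mem P hP =>
      intro f
      rcases hP with (⟨i, rfl⟩ | ⟨j, rfl⟩) | ⟨i, rfl⟩
      · exact ⟨xop i f, (hΦ.map_xop h i f).symm⟩
      · refine ⟨emb (X (Sum.inr j)) * f, ?_⟩
        rw [hΦ.em, hΦ.commute_s h]
        · rfl
        · exact fun i => pderiv_X_of_ne (by simp)
      · exact ⟨vxi i * f, (hΦ.xi i f).symm⟩
    | algebraMap a => exact fun f => ⟨a • f, by rw [map_smul, ← Algebra.smul_def]⟩
    | add P P' _ _ h1 h2 =>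
      intro f
      obtain ⟨g, hg⟩ := h1 f
      obtain ⟨g', hg'⟩ := h2 f
      exact ⟨g + g', by rw [add_mul, hg, hg', map_add]⟩
    | mul P P' _ _ h1 h2 =>
      intro f
      obtain ⟨g, hg⟩ := h2 f
      obtain ⟨g', hg'⟩ := h1 g
      exact ⟨g', by rw [mul_assoc, hg, hg']⟩
  obtain ⟨g, hg⟩ := key 1
  exact ⟨g, by rw [← hg, hΦ.one, mul_one]⟩

theorem mu_mem (r : Rs n p) : (mu (Loc c) : Rs n p →ₐ[ℂ] _) r ∈
    Arrangement.Wa (fun j => lin (c j)) D := by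
  induction r using MvPolynomial.induction_on with
  | C a =>
    have e : (mu (Loc c) : Rs n p →ₐ[ℂ] _) (C a) = algebraMap ℂ _ a := AlgHom.commutes _ a
    rw [e]
    exact Subalgebra.algebraMap_mem _ _
  | add f g hf hg => rw [map_add]; exact add_mem hf hg
  | mul_X f k hf =>
    rw [map_mul]
    refine mul_mem hf (Algebra.subset_adjoin ?_)
    rcases k with i | j
    · exact Or.inl (Or.inl ⟨i, rfl⟩)
    · exact Or.inl (Or.inr ⟨j, rfl⟩)

theorem IsAnti.mem {ρ : Sg n p →ₗ[ℂ] Module.End ℂ (Loc c)} (hρ : IsAnti D ρ) (f : Sg n p) :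
    ρ f ∈ Arrangement.Wa (fun j => lin (c j)) D := by
  induction f using Sg_induction with
  | hadd f g hf hg => rw [map_add]; exact add_mem hf hg
  | hemb r => rw [hρ.apply_emb]; exact mu_mem _
  | hxi i f hf =>
    rw [hρ.xi, ← neg_one_smul ℂ]
    exact Subalgebra.smul_mem _ (mul_mem hf (Algebra.subset_adjoin (Or.inr ⟨i, rfl⟩))) _

theorem inv2_rename_inr (b : MvPolynomial (Fin p) ℂ) :
    (inv2 (rename Sum.inr b) : Rs n p) = rename Sum.inr (bind₁ (fun i => - X i - 2) b) := by
  induction b using MvPolynomial.induction_on with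
  | C a => rw [rename_C, inv2, aeval_C, bind₁_C_right, rename_C]; rfl
  | add f g hf hg => simp only [map_add, hf, hg]
  | mul_X f k hf =>
    rw [map_mul, map_mul, map_mul, map_mul, hf, rename_X, inv2_inr, bind₁_X_right, map_sub,
      map_neg, rename_X, map_ofNat]

theorem bind₁_neg_sub_two (b : MvPolynomial (Fin p) ℂ) :
    bind₁ (fun i => - X i - 2) (bind₁ (fun i => - X i - 2) b) = b := by
  induction b using MvPolynomial.induction_on with
  | C a => rw [bind₁_C_right, bind₁_C_right]
  | add f g hf hg => rw [map_add, map_add, hf, hg]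
  | mul_X f k hf =>
    rw [map_mul, map_mul, hf, bind₁_X_right, map_sub, map_neg, bind₁_X_right, map_ofNat]
    ring

theorem pderiv_rename_inr (i : Fin n) (b : MvPolynomial (Fin p) ℂ) :
    pderiv (Sum.inl i) (rename Sum.inr b : Rs n p) = 0 := by
  induction b using MvPolynomial.induction_on with
  | C a => rw [rename_C, pderiv_C]
  | add f g hf hg => rw [map_add, map_add, hf, hg, add_zero]
  | mul_X f k hf =>
    rw [map_mul, pderiv_mul, hf, rename_X, pderiv_X_of_ne (by simp), zero_mul, mul_zero, add_zero]

theorem bind₁_mem_Bideal (hc : Sep c)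
    (hfree : Module.Free (Rg n) (Arrangement.DA fun j => lin (c j)))
    (hD : Arrangement.IsTwisted (fun j => lin (c j)) D) {b : MvPolynomial (Fin p) ℂ}
    (hb : b ∈ Arrangement.Bideal (fun j => lin (c j)) D) :
    bind₁ (fun i => - X i - 2) b ∈ Arrangement.Bideal (fun j => lin (c j)) D := by
  have h : IsTw c hc D := isTw_of_isTwisted hD
  obtain ⟨m, ⟨ℱ⟩⟩ := exists_freeData hc hfree
  obtain ⟨Φ, hΦ⟩ := h.exists_isOrd
  obtain ⟨ρ, hρ⟩ := h.exists_isAnti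
  obtain ⟨P, hP, e⟩ := hb
  obtain ⟨f, rfl⟩ := hΦ.exists_of_mem h hP
  obtain ⟨g, hg⟩ := exists_symm ℱ h hΦ hρ (fun i => pderiv_rename_inr i b) e
  rw [inv2_rename_inr] at hg
  exact ⟨_, hρ.mem g, hg⟩

end Bridge

end FreeArr

open Arrangement in
/-- If the central arrangement defined by `l₁,…,l_p` is free, then
`b(s₁,…,s_p)` belongs to the Bernstein ideal iff `b(−s₁−2,…,−s_p−2)` does. -/
theorem bernstein_ideal_symmetry
    (n p : ℕ) (hp : 1 ≤ p) (l : Fin p → MvPolynomial (Fin n) ℂ)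
    (hl0 : ∀ i, l i ≠ 0) (hlh : ∀ i, (l i).IsHomogeneous 1)
    (hprop : ∀ i j, i ≠ j → ∀ c : ℂ, l i ≠ c • l j)
    (hfree : Module.Free (MvPolynomial (Fin n) ℂ) (DA l))
    (D : Fin n → Module.End ℂ
      (Localization.Away (rename Sum.inl (∏ i, l i) : MvPolynomial (Fin n ⊕ Fin p) ℂ)))
    (hD : IsTwisted l D) :
    ∀ b : MvPolynomial (Fin p) ℂ,
      b ∈ Bideal l D ↔
        (bind₁ (fun i : Fin p => - X i - 2 : Fin p → MvPolynomial (Fin p) ℂ) b) ∈ Bideal l D := by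
  intro b
  obtain ⟨c, hc, rfl⟩ := FreeArr.exists_coeff hl0 hlh hprop
  refine ⟨FreeArr.bind₁_mem_Bideal hc hfree hD, fun hb => ?_⟩
  rw [← FreeArr.bind₁_neg_sub_two b]
  exact FreeArr.bind₁_mem_Bideal hc hfree hD hb
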